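/- Let k be an algebraically closed field of characteristic p > 0, G̃ a finite group, G a normal subgroup of G̃ such that the quotient group G̃/G is a p-group, and B = kG·b a G̃-stable block of kG whose defect groups are cyclic. Then every indecomposable kG-module lying in B is G̃-stable. -/

import Mathlib

open scoped TensorProduct

namespace Paper

/-! ### Torsion-theoretic notions over an arbitrary ring -/

section Torsion

variable (R : Type) [Ring R]

/-- `FacCl R C` : quotient modules of finite direct sums of modules in `C`. -/
def FacCl (C : ModuleCat.{0} R → Prop) (M : ModuleCat.{0} R) : Prop :=
  ∃ (n : ℕ) (N : Fin n → ModuleCat.{0} R), (∀ i, C (N i)) ∧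
    ∃ f : ((i : Fin n) → N i) →ₗ[R] M, Function.Surjective f

/-- `SubCl R C` : submodules of finite direct sums of modules in `C`. -/
def SubCl (C : ModuleCat.{0} R → Prop) (M : ModuleCat.{0} R) : Prop :=
  ∃ (n : ℕ) (N : Fin n → ModuleCat.{0} R), (∀ i, C (N i)) ∧
    ∃ f : M →ₗ[R] ((i : Fin n) → N i), Function.Injective f

/-- `AddCl R C` : direct summands of finite direct sums of modules in `C`. -/
def AddCl (C : ModuleCat.{0} R → Prop) (M : ModuleCat.{0} R) : Prop :=
  ∃ (n : ℕ) (N : Fin n → ModuleCat.{0} R), (∀ i, C (N i)) ∧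
    ∃ (s : M →ₗ[R] ((i : Fin n) → N i)) (r : ((i : Fin n) → N i) →ₗ[R] M),
      ∀ m : M, r (s m) = m

/-- `FiltCl R C` : modules having a finite filtration with subquotients in `add C`. -/
def FiltCl (C : ModuleCat.{0} R → Prop) (M : ModuleCat.{0} R) : Prop :=
  ∃ (l : ℕ) (F : Fin (l + 1) → Submodule R M),
    Monotone F ∧ F 0 = ⊥ ∧ F (Fin.last l) = ⊤ ∧
      ∀ i : Fin l, AddCl R C (ModuleCat.of R
        (↥(F i.succ) ⧸ Submodule.comap (F i.succ).subtype (F i.castSucc)))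

/-- A torsion class inside the ambient class `Amb` of modules:  a subclass of `Amb`
closed under quotient modules, finite direct sums and extensions. -/
def IsTorsionClassIn (Amb T : ModuleCat.{0} R → Prop) : Prop :=
  (∀ M, T M → Amb M) ∧
  (∀ (M N : ModuleCat.{0} R) (f : M →ₗ[R] N),
      Amb N → Function.Surjective f → T M → T N) ∧
  (∀ (n : ℕ) (N : Fin n → ModuleCat.{0} R), (∀ i, T (N i)) →
      Amb (ModuleCat.of R ((i : Fin n) → N i)) →
      T (ModuleCat.of R ((i : Fin n) → N i))) ∧
  (∀ (M : ModuleCat.{0} R) (A : Submodule R M), Amb M →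
      T (ModuleCat.of R ↥A) → T (ModuleCat.of R (↥M ⧸ A)) → T M)

/-- A torsion-free class inside the ambient class `Amb` of modules. -/
def IsTorsionFreeClassIn (Amb F : ModuleCat.{0} R → Prop) : Prop :=
  (∀ M, F M → Amb M) ∧
  (∀ (M N : ModuleCat.{0} R) (f : M →ₗ[R] N),
      Amb M → Function.Injective f → F N → F M) ∧
  (∀ (n : ℕ) (N : Fin n → ModuleCat.{0} R), (∀ i, F (N i)) →
      Amb (ModuleCat.of R ((i : Fin n) → N i)) →
      F (ModuleCat.of R ((i : Fin n) → N i))) ∧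
  (∀ (M : ModuleCat.{0} R) (A : Submodule R M), Amb M →
      F (ModuleCat.of R ↥A) → F (ModuleCat.of R (↥M ⧸ A)) → F M)

/-- The smallest torsion class (inside `Amb`) containing the class `C`. -/
def TorsClIn (Amb C : ModuleCat.{0} R → Prop) (M : ModuleCat.{0} R) : Prop :=
  ∀ T : ModuleCat.{0} R → Prop, IsTorsionClassIn R Amb T →
    (∀ X, Amb X → C X → T X) → T M

/-- The smallest torsion-free class (inside `Amb`) containing the class `C`. -/
def TorfClIn (Amb C : ModuleCat.{0} R → Prop) (M : ModuleCat.{0} R) : Prop :=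
  ∀ F : ModuleCat.{0} R → Prop, IsTorsionFreeClassIn R Amb F →
    (∀ X, Amb X → C X → F X) → F M

/-- The ambient class of finitely generated modules. -/
def FGMod (M : ModuleCat.{0} R) : Prop := Module.Finite R M

def ContravariantlyFinite (Amb C : ModuleCat.{0} R → Prop) : Prop :=
  ∀ M : ModuleCat.{0} R, Amb M →
    ∃ X : ModuleCat.{0} R, C X ∧ ∃ f : X →ₗ[R] M,
      ∀ Y : ModuleCat.{0} R, C Y → ∀ g : Y →ₗ[R] M,
        ∃ h : Y →ₗ[R] X, ∀ y : Y, f (h y) = g y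

def CovariantlyFinite (Amb C : ModuleCat.{0} R → Prop) : Prop :=
  ∀ M : ModuleCat.{0} R, Amb M →
    ∃ X : ModuleCat.{0} R, C X ∧ ∃ f : M →ₗ[R] X,
      ∀ Y : ModuleCat.{0} R, C Y → ∀ g : M →ₗ[R] Y,
        ∃ h : X →ₗ[R] Y, ∀ m : M, h (f m) = g m

def FunctoriallyFinite (Amb C : ModuleCat.{0} R → Prop) : Prop :=
  ContravariantlyFinite R Amb C ∧ CovariantlyFinite R Amb C

/-- `M` is (isomorphic to) a direct summand of `W`. -/
def IsSummandOf (X W : Type) [AddCommGroup X] [Module R X]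
    [AddCommGroup W] [Module R W] : Prop :=
  ∃ (s : X →ₗ[R] W) (r : W →ₗ[R] X), ∀ x : X, r (s x) = x

/-- An indecomposable module: nonzero and not the direct sum of two nonzero submodules. -/
def IndecMod (M : Type) [AddCommGroup M] [Module R M] : Prop :=
  Nontrivial M ∧ ∀ A B : Submodule R M, IsCompl A B → A = ⊥ ∨ B = ⊥

/-- A projective cover: a surjection from a projective module with superfluous kernel. -/
def IsProjCover {P V : Type} [AddCommGroup P] [Module R P]
    [AddCommGroup V] [Module R V] (π : P →ₗ[R] V) : Prop :=
  Module.Projective R P ∧ Function.Surjective π ∧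
    ∀ L : Submodule R P, LinearMap.ker π ⊔ L = ⊤ → L = ⊤

/-- An injective envelope: an injection into an injective module with essential image. -/
def IsInjEnv {V I : Type} [AddCommGroup V] [Module R V]
    [AddCommGroup I] [Module R I] (ι : V →ₗ[R] I) : Prop :=
  Module.Injective R I ∧ Function.Injective ι ∧
    ∀ L : Submodule R I, L ≠ ⊥ → L ⊓ LinearMap.range ι ≠ ⊥

/-- A central idempotent. -/
def IsCentralIdem (b : R) : Prop :=
  b * b = b ∧ ∀ a : R, a * b = b * a

/-- A block idempotent: a primitive idempotent of the center. -/
def IsBlockIdem (b : R) : Prop :=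
  b ≠ 0 ∧ IsCentralIdem R b ∧
    ∀ c d : R, IsCentralIdem R c → IsCentralIdem R d →
      c * d = 0 → d * c = 0 → b = c + d → c = 0 ∨ d = 0

/-- The module `U` lies in the block determined by the central idempotent `b`. -/
def LiesIn (b : R) (U : Type) [AddCommGroup U] [Module R U] : Prop :=
  ∀ u : U, b • u = u

/-- The `b`-component `b·M` of a module `M`, for a central idempotent `b`. -/
def blockComp (b : R) (hb : ∀ a : R, a * b = b * a)
    (M : Type) [AddCommGroup M] [Module R M] : Submodule R M where
  carrier := {m : M | b • m = m}
  add_mem' := by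
    intro x y hx hy
    simp only [Set.mem_setOf_eq] at *
    rw [smul_add, hx, hy]
  zero_mem' := by simp
  smul_mem' := by
    intro c m hm
    simp only [Set.mem_setOf_eq] at *
    rw [smul_smul, ← hb c, mul_smul, hm]

/-- The ambient class of finitely generated modules lying in the block of `b`. -/
def BlockFG (b : R) : ModuleCat.{0} R → Prop :=
  fun M => Module.Finite R M ∧ LiesIn R b M

end Torsion

/-! ### Bundled modules with a compatible `k`-structure -/

structure BModule (k R : Type) [CommSemiring k] [Ring R] [Algebra k R] : Type 1 where
  carrier : Type
  [isAddCommGroup : AddCommGroup carrier]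
  [isModuleK : Module k carrier]
  [isModuleR : Module R carrier]
  [isTower : IsScalarTower k R carrier]

attribute [instance] BModule.isAddCommGroup BModule.isModuleK BModule.isModuleR
  BModule.isTower

instance (k R : Type) [CommSemiring k] [Ring R] [Algebra k R] :
    CoeSort (BModule k R) Type :=
  ⟨BModule.carrier⟩

section GroupAlg

variable (k : Type) [Field k]

/-- A brick over a `k`-algebra `R`: a nonzero module all of whose `R`-endomorphisms
are given by scalars in `k`. -/
def IsBrickOver (R : Type) [Ring R] [Algebra k R]
    (U : Type) [AddCommGroup U] [Module R U] : Prop :=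
  Nontrivial U ∧ ∀ f : U →ₗ[R] U, ∃ c : k, ∀ u : U, f u = algebraMap k R c • u

/-- A module which is a finite direct sum of bricks with no nonzero homomorphisms
between non-isomorphic summands. -/
def IsSemibrickModule (R : Type) [Ring R] [Algebra k R]
    (M : Type) [AddCommGroup M] [Module R M] : Prop :=
  ∃ (m : ℕ) (T : Fin m → BModule k R),
    Nonempty (M ≃ₗ[R] ((i : Fin m) → ↥(T i))) ∧
    (∀ i, IsBrickOver k R ↥(T i)) ∧
    ∀ i j, IsEmpty (↥(T i) ≃ₗ[R] ↥(T j)) → ∀ f : ↥(T i) →ₗ[R] ↥(T j), f = 0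

/-- `V` is one-dimensional over `k`. -/
def OneDimOver (V : Type) [AddCommGroup V] [Module k V] : Prop :=
  ∃ v : V, v ≠ 0 ∧ ∀ w : V, ∃ c : k, w = c • v

/-- Triviality of the second group cohomology `H²(Q, kˣ)` (trivial action):
every `2`-cocycle is a `2`-coboundary. -/
def H2Trivial (Q : Type) [Group Q] : Prop :=
  ∀ α : Q → Q → kˣ,
    (∀ a b c : Q, α a b * α (a * b) c = α b c * α a (b * c)) →
    ∃ β : Q → kˣ, ∀ a b : Q, α a b = β a * β b * (β (a * b))⁻¹

/-- The `k`-algebra `R` is basic (for `k` algebraically closed this means that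
every simple module is one-dimensional over `k`). -/
def BasicAlg (R : Type) [Ring R] [Algebra k R] : Prop :=
  ∀ V : BModule k R, IsSimpleModule R ↥V → OneDimOver k ↥V

/-- `P` has exactly `n` isomorphism classes of modules satisfying it. -/
def RepClasses (R : Type) [Ring R] [Algebra k R]
    (P : BModule k R → Prop) (n : ℕ) : Prop :=
  ∃ V : Fin n → BModule k R, (∀ i, P (V i)) ∧
    (∀ i j, i ≠ j → IsEmpty (↥(V i) ≃ₗ[R] ↥(V j))) ∧
    ∀ W : BModule k R, P W → ∃ i, Nonempty (↥W ≃ₗ[R] ↥(V i))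

/-- The ring homomorphism `k[A] → k[B]` induced by a group homomorphism `f : A → B`. -/
noncomputable def MapAlong {A B : Type} [Group A] [Group B] (f : A →* B) :
    MonoidAlgebra k A →+* MonoidAlgebra k B :=
  MonoidAlgebra.mapDomainRingHom k f

/-- The `k[B]`-module `W` restricted along `f : A → B` is isomorphic to the
`k[A]`-module `U`; i.e. `W` is an extending module of `U`. -/
def ExtendsAlong {A B : Type} [Group A] [Group B] (f : A →* B)
    (U : Type) [AddCommGroup U] [Module (MonoidAlgebra k A) U]
    (W : Type) [AddCommGroup W] [Module (MonoidAlgebra k B) W] : Prop :=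
  ∃ φ : U ≃+ W, ∀ (a : MonoidAlgebra k A) (u : U),
    φ (a • u) = MapAlong k f a • φ u

/-- `η : U →+ W` exhibits the `k[B]`-module `W` as the module induced along
`f : A → B` from the `k[A]`-module `U`: `η` is `k[A]`-linear into the restriction
of `W`, and has the universal (left-adjoint) property. -/
def IsInducedUnit {A B : Type} [Group A] [Group B] (f : A →* B)
    (U : Type) [AddCommGroup U] [Module (MonoidAlgebra k A) U]
    (W : Type) [AddCommGroup W] [Module (MonoidAlgebra k B) W]
    (η : U →+ W) : Prop :=
  (∀ (a : MonoidAlgebra k A) (u : U), η (a • u) = MapAlong k f a • η u) ∧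
  ∀ (X : BModule k (MonoidAlgebra k B)) (g : U →+ ↥X),
    (∀ (a : MonoidAlgebra k A) (u : U), g (a • u) = MapAlong k f a • g u) →
    ∃! F : W →ₗ[MonoidAlgebra k B] ↥X, ∀ u : U, F (η u) = g u

/-- `W` is (a realization of) the induced module `Ind` of `U` along `f`. -/
def IsInducedAlong {A B : Type} [Group A] [Group B] (f : A →* B)
    (U : Type) [AddCommGroup U] [Module (MonoidAlgebra k A) U]
    (W : Type) [AddCommGroup W] [Module (MonoidAlgebra k B) W] : Prop :=
  ∃ η : U →+ W, IsInducedUnit k f U W η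

variable (Gt : Type) [Group Gt] (G : Subgroup Gt) [G.Normal]

/-- Conjugation `g ↦ x⁻¹ g x` as a homomorphism of the normal subgroup `G`. -/
def conjHom (x : Gt) : ↥G →* ↥G where
  toFun g := ⟨x⁻¹ * ↑g * x, ‹G.Normal›.conj_mem' (↑g) g.2 x⟩
  map_one' := by
    apply Subtype.ext
    simp
  map_mul' g h := by
    apply Subtype.ext
    push_cast
    group

/-- The `kG`-module `U` is stable under conjugation by `x`, i.e. `ˣU ≅ U`. -/
def IsStableAt (x : Gt) (U : Type) [AddCommGroup U]
    [Module (MonoidAlgebra k ↥G) U] : Prop :=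
  ∃ ψ : U ≃+ U, ∀ (a : MonoidAlgebra k ↥G) (u : U),
    ψ (MapAlong k (conjHom Gt G x) a • u) = a • ψ u

/-- The `kG`-module `U` is `G̃`-stable. -/
def IsGtStable (U : Type) [AddCommGroup U]
    [Module (MonoidAlgebra k ↥G) U] : Prop :=
  ∀ x : Gt, IsStableAt k Gt G x U

/-- The inertia group of an element `b ∈ kG` inside `G̃`:
all `x ∈ G̃` with `x b x⁻¹ = b`. -/
def inertia (b : MonoidAlgebra k ↥G) : Subgroup Gt where
  carrier := {x : Gt | Commute (MonoidAlgebra.of k Gt x) (MapAlong k G.subtype b)}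
  one_mem' := by
    simp only [Set.mem_setOf_eq, map_one]
    exact Commute.one_left _
  mul_mem' := by
    intro a c ha hc
    simp only [Set.mem_setOf_eq, map_mul] at *
    exact ha.mul_left hc
  inv_mem' := by
    intro a ha
    simp only [Set.mem_setOf_eq] at *
    have h1 : MonoidAlgebra.of k Gt a⁻¹ * MonoidAlgebra.of k Gt a = 1 := by
      rw [← map_mul, inv_mul_cancel, map_one]
    have h2 : MonoidAlgebra.of k Gt a * MonoidAlgebra.of k Gt a⁻¹ = 1 := by
      rw [← map_mul, mul_inv_cancel, map_one]
    show MonoidAlgebra.of k Gt a⁻¹ * MapAlong k G.subtype b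
        = MapAlong k G.subtype b * MonoidAlgebra.of k Gt a⁻¹
    calc MonoidAlgebra.of k Gt a⁻¹ * MapAlong k G.subtype b
        = MonoidAlgebra.of k Gt a⁻¹ * MapAlong k G.subtype b *
            (MonoidAlgebra.of k Gt a * MonoidAlgebra.of k Gt a⁻¹) := by
          rw [h2, mul_one]
      _ = MonoidAlgebra.of k Gt a⁻¹ * (MapAlong k G.subtype b * MonoidAlgebra.of k Gt a) *
            MonoidAlgebra.of k Gt a⁻¹ := by noncomm_ring
      _ = MonoidAlgebra.of k Gt a⁻¹ * (MonoidAlgebra.of k Gt a * MapAlong k G.subtype b) *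
            MonoidAlgebra.of k Gt a⁻¹ := by rw [← ha.eq]
      _ = (MonoidAlgebra.of k Gt a⁻¹ * MonoidAlgebra.of k Gt a) *
            (MapAlong k G.subtype b * MonoidAlgebra.of k Gt a⁻¹) := by noncomm_ring
      _ = MapAlong k G.subtype b * MonoidAlgebra.of k Gt a⁻¹ := by
          rw [h1, one_mul]

/-- Relative projectivity of a `k[A]`-module with respect to a subgroup `D ≤ A`:
any `k[A]`-linear surjection onto a quotient admitting a `k[D]`-linear splitting of
a lifting problem admits a `k[A]`-linear solution. -/
def RelProj (A : Type) [Group A] (D : Subgroup A)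
    (U : Type) [AddCommGroup U] [Module (MonoidAlgebra k A) U] : Prop :=
  ∀ (M N : BModule k (MonoidAlgebra k A))
    (f : ↥M →ₗ[MonoidAlgebra k A] ↥N) (g : U →ₗ[MonoidAlgebra k A] ↥N),
    Function.Surjective f →
    (∃ h : U →+ ↥M,
        (∀ (c : k) (u : U),
          h (algebraMap k (MonoidAlgebra k A) c • u)
            = algebraMap k (MonoidAlgebra k A) c • h u) ∧
        (∀ (d : ↥D) (u : U),
          h (MonoidAlgebra.of k A ↑d • u) = MonoidAlgebra.of k A ↑d • h u) ∧
        ∀ u : U, f (h u) = g u) →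
    ∃ h' : U →ₗ[MonoidAlgebra k A] ↥M, ∀ u : U, f (h' u) = g u

/-- `D` is a defect group of the block of `b`: `D` is minimal with respect to
inclusion among subgroups such that every module in the block is relatively
`D`-projective. -/
def IsDefectGroup (A : Type) [Group A] (b : MonoidAlgebra k A)
    (D : Subgroup A) : Prop :=
  (∀ U : BModule k (MonoidAlgebra k A),
      LiesIn (MonoidAlgebra k A) b ↥U → RelProj k A D ↥U) ∧
  ∀ D' : Subgroup A, D' ≤ D →
    (∀ U : BModule k (MonoidAlgebra k A),
        LiesIn (MonoidAlgebra k A) b ↥U → RelProj k A D' ↥U) →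
    D' = D

/-- Left finiteness (inside the ambient class `Amb`) of a module `S`: the smallest
torsion class containing `S` is functorially finite. -/
def IsLeftFiniteIn (R : Type) [Ring R] (Amb : ModuleCat.{0} R → Prop)
    (S : Type) [AddCommGroup S] [Module R S] : Prop :=
  FunctoriallyFinite R Amb (TorsClIn R Amb (fun X => Nonempty (↥X ≃ₗ[R] S)))

/-- `W₂` realizes the tensor product `W₁ ⊗ₖ V` with the diagonal `G̃`-action, where
`V` is a `k[G̃/G]`-module viewed as a `k[G̃]`-module via the projection. -/
def DiagTensorIso
    (W₁ : Type) [AddCommGroup W₁] [Module k W₁] [Module (MonoidAlgebra k Gt) W₁]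
    [IsScalarTower k (MonoidAlgebra k Gt) W₁]
    (V : Type) [AddCommGroup V] [Module k V] [Module (MonoidAlgebra k (Gt ⧸ G)) V]
    [IsScalarTower k (MonoidAlgebra k (Gt ⧸ G)) V]
    (W₂ : Type) [AddCommGroup W₂] [Module k W₂] [Module (MonoidAlgebra k Gt) W₂]
    [IsScalarTower k (MonoidAlgebra k Gt) W₂] : Prop :=
  ∃ θ : (W₁ ⊗[k] V) ≃ₗ[k] W₂,
    ∀ (x : Gt) (w : W₁) (v : V),
      θ ((MonoidAlgebra.of k Gt x • w) ⊗ₜ[k]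
          (MonoidAlgebra.of k (Gt ⧸ G) (QuotientGroup.mk x) • v))
        = MonoidAlgebra.of k Gt x • θ (w ⊗ₜ[k] v)

end GroupAlg

section CosetSum

theorem exists_out_eq_mul {G : Type*} [Group G] (H : Subgroup G) (g : G) :
    ∃ h ∈ H, (g : G ⧸ H).out = g * h := by
  refine ⟨g⁻¹ * (g : G ⧸ H).out, ?_, by group⟩
  rw [← QuotientGroup.eq]
  simp

attribute [local instance] Fintype.ofFinite

open scoped Classical

variable {G A B : Type*} [Group G] [Finite G] [AddCommGroup A] [AddCommGroup B]

/-- The sum of `f` over representatives of the left cosets of `H` contained in `S`. -/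
noncomputable def cosetSum (H : Subgroup G) (S : Set G) (f : G → A) : A :=
  ∑ x ∈ @Finset.univ {x : G ⧸ H // x.out ∈ S} (Fintype.ofFinite _), f x.1.out

theorem cosetSum_def (H : Subgroup G) (S : Set G) [Fintype {x : G ⧸ H // x.out ∈ S}]
    (f : G → A) : cosetSum H S f = ∑ x : {x : G ⧸ H // x.out ∈ S}, f x.1.out := by
  unfold cosetSum
  congr!

theorem cosetSum_eq_sum {H : Subgroup G} {S : Set G} {f : G → A}
    (hf : ∀ g, ∀ h ∈ H, f (g * h) = f g) {ι : Type*} [Fintype ι] (r : ι → G)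
    (hr : ∀ i, r i ∈ S) (hS : ∀ g ∈ S, ∀ h ∈ H, g * h ∈ S)
    (hu : ∀ g ∈ S, ∃! i, (r i)⁻¹ * g ∈ H) : cosetSum H S f = ∑ i, f (r i) := by
  rw [cosetSum_def]
  symm
  have key : ∀ i, ((r i : G) : G ⧸ H).out ∈ S := fun i => by
    obtain ⟨h, hh, e⟩ := exists_out_eq_mul H (r i)
    rw [e]; exact hS _ (hr i) _ hh
  refine Fintype.sum_bijective (fun i => ⟨(r i : G ⧸ H), key i⟩) ⟨?_, ?_⟩ _ _ ?_
  · intro i j hij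
    have h1 : ((r i : G) : G ⧸ H) = r j := congrArg Subtype.val hij
    obtain ⟨l, -, hl⟩ := hu (r j) (hr j)
    rw [hl i (QuotientGroup.eq.1 h1), hl j (by simp)]
  · rintro ⟨x, hx⟩
    obtain ⟨i, hi, -⟩ := hu _ hx
    refine ⟨i, Subtype.ext ?_⟩
    show ((r i : G) : G ⧸ H) = x
    rw [QuotientGroup.eq.2 hi]; simp
  · intro i
    obtain ⟨h, hh, e⟩ := exists_out_eq_mul H (r i)
    show f (r i) = f ((r i : G) : G ⧸ H).out
    rw [e, hf _ _ hh]

theorem existsUnique_out {H : Subgroup G} {S : Set G} (hS : ∀ g ∈ S, ∀ h ∈ H, g * h ∈ S)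
    {g : G} (hg : g ∈ S) : ∃! x : {x : G ⧸ H // x.out ∈ S}, x.1.out⁻¹ * g ∈ H := by
  obtain ⟨h, hh, e⟩ := exists_out_eq_mul H g
  refine ⟨⟨g, by rw [e]; exact hS _ hg _ hh⟩, ?_, ?_⟩
  · show (g : G ⧸ H).out⁻¹ * g ∈ H
    rw [e]; simpa using hh
  · rintro ⟨x, hx⟩ hx'
    refine Subtype.ext ?_
    show x = g
    rw [← QuotientGroup.eq.2 hx']; simp

theorem cosetSum_equiv {H H' : Subgroup G} {S S' : Set G} (σ : G ≃* G)
    (hH : ∀ g, σ g ∈ H' ↔ g ∈ H) (hS : ∀ g, σ g ∈ S' ↔ g ∈ S)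
    (hSH : ∀ g ∈ S, ∀ h ∈ H, g * h ∈ S) {f : G → A} (hf : ∀ g, ∀ h ∈ H', f (g * h) = f g) :
    cosetSum H S (fun g => f (σ g)) = cosetSum H' S' f := by
  rw [cosetSum_def]
  symm
  refine cosetSum_eq_sum hf (fun x : {x : G ⧸ H // x.out ∈ S} => σ x.1.out)
    (fun x => (hS _).2 x.2) ?_ ?_
  · intro g hg h hh
    obtain ⟨g, rfl⟩ := σ.surjective g
    obtain ⟨h, rfl⟩ := σ.surjective h
    rw [← map_mul, hS]
    exact hSH _ ((hS _).1 hg) _ ((hH _).1 hh)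
  · intro g hg
    obtain ⟨g, rfl⟩ := σ.surjective g
    simpa only [← map_inv, ← map_mul, hH] using existsUnique_out hSH ((hS _).1 hg)

theorem cosetSum_mul_left {H : Subgroup G} {S : Set G} (x : G)
    (hS : ∀ g, x * g ∈ S ↔ g ∈ S)
    (hSH : ∀ g ∈ S, ∀ h ∈ H, g * h ∈ S) {f : G → A} (hf : ∀ g, ∀ h ∈ H, f (g * h) = f g) :
    cosetSum H S (fun g => f (x * g)) = cosetSum H S f := by
  rw [cosetSum_def]
  symm
  refine cosetSum_eq_sum hf (fun y : {y : G ⧸ H // y.out ∈ S} => x * y.1.out)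
    (fun y => (hS _).2 y.2) hSH ?_
  intro g hg
  have h1 : x⁻¹ * g ∈ S := by rw [← hS]; simpa using hg
  simpa only [mul_inv_rev, mul_assoc] using existsUnique_out hSH h1

theorem cosetSum_subgroup {Q C : Subgroup G} (hQC : Q ≤ C) {f : G → A}
    (hf : ∀ g, ∀ h ∈ Q, f (g * h) = f g) :
    cosetSum (Q.subgroupOf C) Set.univ (fun c : C => f c) = cosetSum Q (C : Set G) f := by
  rw [cosetSum_def]
  symm
  refine cosetSum_eq_sum hf
    (fun y : {y : C ⧸ Q.subgroupOf C // y.out ∈ Set.univ} => ((y.1.out : C) : G))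
    (fun y => y.1.out.2) (fun g hg h hh => C.mul_mem hg (hQC hh)) ?_
  intro g hg
  exact existsUnique_out (H := Q.subgroupOf C) (S := Set.univ) (by simp)
    (g := ⟨g, hg⟩) (Set.mem_univ _)

theorem cosetSum_trans {H K : Subgroup G} (hHK : H ≤ K) {S : Set G}
    (hSK : ∀ g ∈ S, ∀ h ∈ K, g * h ∈ S) {f : G → A} (hf : ∀ g, ∀ h ∈ H, f (g * h) = f g) :
    cosetSum K S (fun g => cosetSum H (K : Set G) (fun x => f (g * x))) = cosetSum H S f := by
  symm
  rw [cosetSum_def K]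
  simp only [cosetSum_def H (K : Set G)]
  rw [← Fintype.sum_prod_type']
  refine cosetSum_eq_sum hf (fun y : {y : G ⧸ K // y.out ∈ S} ×
    {y : G ⧸ H // y.out ∈ (K : Set G)} => y.1.1.out * y.2.1.out)
    (fun y => hSK _ y.1.2 _ y.2.2) (fun g hg h hh => hSK _ hg _ (hHK hh)) ?_
  intro g hg
  obtain ⟨x, hx, hx'⟩ := existsUnique_out hSK hg
  obtain ⟨y, hy, hy'⟩ := existsUnique_out (H := H) (S := (K : Set G))
    (fun g hg h hh => K.mul_mem hg (hHK hh)) hx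
  refine ⟨(x, y), by simpa only [mul_inv_rev, mul_assoc] using hy, ?_⟩
  rintro ⟨x1, y1⟩ h1
  simp only [mul_inv_rev, mul_assoc] at h1
  have hx1 : x1 = x := hx' _ (by
    have := K.mul_mem (show y1.1.out ∈ K from y1.2) (hHK h1)
    simpa using this)
  subst hx1
  rw [hy' y1 h1]

theorem cosetSum_univ (H : Subgroup G) (f : G → A) :
    cosetSum H Set.univ f = ∑ x : G ⧸ H, f x.out := by
  rw [cosetSum_def]
  exact Fintype.sum_equiv (Equiv.subtypeUnivEquiv (fun x => Set.mem_univ _)) _ _ fun _ => rfl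

theorem cosetSum_add_compl (H : Subgroup G) (S : Set G) (f : G → A) :
    cosetSum H S f + cosetSum H Sᶜ f = cosetSum H Set.univ f := by
  rw [cosetSum_univ, cosetSum_def, cosetSum_def,
    ← Fintype.sum_subtype_add_sum_subtype (fun x : G ⧸ H => x.out ∈ S) (fun x => f x.out)]
  congr!

theorem cosetSum_self (H : Subgroup G) {f : G → A} (hf : ∀ g, ∀ h ∈ H, f (g * h) = f g) :
    cosetSum H (H : Set G) f = f 1 := by
  rw [cosetSum_eq_sum hf (fun _ : Unit => 1) (fun _ => H.one_mem)
    (fun g hg h hh => H.mul_mem hg hh)]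
  · simp
  · intro g hg
    exact ⟨(), by simpa using hg, fun _ _ => rfl⟩

theorem map_cosetSum {F : Type*} [FunLike F A B] [AddMonoidHomClass F A B] (φ : F)
    (H : Subgroup G) (S : Set G) (f : G → A) :
    φ (cosetSum H S f) = cosetSum H S (fun g => φ (f g)) := by
  unfold cosetSum; rw [map_sum]

theorem cosetSum_congr (H : Subgroup G) (S : Set G) {f f' : G → A} (h : ∀ g ∈ S, f g = f' g) :
    cosetSum H S f = cosetSum H S f' :=
  Finset.sum_congr rfl fun x _ => h _ x.2

theorem cosetSum_bot (f : G → A) : cosetSum ⊥ Set.univ f = ∑ g, f g :=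
  cosetSum_eq_sum (by simp) id (by simp) (by simp)
    (fun g _ => ⟨g, by simp, fun y hy => by simpa [inv_mul_eq_one] using hy⟩)

/-- The sum of an equivariant family over a finite `Q`-set is a sum of relative traces. -/
theorem sum_eq_sum_orbits {X : Type*} [MulAction G X] [Finite X] (R : G →* AddMonoid.End A)
    (F : X → A) (hF : ∀ (q : G) x, F (q • x) = R q (F x)) :
    ∑ x, F x = ∑ ω : MulAction.orbitRel.Quotient G X,
      cosetSum (MulAction.stabilizer G ω.out) Set.univ (fun g => R g (F ω.out)) := by
  rw [← (MulAction.selfEquivSigmaOrbitsQuotientStabilizer G X).symm.sum_comp, Fintype.sum_sigma]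
  refine Finset.sum_congr rfl fun ω _ => ?_
  rw [cosetSum_univ]
  refine Finset.sum_congr rfl fun y _ => ?_
  rw [← hF]
  congr 1
  conv_lhs => rw [← QuotientGroup.out_eq' y]
  rfl

end CosetSum

section Fitting

open Polynomial

/-- Fitting decomposition: for an element `x` of a finite-dimensional algebra there is an idempotent
polynomial in `x` on which `x` is invertible and off which it is nilpotent. -/
theorem exists_fitting {k A : Type*} [Field k] [Ring A] [Algebra k A] [FiniteDimensional k A]
    (x : A) : ∃ (P R : k[X]) (n : ℕ), aeval x P * aeval x P = aeval x P ∧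
      x * aeval x R = aeval x P ∧ x ^ n * (1 - aeval x P) = 0 := by
  have hx : IsIntegral k x := Algebra.IsIntegral.isIntegral x
  obtain ⟨q, hq, hndvd⟩ := (minpoly k x).exists_eq_pow_rootMultiplicity_mul_and_not_dvd
    (minpoly.ne_zero hx) 0
  rw [C_0, sub_zero] at hq hndvd
  set a := rootMultiplicity 0 (minpoly k x)
  have hcop : IsCoprime ((X : k[X]) ^ (a + 1)) q :=
    ((irreducible_X.coprime_iff_not_dvd).2 hndvd).pow_left
  obtain ⟨u, v, huv⟩ := hcop
  have h0 : aeval x ((X : k[X]) ^ (a + 1) * q) = 0 := by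
    rw [pow_succ', mul_assoc, ← hq, map_mul, minpoly.aeval, mul_zero]
  have h1 : 1 - aeval x (u * X ^ (a + 1)) = aeval x (v * q) := by
    rw [← map_one (aeval (R := k) x), ← huv, map_add, add_sub_cancel_left]
  refine ⟨u * X ^ (a + 1), u * X ^ a, a + 1, ?_, ?_, ?_⟩
  · have h2 : aeval x (u * X ^ (a + 1)) * (1 - aeval x (u * X ^ (a + 1))) = 0 := by
      rw [h1, ← map_mul,
        show u * X ^ (a + 1) * (v * q) = (u * v) * (X ^ (a + 1) * q) by ring, map_mul, h0, mul_zero]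
    rw [mul_sub, mul_one, sub_eq_zero] at h2
    exact h2.symm
  · rw [show u * X ^ (a + 1) = X * (u * X ^ a) by ring, map_mul (aeval x) X, aeval_X]
  · rw [h1, ← aeval_X_pow (R := k) x, ← map_mul,
      show (X : k[X]) ^ (a + 1) * (v * q) = v * (X ^ (a + 1) * q) by ring, map_mul, h0, mul_zero]

end Fitting

section Intertwiners

set_option linter.unusedSectionVars false

variable {k G V W X Y : Type*} [Field k] [Group G] [AddCommGroup V] [Module k V]
  [AddCommGroup W] [Module k W] [AddCommGroup X] [Module k X] [AddCommGroup Y] [Module k Y]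

/-- `f` commutes with the action of the elements of `H`. -/
def IntwOn (H : Subgroup G) (ρ : Representation k G V) (τ : Representation k G W)
    (f : V →ₗ[k] W) : Prop :=
  ∀ h ∈ H, ∀ v, f (ρ h v) = τ h (f v)

/-- `f` is a homomorphism of representations. -/
def Intw (ρ : Representation k G V) (τ : Representation k G W) (f : V →ₗ[k] W) : Prop :=
  ∀ h v, f (ρ h v) = τ h (f v)

/-- `ρ` is an indecomposable representation. -/
def Indec (ρ : Representation k G V) : Prop :=
  Nontrivial V ∧ ∀ e : Module.End k V, Intw ρ ρ e → e * e = e → e = 0 ∨ e = 1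

/-- Isomorphism of representations. -/
def RepIso (ρ : Representation k G V) (τ : Representation k G W) : Prop :=
  ∃ e : V ≃ₗ[k] W, Intw ρ τ e.toLinearMap

variable {ρ : Representation k G V} {τ : Representation k G W} {υ : Representation k G X}

namespace Intw

theorem one : Intw ρ ρ (1 : Module.End k V) := fun _ _ => rfl

theorem id : Intw ρ ρ LinearMap.id := fun _ _ => rfl

theorem zero : Intw ρ τ 0 := fun _ _ => by simp

theorem add {f g : V →ₗ[k] W} (hf : Intw ρ τ f) (hg : Intw ρ τ g) : Intw ρ τ (f + g) :=
  fun h v => by simp [hf h v, hg h v]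

theorem sub {f g : V →ₗ[k] W} (hf : Intw ρ τ f) (hg : Intw ρ τ g) : Intw ρ τ (f - g) :=
  fun h v => by simp [hf h v, hg h v]

theorem smul (c : k) {f : V →ₗ[k] W} (hf : Intw ρ τ f) : Intw ρ τ (c • f) :=
  fun h v => by simp [hf h v]

theorem sum {ι : Type*} (s : Finset ι) {f : ι → V →ₗ[k] W} (hf : ∀ i ∈ s, Intw ρ τ (f i)) :
    Intw ρ τ (∑ i ∈ s, f i) := fun h v => by
  simp only [LinearMap.sum_apply, map_sum]
  exact Finset.sum_congr rfl fun i hi => hf i hi h v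

theorem comp {f : W →ₗ[k] X} {g : V →ₗ[k] W} (hf : Intw τ υ f) (hg : Intw ρ τ g) :
    Intw ρ υ (f ∘ₗ g) := fun h v => by simp [hg h v, hf h (g v)]

theorem mul {f g : Module.End k V} (hf : Intw ρ ρ f) (hg : Intw ρ ρ g) : Intw ρ ρ (f * g) :=
  hf.comp hg

theorem pow {f : Module.End k V} (hf : Intw ρ ρ f) (n : ℕ) : Intw ρ ρ (f ^ n) := by
  induction n with
  | zero => exact one
  | succ n ih => rw [pow_succ]; exact ih.mul hf

theorem aeval {f : Module.End k V} (hf : Intw ρ ρ f) (P : Polynomial k) :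
    Intw ρ ρ (Polynomial.aeval f P) := by
  rw [Polynomial.aeval_eq_sum_range]
  exact Intw.sum _ fun i _ => (hf.pow i).smul _

theorem equiv_symm {e : V ≃ₗ[k] W} (he : Intw ρ τ e.toLinearMap) :
    Intw τ ρ e.symm.toLinearMap := fun h w => by
  apply e.injective
  have := he h (e.symm w)
  simp at this ⊢
  exact this.symm

theorem inv {f g : Module.End k V} (hf : Intw ρ ρ f) (h1 : f * g = 1) (h2 : g * f = 1) :
    Intw ρ ρ g := fun h v => by
  have e1 : ∀ v, g (f v) = v := fun v => LinearMap.congr_fun h2 v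
  have e2 : ∀ v, f (g v) = v := fun v => LinearMap.congr_fun h1 v
  conv_lhs => rw [← e2 v]
  rw [← hf, e1]

end Intw

theorem RepIso.refl (ρ : Representation k G V) : RepIso ρ ρ := ⟨LinearEquiv.refl k V, fun _ _ => rfl⟩

theorem RepIso.symm (h : RepIso ρ τ) : RepIso τ ρ :=
  let ⟨e, he⟩ := h; ⟨e.symm, he.equiv_symm⟩

theorem RepIso.trans (h : RepIso ρ τ) (h' : RepIso τ υ) : RepIso ρ υ :=
  let ⟨e, he⟩ := h; let ⟨e', he'⟩ := h'; ⟨e.trans e', Intw.comp he' he⟩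

theorem RepIso.of_bijective {f : V →ₗ[k] W} (hf : Intw ρ τ f) (hb : Function.Bijective f) :
    RepIso ρ τ := ⟨LinearEquiv.ofBijective f hb, hf⟩

/-- The restriction of a representation to an invariant subspace. -/
def subRep (ρ : Representation k G V) (S : Submodule k V) (hS : ∀ g, ∀ v ∈ S, ρ g v ∈ S) :
    Representation k G S where
  toFun g := (ρ g).restrict (hS g)
  map_one' := by ext; simp
  map_mul' g h := by ext; simp [LinearMap.restrict_apply]

@[simp]
theorem subRep_apply (ρ : Representation k G V) (S : Submodule k V)
    (hS : ∀ g, ∀ v ∈ S, ρ g v ∈ S) (g : G) (v : S) : (subRep ρ S hS g v : V) = ρ g v := rfl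

theorem subRep_asAlgebraHom (ρ : Representation k G V) (S : Submodule k V)
    (hS : ∀ g, ∀ v ∈ S, ρ g v ∈ S) (a : MonoidAlgebra k G) (v : S) :
    ((subRep ρ S hS).asAlgebraHom a v : V) = ρ.asAlgebraHom a v := by
  induction a using MonoidAlgebra.induction_linear with
  | zero => simp
  | add f g hf hg => simp [hf, hg]
  | single g r => simp

theorem Intw.range_mem {f : V →ₗ[k] W} (hf : Intw ρ τ f) (g : G) :
    ∀ w ∈ LinearMap.range f, τ g w ∈ LinearMap.range f := by
  rintro _ ⟨v, rfl⟩
  exact ⟨ρ g v, hf g v⟩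

theorem Intw.asAlgebraHom {f : V →ₗ[k] W} (hf : Intw ρ τ f) (a : MonoidAlgebra k G) (v : V) :
    f (ρ.asAlgebraHom a v) = τ.asAlgebraHom a (f v) := by
  induction a using MonoidAlgebra.induction_linear with
  | zero => simp
  | add f g hf hg => simp [hf, hg]
  | single g r => simp [hf g v]

theorem intw_of_central {c : MonoidAlgebra k G} (ρ : Representation k G V)
    (hc : ∀ a, a * c = c * a) : Intw ρ ρ (ρ.asAlgebraHom c) := fun g v => by
  have := congrArg ρ.asAlgebraHom (hc (MonoidAlgebra.of k G g))
  rw [map_mul, map_mul, Representation.asAlgebraHom_of] at this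
  exact (LinearMap.congr_fun this v).symm

section Local

variable [FiniteDimensional k V]

theorem Indec.isUnit_or_isNilpotent (hρ : Indec ρ) {f : Module.End k V} (hf : Intw ρ ρ f) :
    IsUnit f ∨ IsNilpotent f := by
  obtain ⟨P, R, n, h1, h2, h3⟩ := exists_fitting (k := k) f
  rcases hρ.2 _ (hf.aeval P) h1 with h | h
  · right
    rw [h, sub_zero, mul_one] at h3
    exact ⟨n, h3⟩
  · left
    rw [h] at h2
    exact IsUnit.of_mul_eq_one _ h2

theorem Indec.not_isUnit_iff (hρ : Indec ρ) {f : Module.End k V} (hf : Intw ρ ρ f) :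
    ¬ IsUnit f ↔ IsNilpotent f := by
  have := hρ.1
  refine ⟨fun h => (hρ.isUnit_or_isNilpotent hf).resolve_left h, fun h h' => h.not_isUnit h'⟩

theorem Indec.isUnit_or_of_add (hρ : Indec ρ) {f g : Module.End k V} (hf : Intw ρ ρ f)
    (hg : Intw ρ ρ g) (h : IsUnit (f + g)) : IsUnit f ∨ IsUnit g := by
  by_contra! hc
  obtain ⟨u, hu⟩ := h
  have h1 : (↑u⁻¹ : Module.End k V) * f + ↑u⁻¹ * g = 1 := by rw [← mul_add, ← hu]; simp
  have hi : Intw ρ ρ (↑u⁻¹ : Module.End k V) :=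
    (hf.add hg).inv (by rw [← hu]; simp) (by rw [← hu]; simp)
  have h2 : ¬ IsUnit ((↑u⁻¹ : Module.End k V) * f) := by simpa using hc.1
  have h3 : ¬ IsUnit ((↑u⁻¹ : Module.End k V) * g) := by simpa using hc.2
  rw [← eq_sub_iff_add_eq'] at h1
  apply h3
  rw [h1]
  exact ((hρ.not_isUnit_iff (hi.mul hf)).1 h2).isUnit_one_sub

theorem Indec.exists_isUnit_of_sum (hρ : Indec ρ) {ι : Type*} (s : Finset ι)
    {f : ι → Module.End k V} (hf : ∀ i ∈ s, Intw ρ ρ (f i)) (h : IsUnit (∑ i ∈ s, f i)) :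
    ∃ i ∈ s, IsUnit (f i) := by
  classical
  have := hρ.1
  induction s using Finset.induction_on with
  | empty => simp at h
  | insert a s ha ih =>
    rw [Finset.sum_insert ha] at h
    rcases hρ.isUnit_or_of_add (hf a (by simp)) (Intw.sum s fun i hi => hf i (by simp [hi])) h
      with h | h
    · exact ⟨a, by simp, h⟩
    · obtain ⟨i, hi, hi'⟩ := ih (fun i hi => hf i (by simp [hi])) h
      exact ⟨i, by simp [hi], hi'⟩

theorem Indec.bijective_of_isUnit_comp (hτ : Indec τ) (hV : Nontrivial V) {f : V →ₗ[k] W}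
    {g : W →ₗ[k] V} (hf : Intw ρ τ f) (hg : Intw τ ρ g)
    (h : IsUnit (g ∘ₗ f : Module.End k V)) : Function.Bijective f := by
  obtain ⟨u, hu⟩ := h
  have h1 : ∀ v, g (f v) = u.1 v := fun v => (LinearMap.congr_fun hu v).symm
  have h2 : ∀ v, u.2 (u.1 v) = v := fun v => LinearMap.congr_fun u.inv_val v
  have h2' : ∀ v, u.1 (u.2 v) = v := fun v => LinearMap.congr_fun u.val_inv v
  have hi : Intw ρ ρ u.2 := (hg.comp hf).inv (by rw [← hu]; exact u.val_inv)
    (by rw [← hu]; exact u.inv_val)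
  have hinj : Function.Injective f := fun a b hab => by
    rw [← h2 a, ← h2 b, ← h1, ← h1, hab]
  refine ⟨hinj, ?_⟩
  rcases hτ.2 (f ∘ₗ u.2 ∘ₗ g) (hf.comp (hi.comp hg)) (LinearMap.ext fun w => by
      show f (u.2 (g (f (u.2 (g w))))) = f (u.2 (g w))
      rw [h1, h2]) with h | h
  · exfalso
    obtain ⟨v, hv⟩ := exists_ne (0 : V)
    have h3 := LinearMap.congr_fun h (f v)
    simp only [LinearMap.comp_apply, h1, h2] at h3
    exact hv (hinj (by simpa using h3))
  · intro w
    exact ⟨u.2 (g w), LinearMap.congr_fun h w⟩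

theorem Indec.repIso_of_not_isNilpotent (hρ : Indec ρ) (hτ : Indec τ) {f : V →ₗ[k] W}
    {g : W →ₗ[k] V} (hf : Intw ρ τ f) (hg : Intw τ ρ g)
    (h : ¬ IsNilpotent (g ∘ₗ f : Module.End k V)) : RepIso ρ τ :=
  RepIso.of_bijective hf (hτ.bijective_of_isUnit_comp hρ.1 hf hg
    ((hρ.isUnit_or_isNilpotent (hg.comp hf)).resolve_right h))

/-- The residue homomorphism of the local endomorphism algebra of an indecomposable
representation over an algebraically closed field. -/
theorem Indec.exists_residue [IsAlgClosed k] (hρ : Indec ρ) :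
    ∃ t : Module.End k V → k, t 1 = 1 ∧
      (∀ f g, Intw ρ ρ f → Intw ρ ρ g → t (f + g) = t f + t g) ∧
      (∀ f g, Intw ρ ρ f → Intw ρ ρ g → t (f * g) = t f * t g) ∧
      (∀ f, Intw ρ ρ f → (t f = 0 ↔ ¬ IsUnit f)) := by
  have := hρ.1
  have ex : ∀ f : Module.End k V, ∃ l : k, ¬ IsUnit (f - l • 1) := fun f => by
    obtain ⟨l, hl⟩ := Module.End.exists_eigenvalue f
    refine ⟨l, fun h => ?_⟩
    obtain ⟨v, hv⟩ := hl.exists_hasEigenvector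
    refine hv.2 (((Module.End.isUnit_iff _).1 h).1 ?_)
    have := hv.apply_eq_smul
    simp [this]
  choose t ht using ex
  have hunit : ∀ l : k, l ≠ 0 → IsUnit (l • (1 : Module.End k V)) := fun l hl =>
    IsUnit.of_mul_eq_one (l⁻¹ • 1) (by simp [hl])
  have hI : ∀ f, Intw ρ ρ f → ∀ l : k, Intw ρ ρ (f - l • 1) := fun f hf l =>
    hf.sub (Intw.one.smul l)
  have uniq : ∀ f, Intw ρ ρ f → ∀ l : k, ¬ IsUnit (f - l • 1) → t f = l := by
    intro f hf l hl
    by_contra hne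
    have h1 : (f - l • 1) + (-1 : k) • (f - t f • 1) = (t f - l) • (1 : Module.End k V) := by
      simp only [sub_smul, neg_smul, one_smul]; abel
    have h2 : IsUnit ((f - l • 1) + (-1 : k) • (f - t f • 1)) := by
      rw [h1]; exact hunit _ (sub_ne_zero.2 hne)
    rcases hρ.isUnit_or_of_add (hI f hf l) ((hI f hf _).smul _) h2 with h | h
    · exact hl h
    · exact ht f (by rwa [neg_one_smul, IsUnit.neg_iff] at h)
  refine ⟨t, ?_, ?_, ?_, ?_⟩
  · exact uniq _ Intw.one _ (by simp)
  · intro f g hf hg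
    refine uniq _ (hf.add hg) _ fun h => ?_
    rw [show f + g - (t f + t g) • (1 : Module.End k V) = (f - t f • 1) + (g - t g • 1) by
      rw [add_smul]; abel] at h
    rcases hρ.isUnit_or_of_add (hI f hf _) (hI g hg _) h with h | h
    · exact ht f h
    · exact ht g h
  · intro f g hf hg
    refine uniq _ (hf.mul hg) _ fun h => ?_
    rw [show f * g - (t f * t g) • (1 : Module.End k V) =
        (f - t f • 1) * g + (t f) • (g - t g • 1) by
      rw [sub_mul, smul_sub, smul_smul]; simp] at h
    rcases hρ.isUnit_or_of_add ((hI f hf _).mul hg) ((hI g hg _).smul _) h with h | h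
    · obtain ⟨u, hu⟩ := h
      exact ht f (IsUnit.of_mul_eq_one (g * ↑u⁻¹) (by rw [← mul_assoc, ← hu, u.mul_inv]))
    · by_cases h0 : t f = 0
      · rw [h0, zero_smul] at h; simp at h
      · refine ht g ?_
        have := (hunit _ (inv_ne_zero h0)).mul h
        simpa [smul_smul, h0] using this
  · intro f hf
    refine ⟨fun h h' => ht f (by rw [h]; simpa using h'), fun h => uniq f hf 0 (by simpa using h)⟩

end Local

end Intertwiners

section RelTrace

set_option linter.unusedSectionVars false

attribute [local instance] Fintype.ofFinite

open scoped Classical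

variable {k G A B : Type*} [Field k] [Group G] [Finite G] [AddCommGroup A] [Module k A]
  [AddCommGroup B] [Module k B]

/-- `a` is fixed by the elements of `H`. -/
def IsFix (R : Representation k G A) (H : Subgroup G) (a : A) : Prop := ∀ h ∈ H, R h a = a

/-- The relative trace from `H` to `G`. -/
noncomputable def relTr (R : Representation k G A) (H : Subgroup G) : A →ₗ[k] A :=
  cosetSum H Set.univ fun g => R g

/-- `m` is the relative trace of an `H`-fixed element. -/
def InTr (R : Representation k G A) (H : Subgroup G) (m : A) : Prop :=
  ∃ a, IsFix R H a ∧ relTr R H a = m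

variable {R : Representation k G A} {R' : Representation k G B} {H K : Subgroup G} {a : A}

theorem relTr_apply (R : Representation k G A) (H : Subgroup G) (a : A) :
    relTr R H a = cosetSum H Set.univ fun g => R g a :=
  map_cosetSum (LinearMap.applyₗ (R := k) (M₂ := A) a) H Set.univ fun g => R g

theorem IsFix.apply_mul (ha : IsFix R H a) (g : G) : ∀ h ∈ H, R (g * h) a = R g a := fun h hh => by
  rw [map_mul, Module.End.mul_apply, ha h hh]

theorem isFix_relTr (ha : IsFix R H a) : IsFix R ⊤ (relTr R H a) := fun g _ => by
  rw [relTr_apply, map_cosetSum]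
  simp only [← Module.End.mul_apply, ← map_mul]
  exact cosetSum_mul_left (f := fun x => R x a) g (by simp) (by simp)
    (fun g h hh => ha.apply_mul g h hh)

theorem cosetSum_eq_relTr {C : Subgroup G} (hHC : H ≤ C) (ha : IsFix R H a) :
    relTr (R.comp C.subtype) (H.subgroupOf C) a = cosetSum H (C : Set G) fun g => R g a := by
  rw [relTr_apply]
  exact cosetSum_subgroup hHC (f := fun g => R g a) (fun g h hh => ha.apply_mul g h hh)

theorem cosetSum_relTr {C : Subgroup G} (hHC : H ≤ C) (ha : IsFix R H a) {S : Set G}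
    (hS : ∀ g ∈ S, ∀ h ∈ C, g * h ∈ S) :
    cosetSum C S (fun g => R g (relTr (R.comp C.subtype) (H.subgroupOf C) a)) =
      cosetSum H S fun g => R g a := by
  rw [cosetSum_eq_relTr hHC ha,
    ← cosetSum_trans hHC hS (f := fun g => R g a) (fun g h hh => ha.apply_mul g h hh)]
  congr 1
  funext g
  rw [map_cosetSum]
  simp only [← Module.End.mul_apply, ← map_mul]

theorem relTr_relTr {C : Subgroup G} (hHC : H ≤ C) (ha : IsFix R H a) :
    relTr R C (relTr (R.comp C.subtype) (H.subgroupOf C) a) = relTr R H a := by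
  rw [relTr_apply, relTr_apply R H, cosetSum_relTr hHC ha (by simp)]

theorem map_relTr (φ : A →ₗ[k] B) (hφ : ∀ g a, φ (R g a) = R' g (φ a)) (H : Subgroup G) (a : A) :
    φ (relTr R H a) = relTr R' H (φ a) := by
  rw [relTr_apply, relTr_apply, map_cosetSum]
  simp only [hφ]

theorem IsFix.map (φ : A →ₗ[k] B) (hφ : ∀ g a, φ (R g a) = R' g (φ a)) (ha : IsFix R H a) :
    IsFix R' H (φ a) := fun h hh => by rw [← hφ, ha h hh]

theorem InTr.map (φ : A →ₗ[k] B) (hφ : ∀ g a, φ (R g a) = R' g (φ a)) {m : A} (hm : InTr R H m) :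
    InTr R' H (φ m) := by
  obtain ⟨a, ha, rfl⟩ := hm
  exact ⟨φ a, ha.map φ hφ, (map_relTr φ hφ H a).symm⟩

theorem relTr_comp_equiv (σ : G ≃* G) (hσ : ∀ g, σ g ∈ K ↔ g ∈ H) (ha : IsFix R K a) :
    relTr (R.comp (σ : G →* G)) H a = relTr R K a := by
  rw [relTr_apply, relTr_apply]
  exact cosetSum_equiv (f := fun g => R g a) σ hσ (by simp) (by simp)
    (fun g h hh => ha.apply_mul g h hh)

theorem InTr.add {m m' : A} (hm : InTr R H m) (hm' : InTr R H m') : InTr R H (m + m') := by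
  obtain ⟨a, ha, rfl⟩ := hm
  obtain ⟨b, hb, rfl⟩ := hm'
  exact ⟨a + b, fun h hh => by rw [map_add, ha h hh, hb h hh], map_add _ _ _⟩

theorem InTr.zero : InTr R H 0 := ⟨0, fun _ _ => map_zero _, map_zero _⟩

theorem InTr.sum {ι : Type*} (s : Finset ι) {f : ι → A} (hf : ∀ i ∈ s, InTr R H (f i)) :
    InTr R H (∑ i ∈ s, f i) := by
  induction s using Finset.induction_on with
  | empty => exact InTr.zero
  | insert a s ha ih =>
    rw [Finset.sum_insert ha]
    exact (hf a (by simp)).add (ih fun i hi => hf i (by simp [hi]))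

theorem relTr_bot (R : Representation k G A) (a : A) : relTr R ⊥ a = ∑ g, R g a := by
  rw [relTr_apply, cosetSum_bot]

theorem isFix_bot : IsFix R ⊥ a := fun h hh => by
  rw [Subgroup.mem_bot.1 hh, map_one, Module.End.one_apply]

theorem relTr_top (ha : IsFix R ⊤ a) : relTr R ⊤ a = a := by
  rw [relTr_apply, ← Subgroup.coe_top,
    cosetSum_self _ (f := fun g => R g a) (fun g h hh => ha.apply_mul g h hh),
    map_one, Module.End.one_apply]

theorem sum_eq_sum_relTr {X : Type*} [MulAction G X] [Finite X] (F : X → A)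
    (hF : ∀ (q : G) x, F (q • x) = R q (F x)) :
    ∑ x, F x = ∑ ω : MulAction.orbitRel.Quotient G X,
      relTr R (MulAction.stabilizer G ω.out) (F ω.out) := by
  have := sum_eq_sum_orbits
    ((Module.toAddMonoidEnd (Module.End k A) A : Module.End k A →* AddMonoid.End A).comp R) F hF
  rw [this]
  refine Finset.sum_congr rfl fun ω _ => ?_
  rw [relTr_apply]; rfl

theorem isFix_stabilizer {X : Type*} [MulAction G X] {F : X → A}
    (hF : ∀ (q : G) x, F (q • x) = R q (F x)) (x : X) :
    IsFix R (MulAction.stabilizer G x) (F x) := fun h hh => by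
  rw [← hF, MulAction.mem_stabilizer_iff.1 hh]

/-- A sum over a set with a free action is a trace from the trivial group. -/
theorem inTr_bot_of_free {X : Type*} [MulAction G X] [Finite X] (F : X → A)
    (hF : ∀ (q : G) x, F (q • x) = R q (F x)) (hfree : ∀ (q : G) (x : X), q • x = x → q = 1) :
    InTr R ⊥ (∑ x, F x) := by
  rw [sum_eq_sum_relTr F hF]
  refine InTr.sum _ fun ω _ => ⟨F ω.out, isFix_bot, ?_⟩
  rw [show MulAction.stabilizer G ω.out = ⊥ from (Subgroup.eq_bot_iff_forall _).2 fun q hq =>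
    hfree q _ hq]

end RelTrace

section Hom

set_option linter.unusedSectionVars false

open Representation

variable {k G V W X : Type*} [Field k] [Group G] [Finite G] [AddCommGroup V] [Module k V]
  [AddCommGroup W] [Module k W] [AddCommGroup X] [Module k X]
  {ρ : Representation k G V} {τ : Representation k G W} {υ : Representation k G X}
  {H : Subgroup G}

theorem isFix_linHom {f : V →ₗ[k] W} : IsFix (linHom ρ τ) H f ↔ IntwOn H ρ τ f := by
  constructor
  · intro hf h hh v
    conv_lhs => rw [← hf h hh]
    simp
  · intro hf h hh
    ext v
    simp [← hf h hh]

theorem isFix_linHom_top {f : V →ₗ[k] W} : IsFix (linHom ρ τ) ⊤ f ↔ Intw ρ τ f := by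
  rw [isFix_linHom]
  exact ⟨fun h g => h g trivial, fun h g _ => h g⟩

theorem intw_relTr {f : V →ₗ[k] W} (hf : IntwOn H ρ τ f) :
    Intw ρ τ (relTr (linHom ρ τ) H f) :=
  isFix_linHom_top.1 (isFix_relTr (isFix_linHom.2 hf))

theorem comp_relTr {f : W →ₗ[k] X} (hf : Intw τ υ f) (H : Subgroup G) (g : V →ₗ[k] W) :
    f ∘ₗ relTr (linHom ρ τ) H g = relTr (linHom ρ υ) H (f ∘ₗ g) :=
  map_relTr (LinearMap.llcomp k V W X f) (fun x a => by
    ext v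
    simp [hf x]) H g

theorem relTr_comp {g : V →ₗ[k] W} (hg : Intw ρ τ g) (H : Subgroup G) (f : W →ₗ[k] X) :
    relTr (linHom τ υ) H f ∘ₗ g = relTr (linHom ρ υ) H (f ∘ₗ g) :=
  map_relTr (LinearMap.lcomp k X g) (fun x a => by
    ext v
    simp [hg x⁻¹]) H f

theorem IntwOn.comp {f : W →ₗ[k] X} {g : V →ₗ[k] W} (hf : IntwOn H τ υ f) (hg : IntwOn H ρ τ g) :
    IntwOn H ρ υ (f ∘ₗ g) := fun h hh v => by
  rw [LinearMap.comp_apply, hg h hh, hf h hh, LinearMap.comp_apply]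

/-- `ρ` is a projective representation. -/
def IsProj (ρ : Representation k G V) : Prop :=
  ∃ θ : Module.End k V, relTr (linHom ρ ρ) ⊥ θ = 1

theorem InTr.isProj (h : InTr (linHom ρ ρ) ⊥ (1 : Module.End k V)) : IsProj ρ :=
  let ⟨θ, _, hθ⟩ := h; ⟨θ, hθ⟩

end Hom

section Conj

open Representation

variable (k G : Type*) [Field k] [Group G]

/-- The conjugation action of `G` on its group algebra. -/
noncomputable def conjRep : Representation k G (MonoidAlgebra k G) where
  toFun g := LinearMap.mulLeft k (MonoidAlgebra.of k G g) ∘ₗ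
    LinearMap.mulRight k (MonoidAlgebra.of k G g⁻¹)
  map_one' := by ext; simp
  map_mul' g h := by
    ext x
    simp [mul_assoc]

variable {k G}

theorem conjRep_apply (g : G) (a : MonoidAlgebra k G) :
    conjRep k G g a = MonoidAlgebra.of k G g * a * MonoidAlgebra.of k G g⁻¹ := by
  simp [conjRep, mul_assoc]

theorem conjRep_coeff (g : G) (a : MonoidAlgebra k G) (x : G) :
    (conjRep k G g a).coeff x = a.coeff (g⁻¹ * x * g) := by
  rw [conjRep_apply]
  simp [MonoidAlgebra.coeff_single_mul_apply, MonoidAlgebra.coeff_mul_single_apply, mul_assoc]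

theorem of_inv_mul_of (g : G) : MonoidAlgebra.of k G g⁻¹ * MonoidAlgebra.of k G g = 1 := by
  rw [← map_mul, inv_mul_cancel, map_one]

theorem of_mul_of_inv (g : G) : MonoidAlgebra.of k G g * MonoidAlgebra.of k G g⁻¹ = 1 := by
  rw [← map_mul, mul_inv_cancel, map_one]

theorem conjRep_eq_self_iff {g : G} {a : MonoidAlgebra k G} :
    conjRep k G g a = a ↔ MonoidAlgebra.of k G g * a = a * MonoidAlgebra.of k G g := by
  rw [conjRep_apply]
  constructor
  · intro h
    conv_rhs => rw [← h]
    rw [mul_assoc, of_inv_mul_of, mul_one]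
  · intro h
    rw [h, mul_assoc, of_mul_of_inv, mul_one]

theorem central_iff {a : MonoidAlgebra k G} :
    (∀ x, x * a = a * x) ↔ ∀ g, conjRep k G g a = a := by
  simp only [conjRep_eq_self_iff]
  refine ⟨fun h g => h _, fun h x => ?_⟩
  induction x using MonoidAlgebra.induction_linear with
  | zero => simp
  | add f g hf hg => rw [add_mul, mul_add, hf, hg]
  | single g r =>
    have := h g
    rw [show MonoidAlgebra.single g r = r • MonoidAlgebra.of k G g by simp, smul_mul_assoc, this,
      mul_smul_comm]

theorem conjRep_mul (g : G) (a b : MonoidAlgebra k G) :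
    conjRep k G g (a * b) = conjRep k G g a * conjRep k G g b := by
  simp only [conjRep_apply]
  rw [show MonoidAlgebra.of k G g * a * MonoidAlgebra.of k G g⁻¹ *
    (MonoidAlgebra.of k G g * b * MonoidAlgebra.of k G g⁻¹) = MonoidAlgebra.of k G g * a *
    (MonoidAlgebra.of k G g⁻¹ * MonoidAlgebra.of k G g) * b * MonoidAlgebra.of k G g⁻¹ by
      simp only [mul_assoc], of_inv_mul_of, mul_one]
  simp only [mul_assoc]

variable {V : Type*} [AddCommGroup V] [Module k V]

theorem asAlgebraHom_conjRep (ρ : Representation k G V) (g : G) (a : MonoidAlgebra k G) :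
    ρ.asAlgebraHom (conjRep k G g a) = linHom ρ ρ g (ρ.asAlgebraHom a) := by
  rw [conjRep_apply, map_mul, map_mul, asAlgebraHom_of, asAlgebraHom_of, mul_assoc]
  rfl

theorem InTr.asAlgebraHom [Finite G] (ρ : Representation k G V) {H : Subgroup G}
    {m : MonoidAlgebra k G} (hm : InTr (conjRep k G) H m) :
    InTr (linHom ρ ρ) H (ρ.asAlgebraHom m) :=
  hm.map ρ.asAlgebraHom.toLinearMap (asAlgebraHom_conjRep ρ)

theorem InTr.mul_central [Finite G] {H : Subgroup G} {m z : MonoidAlgebra k G}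
    (hm : InTr (conjRep k G) H m) (hz : ∀ x, x * z = z * x) : InTr (conjRep k G) H (m * z) :=
  hm.map (LinearMap.mulRight k z) fun g a => by
    simp only [LinearMap.mulRight_apply, conjRep_mul, central_iff.1 hz]

theorem asAlgebraHom_comp {H : Type*} [Group H] (ρ : Representation k G V) (σ : H →* G)
    (a : MonoidAlgebra k H) :
    (show Representation k H V from ρ.comp σ).asAlgebraHom a =
      ρ.asAlgebraHom (MonoidAlgebra.mapDomainRingHom k σ a) := by
  induction a using MonoidAlgebra.induction_linear with
  | zero => simp
  | add f g hf hg => rw [map_add, hf, hg, map_add, map_add]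
  | single g r => simp

end Conj

section SmallSet

theorem apply_eq_of_iterate_prime_pow {X : Type*} {f : X → X} {p m : ℕ} (hp : p.Prime)
    (hf : f^[p ^ m] = id) {S : Set X} (hS : S.Finite) (hfS : ∀ x ∈ S, f x ∈ S)
    (hc : S.ncard < p) : ∀ x ∈ S, f x = x := by
  intro x hx
  have hper : Function.minimalPeriod f x ∣ p ^ m :=
    Function.IsPeriodicPt.minimalPeriod_dvd (by
      show f^[p ^ m] x = x
      rw [hf]; rfl)
  obtain ⟨j, -, hj⟩ := (Nat.dvd_prime_pow hp).1 hper
  have hmem : ∀ n, f^[n] x ∈ S := fun n => by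
    induction n with
    | zero => exact hx
    | succ n ih => rw [Function.iterate_succ_apply']; exact hfS _ ih
  have hle : Function.minimalPeriod f x ≤ S.ncard := by
    have h1 := Set.ncard_le_ncard_of_injOn (s := Set.Iio (Function.minimalPeriod f x))
      (fun n => f^[n] x) (fun n _ => hmem n) Function.iterate_injOn_Iio_minimalPeriod hS
    simpa using h1
  rcases Nat.eq_zero_or_pos j with h0 | h0
  · rw [h0, pow_zero] at hj
    exact Function.minimalPeriod_eq_one_iff_isFixedPt.1 hj
  · exfalso
    have := Nat.le_self_pow h0.ne' p
    omega

end SmallSet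

section Blocks

theorem IsCentralIdem.mul {A : Type} [Ring A] {b c : A} (hb : IsCentralIdem A b)
    (hc : IsCentralIdem A c) : IsCentralIdem A (b * c) := by
  refine ⟨?_, fun a => ?_⟩
  · rw [mul_assoc, ← mul_assoc c b, hb.2 c, mul_assoc b c c, hc.1, ← mul_assoc, hb.1]
  · rw [← mul_assoc, hb.2 a, mul_assoc, hc.2, mul_assoc]

theorem IsBlockIdem.mul_eq {A : Type} [Ring A] {b c : A} (hb : IsBlockIdem A b)
    (hc : IsCentralIdem A c) : b * c = 0 ∨ b * c = b := by
  have hbc := hb.2.1.mul hc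
  have h4 : b * (b * c) = b * c := by rw [← mul_assoc, hb.2.1.1]
  have h5 : b * c * b = b * c := by rw [← hbc.2, h4]
  have hbc' : IsCentralIdem A (b - b * c) := by
    refine ⟨?_, fun a => ?_⟩
    · rw [sub_mul, mul_sub, mul_sub, hb.2.1.1, hbc.1, h4, h5]; abel
    · rw [mul_sub, sub_mul, hb.2.1.2 a, hbc.2 a]
  rcases hb.2.2 _ _ hbc hbc' (by rw [mul_sub, h5, hbc.1, sub_self])
    (by rw [sub_mul, h4, hbc.1, sub_self]) (by abel) with h | h
  · exact Or.inl h
  · exact Or.inr (sub_eq_zero.1 h).symm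

theorem IsBlockIdem.exists_mul_eq (k : Type*) {A : Type} [Field k] [Ring A] [Algebra k A]
    [FiniteDimensional k A] {b : A} (hb : IsBlockIdem A b) {z : A} (hz : ∀ a, a * z = z * a)
    (hn : ¬ IsNilpotent (b * z)) : ∃ y, (∀ a, a * y = y * a) ∧ b * z * y = b := by
  have hbz : ∀ a, a * (b * z) = b * z * a := fun a => by
    rw [← mul_assoc, hb.2.1.2 a, mul_assoc, hz, mul_assoc]
  have hpoly : ∀ (P : Polynomial k) a, a * Polynomial.aeval (b * z) P =
      Polynomial.aeval (b * z) P * a := fun P a => by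
    have h1 : Commute a (b * z) := hbz a
    rw [Polynomial.aeval_eq_sum_range (p := P)]
    exact (Commute.sum_right _ _ _ fun i _ => (h1.pow_right i).smul_right _).eq
  obtain ⟨P, R, n, h1, h2, h3⟩ := exists_fitting (k := k) (b * z)
  rcases hb.mul_eq ⟨h1, hpoly P⟩ with h | h
  · exfalso
    apply hn
    refine ⟨n + 1, ?_⟩
    rw [mul_sub, mul_one, sub_eq_zero] at h3
    rw [pow_succ, h3, mul_assoc, ← mul_assoc _ b z, ← hpoly P b, h, zero_mul, mul_zero]
  · refine ⟨Polynomial.aeval (b * z) R * b, fun a => ?_, ?_⟩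
    · rw [← mul_assoc, hpoly, mul_assoc, hb.2.1.2 a, mul_assoc]
    · rw [← mul_assoc, h2, ← hpoly P b, h]

theorem exists_blockIdem (k : Type*) {A : Type} [Field k] [Ring A] [Algebra k A]
    [FiniteDimensional k A] {z : A} (hz : ∀ a, a * z = z * a) {e : A} (he : IsCentralIdem A e)
    (hn : ¬ IsNilpotent (e * z)) :
    ∃ c, IsBlockIdem A c ∧ e * c = c ∧ ¬ IsNilpotent (c * z) := by
  induction hd : Module.finrank k (LinearMap.range (LinearMap.mulLeft k e)) using
    Nat.strong_induction_on generalizing e with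
  | _ d ih =>
  by_cases hb : IsBlockIdem A e
  · exact ⟨e, hb, he.1, hn⟩
  · have he0 : e ≠ 0 := by rintro rfl; simp at hn
    unfold IsBlockIdem at hb
    push Not at hb
    obtain ⟨c, d', hc, hd', hcd, hdc, hecd, hc0, hd0⟩ := hb he0 he
    have key : ∀ c d' : A, IsCentralIdem A c → IsCentralIdem A d' → c * d' = 0 → d' * c = 0 →
        e = c + d' → d' ≠ 0 → ¬ IsNilpotent (c * z) →
        ∃ c, IsBlockIdem A c ∧ e * c = c ∧ ¬ IsNilpotent (c * z) := by
      intro c d' hc hd' hcd hdc hecd hd0 hcn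
      have hec : e * c = c := by rw [hecd, add_mul, hc.1, hdc, add_zero]
      have hed : e * d' = d' := by rw [hecd, add_mul, hd'.1, hcd, zero_add]
      obtain ⟨x, hx, hcx, hxn⟩ := ih _ (by
        rw [← hd]
        refine Submodule.finrank_lt_finrank_of_lt (lt_of_le_of_ne ?_ ?_)
        · rintro _ ⟨y, rfl⟩
          exact ⟨c * y, by simp [← mul_assoc, hec]⟩
        · intro h
          have : d' ∈ LinearMap.range (LinearMap.mulLeft k c) := by
            rw [h]; exact ⟨d', hed⟩
          obtain ⟨y, hy⟩ := this
          apply hd0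
          rw [← hd'.1]
          nth_rw 2 [← hy]
          simp [← mul_assoc, hdc]) hc hcn rfl
      exact ⟨x, hx, by rw [← hcx, ← mul_assoc, hec], hxn⟩
    by_cases hcn : IsNilpotent (c * z)
    · refine key d' c hd' hc hdc hcd (by rw [hecd, add_comm]) hc0 fun hdn => hn ?_
      rw [hecd, add_mul]
      refine Commute.isNilpotent_add ?_ hcn hdn
      show c * z * (d' * z) = d' * z * (c * z)
      rw [mul_assoc, ← mul_assoc z, ← hz, mul_assoc d', ← mul_assoc, hcd, zero_mul, mul_assoc,
        ← mul_assoc z, ← hz, mul_assoc c, ← mul_assoc, hdc, zero_mul]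
    · exact key c d' hc hd' hcd hdc hecd hd0 hcn

theorem IsBlockIdem.eq_of_mul_ne_zero {A : Type} [Ring A] {b c : A} (hb : IsBlockIdem A b)
    (hc : IsBlockIdem A c) (h : b * c ≠ 0) : b = c := by
  rw [← (hb.mul_eq hc.2.1).resolve_left h, hc.2.1.2 b]
  rw [hc.2.1.2 b] at h
  exact (hc.mul_eq hb.2.1).resolve_left h

theorem IsBlockIdem.map {A B : Type} [Ring A] [Ring B] {b : A} (hb : IsBlockIdem A b)
    (φ : A ≃+* B) : IsBlockIdem B (φ b) := by
  have hC : ∀ c, IsCentralIdem B c → IsCentralIdem A (φ.symm c) := fun c hc =>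
    ⟨by rw [← map_mul, hc.1], fun a => φ.injective (by simpa using hc.2 (φ a))⟩
  refine ⟨by simpa using hb.1, ⟨by rw [← map_mul, hb.2.1.1], fun a => ?_⟩, ?_⟩
  · have := congrArg φ (hb.2.1.2 (φ.symm a))
    simpa using this
  · intro c d hc hd hcd hdc hbcd
    have := hb.2.2 _ _ (hC c hc) (hC d hd) (by rw [← map_mul, hcd, map_zero])
      (by rw [← map_mul, hdc, map_zero]) (φ.injective (by simpa using hbcd))
    simpa using this

end Blocks

section Extension

variable {k V W : Type*} [Field k] [AddCommGroup V] [Module k V] [AddCommGroup W] [Module k W]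

theorem exists_linear_section (f : V →ₗ[k] W) : ∃ s : W →ₗ[k] V, ∀ v, f (s (f v)) = f v := by
  obtain ⟨r, hr⟩ := f.rangeRestrict.exists_rightInverse_of_surjective f.range_rangeRestrict
  obtain ⟨s, hs⟩ := r.exists_extend
  refine ⟨s, fun v => ?_⟩
  have h1 : s (f v) = r (f.rangeRestrict v) := (LinearMap.congr_fun hs (f.rangeRestrict v))
  have h2 := congrArg Subtype.val (LinearMap.congr_fun hr (f.rangeRestrict v))
  rw [h1]
  exact h2

/-- A linear map commuting with `T` and `T'` on the range of `T ^ a` and with values in the range of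
`T' ^ a` extends to a map commuting with `T` and `T'`. -/
theorem exists_extend_of_range_pow (T : Module.End k V) (T' : Module.End k W) (a : ℕ) :
    ∀ φ : V →ₗ[k] W, (∀ v, T' (φ ((T ^ a) v)) = φ (T ((T ^ a) v))) →
      (∀ v, ∃ w, φ ((T ^ a) v) = (T' ^ a) w) →
      ∃ Φ : V →ₗ[k] W, (∀ v, Φ (T v) = T' (Φ v)) ∧ ∀ v, Φ ((T ^ a) v) = φ ((T ^ a) v) := by
  induction a with
  | zero => exact fun φ h _ => ⟨φ, fun v => (h v).symm, fun _ => rfl⟩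
  | succ a ih =>
    intro φ h1 h2
    obtain ⟨C, hC⟩ := Submodule.exists_isCompl (LinearMap.range (T ^ (a + 1)))
    obtain ⟨π, hπ1, hπ2⟩ : ∃ π : V →ₗ[k] V, (∀ v, π ((T ^ (a + 1)) v) = (T ^ (a + 1)) v) ∧
        ∀ v, ∃ u, π v = (T ^ (a + 1)) u := by
      refine ⟨(LinearMap.range (T ^ (a + 1))).subtype ∘ₗ Submodule.projectionOnto _ _ hC,
        fun v => ?_, fun v => ?_⟩
      · exact congrArg Subtype.val (Submodule.projectionOnto_apply_left hC ⟨_, v, rfl⟩)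
      · obtain ⟨u, hu⟩ := (Submodule.projectionOnto _ _ hC v).2
        exact ⟨u, hu.symm⟩
    obtain ⟨s, hs⟩ := exists_linear_section (T' ^ (a + 1))
    have hs' : ∀ v, T' ((T' ^ a) (s (φ ((T ^ (a + 1)) v)))) = φ ((T ^ (a + 1)) v) := fun v => by
      obtain ⟨w, hw⟩ := h2 v
      rw [hw, ← Module.End.mul_apply, ← pow_succ', hs]
    have hT : ∀ v, T ((T ^ a) v) = (T ^ (a + 1)) v := fun v => by
      rw [pow_succ', Module.End.mul_apply]
    have hT' : ∀ w, (T' ^ (a + 1)) w = (T' ^ a) (T' w) := fun v => by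
      rw [pow_succ, Module.End.mul_apply]
    obtain ⟨ψ, hψ⟩ : ∃ ψ : V →ₗ[k] W, ∀ v, ψ v = φ (π v) + (T' ^ a) (s (φ (T (v - π v)))) :=
      ⟨φ ∘ₗ π + (T' ^ a) ∘ₗ s ∘ₗ φ ∘ₗ T ∘ₗ (LinearMap.id - π), fun v => rfl⟩
    have h3 : ∀ v, T' (ψ ((T ^ a) v)) = ψ (T ((T ^ a) v)) := by
      intro v
      obtain ⟨u, hu⟩ := hπ2 ((T ^ a) v)
      have hx : T ((T ^ a) v - π ((T ^ a) v)) = (T ^ (a + 1)) (v - T u) := by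
        rw [map_sub, map_sub, hT, hu]
        congr 1
        rw [← Module.End.mul_apply, ← pow_succ', pow_succ, Module.End.mul_apply]
      rw [hψ, hψ, map_add]
      rw [hx, hs', ← hx, map_sub, hT v, hπ1, hu, h1]
      simp
    have h4 : ∀ v, ∃ w, ψ ((T ^ a) v) = (T' ^ a) w := by
      intro v
      obtain ⟨u, hu⟩ := hπ2 ((T ^ a) v)
      obtain ⟨w, hw⟩ := h2 u
      refine ⟨T' w + s (φ (T ((T ^ a) v - π ((T ^ a) v)))), ?_⟩
      rw [hψ]
      rw [hu, hw, hT', map_add]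
    obtain ⟨Φ, hΦ1, hΦ2⟩ := ih _ h3 h4
    refine ⟨Φ, hΦ1, fun v => ?_⟩
    have := hπ1 v
    rw [pow_succ, Module.End.mul_apply] at this
    rw [pow_succ, Module.End.mul_apply, hΦ2]
    simp [hψ, this]

end Extension

section RepExtension

set_option linter.unusedSectionVars false

open Representation

variable {k G V W S S' : Type*} [Field k] [Group G] [Finite G] [AddCommGroup V] [Module k V]
  [AddCommGroup W] [Module k W] [AddCommGroup S] [Module k S] [AddCommGroup S'] [Module k S']
  {ρ : Representation k G V} {τ : Representation k G W} {υ : Representation k G S}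
  {υ' : Representation k G S'}

theorem exists_intw_extend {Q : Subgroup G} {a : Module.End k W}
    (ha1 : relTr (linHom τ τ) Q a = 1) (ha : IntwOn Q τ τ a) {Φ : V →ₗ[k] W}
    (hΦ : IntwOn Q ρ τ Φ) {ι : S →ₗ[k] V} (hι : Intw υ ρ ι) (hφ : Intw υ τ (Φ ∘ₗ ι)) :
    ∃ Ψ : V →ₗ[k] W, Intw ρ τ Ψ ∧ Ψ ∘ₗ ι = Φ ∘ₗ ι := by
  refine ⟨relTr (linHom ρ τ) Q (a ∘ₗ Φ), intw_relTr (ha.comp hΦ), ?_⟩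
  rw [relTr_comp hι, LinearMap.comp_assoc, ← relTr_comp hφ, ha1]
  rfl

theorem repIso_of_extend [FiniteDimensional k V] (hρ : Indec ρ) (hτ : Indec τ) [Nontrivial S]
    {ι : S →ₗ[k] V} (hinj : Function.Injective ι) {ι' : S' →ₗ[k] W} {e : S ≃ₗ[k] S'}
    {Φ : V →ₗ[k] W} (hΦ : Intw ρ τ Φ) (h : ∀ s, Φ (ι s) = ι' (e s))
    {Ψ : W →ₗ[k] V} (hΨ : Intw τ ρ Ψ) (h' : ∀ s, Ψ (ι' s) = ι (e.symm s)) : RepIso ρ τ := by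
  refine hρ.repIso_of_not_isNilpotent hτ hΦ hΨ ?_
  rintro ⟨n, hn⟩
  obtain ⟨s, hs⟩ := exists_ne (0 : S)
  have h1 : ∀ m : ℕ, ((Ψ ∘ₗ Φ : Module.End k V) ^ m) (ι s) = ι s := fun m => by
    induction m with
    | zero => rfl
    | succ m ih => rw [pow_succ', Module.End.mul_apply, ih]; simp [h, h']
  apply hs
  apply hinj
  rw [← h1 n, hn]
  simp

/-- `ρ` is an irreducible representation. -/
def Irr (ρ : Representation k G V) : Prop :=
  Nontrivial V ∧ ∀ S : Submodule k V, (∀ g, ∀ v ∈ S, ρ g v ∈ S) → S = ⊥ ∨ S = ⊤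

theorem Irr.bijective {ρ : Representation k G V} {τ : Representation k G W} (hρ : Irr ρ)
    (hτ : Irr τ) {f : V →ₗ[k] W} (hf : Intw ρ τ f) (h0 : f ≠ 0) : Function.Bijective f := by
  constructor
  · rw [← LinearMap.ker_eq_bot]
    refine (hρ.2 _ fun g v hv => ?_).resolve_right fun h => h0 (LinearMap.ker_eq_top.1 h)
    rw [LinearMap.mem_ker] at hv ⊢
    rw [hf, hv, map_zero]
  · rw [← LinearMap.range_eq_top]
    refine (hτ.2 _ fun g w hw => hf.range_mem g w hw).resolve_left fun h => h0 ?_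
    exact LinearMap.range_eq_bot.1 h

theorem Irr.indec {ρ : Representation k G V} (hρ : Irr ρ) : Indec ρ := by
  refine ⟨hρ.1, fun e he hee => ?_⟩
  by_contra! hc
  have hb := hρ.bijective hρ he hc.1
  refine hc.2 (LinearMap.ext fun v => hb.1 ?_)
  exact LinearMap.congr_fun hee v

theorem exists_irr_sub [FiniteDimensional k V] (ρ : Representation k G V) [Nontrivial V] :
    ∃ (S : Submodule k V) (hS : ∀ g, ∀ v ∈ S, ρ g v ∈ S), Irr (subRep ρ S hS) := by
  have hwf : WellFounded ((· < ·) : Submodule k V → Submodule k V → Prop) := wellFounded_lt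
  obtain ⟨S, ⟨hS0, hS⟩, hmin⟩ := hwf.has_min {S | S ≠ ⊥ ∧ ∀ g, ∀ v ∈ S, ρ g v ∈ S}
    ⟨⊤, top_ne_bot, by simp⟩
  refine ⟨S, hS, Submodule.nontrivial_iff_ne_bot.2 hS0, fun T hT => ?_⟩
  by_contra! hc
  refine hmin (T.map S.subtype) ⟨?_, ?_⟩ ?_
  · exact fun h => hc.1 (Submodule.map_injective_of_injective S.injective_subtype
      (h.trans (Submodule.map_bot _).symm))
  · rintro g _ ⟨t, ht, rfl⟩
    exact ⟨subRep ρ S hS g t, hT g t ht, rfl⟩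
  · refine lt_of_le_of_ne (Submodule.map_subtype_le S T) fun h => hc.2 ?_
    rw [eq_top_iff]
    intro s _
    obtain ⟨t, ht, hts⟩ : (s : V) ∈ T.map S.subtype := by rw [h]; exact s.2
    rwa [← Subtype.ext (a1 := t) (a2 := s) hts]

variable [IsAlgClosed k] [FiniteDimensional k V]

theorem Irr.exists_smul {ρ : Representation k G V} (hρ : Irr ρ) {f : Module.End k V}
    (hf : Intw ρ ρ f) : ∃ l : k, f = l • 1 := by
  have := hρ.1
  obtain ⟨l, hl⟩ := Module.End.exists_eigenvalue f
  refine ⟨l, ?_⟩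
  obtain ⟨v, hv⟩ := hl.exists_hasEigenvector
  by_contra hne
  have := (hρ.bijective hρ (hf.sub (Intw.one.smul l)) (sub_ne_zero.2 hne)).1
  refine hv.2 (this ?_)
  simp [hv.apply_eq_smul]

end RepExtension

section Character

set_option linter.unusedSectionVars false

open Representation

variable {k G : Type} {V W : Type*} [Field k] [IsAlgClosed k] [Group G] [Finite G]
  [AddCommGroup V] [Module k V]
  [AddCommGroup W] [Module k W] [FiniteDimensional k V]
  {ρ : Representation k G V} {τ : Representation k G W}

attribute [local instance] Fintype.ofFinite

/-- `∑ χ(g⁻¹) g` for the character `χ` of `ρ`. -/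
noncomputable def charSum (ρ : Representation k G V) : MonoidAlgebra k G :=
  ∑ g, LinearMap.trace k V (ρ g⁻¹) • MonoidAlgebra.of k G g

theorem charSum_central (ρ : Representation k G V) (x : MonoidAlgebra k G) :
    x * charSum ρ = charSum ρ * x := by
  revert x
  rw [central_iff]
  intro h
  rw [charSum, map_sum, ← (MulAut.conj h⁻¹).toEquiv.sum_comp]
  refine Finset.sum_congr rfl fun g _ => ?_
  rw [map_smul, conjRep_apply, ← map_mul, ← map_mul]
  have h1 : LinearMap.trace k V (ρ (h⁻¹ * g * h)⁻¹) = LinearMap.trace k V (ρ g⁻¹) := by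
    rw [show (h⁻¹ * g * h)⁻¹ = h⁻¹ * (g⁻¹ * h) by group, map_mul ρ, LinearMap.trace_mul_comm,
      ← map_mul ρ]
    group
  change LinearMap.trace k V (ρ (h⁻¹ * g * h⁻¹⁻¹)⁻¹) •
    MonoidAlgebra.of k G (h * (h⁻¹ * g * h⁻¹⁻¹) * h⁻¹) = _
  rw [inv_inv, h1]
  congr 2
  group

theorem asAlgebraHom_charSum (ρ : Representation k G V) (τ : Representation k G W) {ι : Type*}
    [Fintype ι] [DecidableEq ι] (e : Module.Basis ι k V) (w : W) : τ.asAlgebraHom (charSum ρ) w =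
      ∑ i, relTr (linHom ρ τ) ⊥ ((e.coord i).smulRight w) (e i) := by
  simp only [relTr_bot, charSum, map_sum, LinearMap.sum_apply, map_smul, LinearMap.smul_apply,
    asAlgebraHom_of]
  rw [Finset.sum_comm]
  refine Finset.sum_congr rfl fun g _ => ?_
  simp only [linHom_apply, LinearMap.comp_apply, LinearMap.smulRight_apply, map_smul,
    ← Finset.sum_smul]
  rw [LinearMap.trace_eq_matrix_trace k e]
  simp [Matrix.trace, LinearMap.toMatrix_apply]

theorem sum_coord_smulRight {ι : Type*} [Fintype ι] (e : Module.Basis ι k V) (f : V →ₗ[k] W) :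
    ∑ i, (e.coord i).smulRight (f (e i)) = f := by
  ext v
  simp only [LinearMap.sum_apply, LinearMap.smulRight_apply, Module.Basis.coord_apply, ← map_smul,
    ← map_sum, e.sum_repr]

theorem Irr.asAlgebraHom_charSum_ne_zero (hρ : Irr ρ) (hproj : IsProj ρ) :
    ρ.asAlgebraHom (charSum ρ) ≠ 0 := by
  classical
  intro h0
  obtain ⟨θ, hθ⟩ := hproj
  have e := Module.finBasis k V
  have hμ : ∀ f : Module.End k V, ∃ l : k, relTr (linHom ρ ρ) ⊥ f = l • 1 := fun f =>
    hρ.exists_smul (intw_relTr (isFix_linHom.1 isFix_bot))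
  have hz : ∀ v i, relTr (linHom ρ ρ) ⊥ ((e.coord i).smulRight v) = 0 := by
    intro v i
    choose l hl using fun i => hμ ((e.coord i).smulRight v)
    have h1 := asAlgebraHom_charSum ρ ρ e v
    rw [h0, LinearMap.zero_apply] at h1
    simp only [hl, LinearMap.smul_apply, Module.End.one_apply] at h1
    rw [hl, Fintype.linearIndependent_iff.1 e.linearIndependent l h1.symm i, zero_smul]
  rw [← sum_coord_smulRight e θ, map_sum, Finset.sum_eq_zero fun i _ => hz _ i] at hθ
  obtain ⟨v, hv⟩ := @exists_ne _ hρ.1 0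
  exact hv (LinearMap.congr_fun hθ.symm v)

theorem Irr.repIso_of_isProj {b : MonoidAlgebra k G} (hb : IsBlockIdem (MonoidAlgebra k G) b)
    (hρ : Irr ρ) (hproj : IsProj ρ) (hρb : ρ.asAlgebraHom b = 1) (hτ : Irr τ)
    (hτb : τ.asAlgebraHom b = 1) : RepIso ρ τ := by
  classical
  by_contra hn
  have h0 : τ.asAlgebraHom (charSum ρ) = 0 := by
    ext w
    rw [asAlgebraHom_charSum ρ τ (Module.finBasis k V)]
    refine Finset.sum_eq_zero fun i _ => ?_
    have hf : Intw ρ τ (relTr (linHom ρ τ) ⊥ ((((Module.finBasis k V).coord i).smulRight w))) :=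
      intw_relTr (isFix_linHom.1 isFix_bot)
    by_contra hne
    refine hn (RepIso.of_bijective hf (hρ.bijective hτ hf fun h => hne ?_))
    rw [h, LinearMap.zero_apply]
  obtain ⟨l, hl⟩ := hρ.exists_smul (intw_of_central ρ (charSum_central ρ))
  have hnil : ¬ IsNilpotent (b * charSum ρ) := by
    rintro ⟨n, hn⟩
    have h1 := congrArg ρ.asAlgebraHom hn
    rw [map_pow, map_mul, hρb, one_mul, map_zero, hl, smul_pow, one_pow, smul_eq_zero] at h1
    have := hρ.1
    have hl0 := h1.resolve_right one_ne_zero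
    refine hρ.asAlgebraHom_charSum_ne_zero hproj ?_
    rw [hl, eq_zero_of_pow_eq_zero hl0, zero_smul]
  obtain ⟨y, -, hy⟩ := hb.exists_mul_eq k (charSum_central ρ) hnil
  have h1 := congrArg τ.asAlgebraHom hy
  rw [map_mul, map_mul, h0, mul_zero, zero_mul, hτb] at h1
  obtain ⟨w, hw⟩ := @exists_ne _ hτ.1 0
  exact hw (LinearMap.congr_fun h1.symm w)

end Character

section Twist

set_option linter.unusedSectionVars false

open Representation

variable {k G V W : Type*} [Field k] [Group G] [AddCommGroup V] [Module k V]
  [AddCommGroup W] [Module k W] {ρ : Representation k G V} {τ : Representation k G W}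

/-- The representation `ρ` twisted by the automorphism `σ`. -/
abbrev twist (ρ : Representation k G V) (σ : G ≃* G) : Representation k G V :=
  MonoidHom.comp ρ (σ : G →* G)

theorem Intw.twist {f : V →ₗ[k] W} (hf : Intw ρ τ f) (σ : G ≃* G) :
    Intw (twist ρ σ) (twist τ σ) f := fun g v => hf (σ g) v

theorem Intw.of_twist {σ : G ≃* G} {f : V →ₗ[k] W} (hf : Intw (Paper.twist ρ σ) (Paper.twist τ σ) f) :
    Intw ρ τ f := fun g v => by simpa using hf (σ.symm g) v

theorem RepIso.twist (h : RepIso ρ τ) (σ : G ≃* G) : RepIso (twist ρ σ) (twist τ σ) :=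
  let ⟨e, he⟩ := h; ⟨e, he.twist σ⟩

theorem RepIso.of_twist {σ : G ≃* G} (h : RepIso (Paper.twist ρ σ) (Paper.twist τ σ)) :
    RepIso ρ τ :=
  let ⟨e, he⟩ := h; ⟨e, he.of_twist⟩

theorem Indec.twist (hρ : Indec ρ) (σ : G ≃* G) : Indec (twist ρ σ) :=
  ⟨hρ.1, fun e he => hρ.2 e he.of_twist⟩

theorem Irr.twist (hρ : Irr ρ) (σ : G ≃* G) : Irr (twist ρ σ) :=
  ⟨hρ.1, fun S hS => hρ.2 S fun g v hv => by simpa using hS (σ.symm g) v hv⟩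

theorem relTr_linHom_twist [Finite G] {σ : G ≃* G} {H K : Subgroup G} (hσ : ∀ g, σ g ∈ K ↔ g ∈ H)
    {f : V →ₗ[k] W} (hf : IntwOn K ρ τ f) :
    relTr (linHom (twist ρ σ) (twist τ σ)) H f = relTr (linHom ρ τ) K f := by
  rw [← relTr_comp_equiv σ hσ (isFix_linHom.2 hf)]
  have h : linHom (twist ρ σ) (twist τ σ) = MonoidHom.comp (linHom ρ τ) (σ : G →* G) :=
    MonoidHom.ext fun g => LinearMap.ext fun f => LinearMap.ext fun v => by simp
  rw [h]

theorem IsProj.twist [Finite G] (hρ : IsProj ρ) (σ : G ≃* G) : IsProj (twist ρ σ) := by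
  obtain ⟨θ, hθ⟩ := hρ
  refine ⟨θ, ?_⟩
  rw [relTr_linHom_twist (K := ⊥) (by simp) (isFix_linHom.1 isFix_bot), hθ]

theorem asAlgebraHom_twist (ρ : Representation k G V) {σ : G ≃* G} {b : MonoidAlgebra k G}
    (hb : MonoidAlgebra.mapDomainRingHom k (σ : G →* G) b = b) :
    (twist ρ σ).asAlgebraHom b = ρ.asAlgebraHom b := by
  rw [asAlgebraHom_comp ρ (σ : G →* G) b, hb]

theorem RepIso.of_isIdem [FiniteDimensional k V] {e : Module.End k V} (he : Intw ρ ρ e)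
    (hee : e * e = e) {σ : G ≃* G}
    (h1 : RepIso (Paper.twist (subRep ρ _ he.range_mem) σ) (subRep ρ _ he.range_mem))
    (h2 : RepIso (Paper.twist (subRep ρ _ (Intw.one.sub he).range_mem) σ)
      (subRep ρ _ (Intw.one.sub he).range_mem)) : RepIso (Paper.twist ρ σ) ρ := by
  obtain ⟨e1, he1⟩ := h1
  obtain ⟨e2, he2⟩ := h2
  have hev : ∀ v, e (e v) = e v := fun v => LinearMap.congr_fun hee v
  have hr1 : ∀ x : LinearMap.range e, e x = x := by rintro ⟨_, v, rfl⟩; exact hev v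
  have hr2 : ∀ x : LinearMap.range (1 - e), e x = 0 := by
    rintro ⟨_, v, rfl⟩
    simp [hev]
  let F : Module.End k V := (LinearMap.range e).subtype ∘ₗ e1.toLinearMap ∘ₗ e.rangeRestrict +
    (LinearMap.range (1 - e)).subtype ∘ₗ e2.toLinearMap ∘ₗ (1 - e).rangeRestrict
  have hF : ∀ v, F v = e1 (e.rangeRestrict v) + e2 ((1 - e).rangeRestrict v) := fun v => rfl
  have hFi : Intw (Paper.twist ρ σ) ρ F := fun g v => by
    have h3 : e.rangeRestrict (ρ (σ g) v) = subRep ρ _ he.range_mem (σ g) (e.rangeRestrict v) :=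
      Subtype.ext (he (σ g) v)
    have h4 : (1 - e).rangeRestrict (ρ (σ g) v) =
        subRep ρ _ (Intw.one.sub he).range_mem (σ g) ((1 - e).rangeRestrict v) :=
      Subtype.ext ((Intw.one.sub he) (σ g) v)
    have h5 := congrArg Subtype.val (he1 g (e.rangeRestrict v))
    have h6 := congrArg Subtype.val (he2 g ((1 - e).rangeRestrict v))
    rw [hF, hF, map_add]
    change ((e1 (e.rangeRestrict (ρ (σ g) v)) : V)) + e2 ((1 - e).rangeRestrict (ρ (σ g) v)) = _
    rw [h3, h4]
    exact congrArg₂ (· + ·) h5 h6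
  refine RepIso.of_bijective hFi ?_
  have hinj : Function.Injective F := by
    rw [← LinearMap.ker_eq_bot, LinearMap.ker_eq_bot']
    intro v hv
    rw [hF] at hv
    have h7 : (e1 (e.rangeRestrict v) : V) = 0 := by
      have := congrArg e hv
      rwa [map_add, hr1, hr2, add_zero, map_zero] at this
    rw [h7, zero_add] at hv
    have h8 : e v = 0 := by
      have := e1.map_eq_zero_iff.1 (Subtype.ext h7 : e1 (e.rangeRestrict v) = 0)
      exact congrArg Subtype.val this
    have h9 : (1 - e) v = 0 := by
      have := e2.map_eq_zero_iff.1 (Subtype.ext hv : e2 ((1 - e).rangeRestrict v) = 0)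
      exact congrArg Subtype.val this
    simpa [h8] using h9
  exact ⟨hinj, LinearMap.injective_iff_surjective.1 hinj⟩

theorem repIso_twist_of_indec {k G : Type*} [Field k] [Group G] {σ : G ≃* G}
    {b : MonoidAlgebra k G}
    (h : ∀ (V : Type) [AddCommGroup V] [Module k V] [FiniteDimensional k V]
      (ρ : Representation k G V), ρ.asAlgebraHom b = 1 → Indec ρ → RepIso (twist ρ σ) ρ)
    (V : Type) [AddCommGroup V] [Module k V] [FiniteDimensional k V]
    (ρ : Representation k G V) (hb : ρ.asAlgebraHom b = 1) : RepIso (twist ρ σ) ρ := by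
  induction hn : Module.finrank k V using Nat.strong_induction_on generalizing V with
  | _ n ih =>
    by_cases hi : Indec ρ
    · exact h V ρ hb hi
    · rcases subsingleton_or_nontrivial V with hV | hV
      · exact ⟨LinearEquiv.refl k V, fun g v => Subsingleton.elim _ _⟩
      have : ∃ e, Intw ρ ρ e ∧ e * e = e ∧ e ≠ 0 ∧ e ≠ 1 := by
        by_contra! hc
        exact hi ⟨hV, fun e he hee => or_iff_not_imp_left.2 (hc e he hee)⟩
      obtain ⟨e, he, hee, h0, h1⟩ := this
      have key : ∀ S : Submodule k V, S ≠ ⊤ → ∀ hS : ∀ g, ∀ v ∈ S, ρ g v ∈ S,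
          RepIso (twist (subRep ρ S hS) σ) (subRep ρ S hS) := fun S hS hS' => by
        refine ih _ (hn ▸ Submodule.finrank_lt hS) S _ ?_ rfl
        ext s
        rw [subRep_asAlgebraHom, hb]
        rfl
      refine RepIso.of_isIdem he hee (key _ (fun ht => h1 ?_) _) (key _ (fun ht => h0 ?_) _)
      · ext v
        obtain ⟨u, rfl⟩ := LinearMap.range_eq_top.1 ht v
        exact LinearMap.congr_fun hee u
      · ext v
        obtain ⟨u, rfl⟩ := LinearMap.range_eq_top.1 ht v
        have := LinearMap.congr_fun hee u
        rw [Module.End.mul_apply] at this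
        simp [this]

end Twist

section Projective

open Representation

variable {k G : Type} {V : Type*} [Field k] [IsAlgClosed k] [Group G] [Finite G]
  [AddCommGroup V] [Module k V] [FiniteDimensional k V] {ρ : Representation k G V}

theorem repIso_twist_of_isProj {b : MonoidAlgebra k G} (hb : IsBlockIdem (MonoidAlgebra k G) b)
    {σ : G ≃* G} (hσ : MonoidAlgebra.mapDomainRingHom k (σ : G →* G) b = b) (hρ : Indec ρ)
    (hproj : IsProj ρ) (hρb : ρ.asAlgebraHom b = 1)
    (hnp : ∀ (S : Submodule k V) (hS : ∀ g, ∀ v ∈ S, ρ g v ∈ S), Irr (subRep ρ S hS) →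
      ¬ IsProj (subRep ρ S hS) → RepIso (twist (subRep ρ S hS) σ) (subRep ρ S hS)) :
    RepIso (twist ρ σ) ρ := by
  have := hρ.1
  obtain ⟨S, hS, hirr⟩ := exists_irr_sub ρ
  have hSb : (subRep ρ S hS).asAlgebraHom b = 1 := by
    ext s
    rw [subRep_asAlgebraHom, hρb]
    rfl
  have hι : Intw (subRep ρ S hS) ρ S.subtype := fun g v => rfl
  by_cases hp : IsProj (subRep ρ S hS)
  · obtain ⟨θ, hθ⟩ := hp
    obtain ⟨r, hr⟩ := S.subtype.exists_leftInverse_of_injective S.ker_subtype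
    obtain ⟨Ψ, hΨ, hΨι⟩ := exists_intw_extend hθ (isFix_linHom.1 isFix_bot) (Φ := r)
      (isFix_linHom.1 isFix_bot) hι (hr ▸ Intw.id)
    rw [hr] at hΨι
    have h1 : S.subtype ∘ₗ Ψ = 1 := by
      refine (hρ.2 _ (hι.comp hΨ) ?_).resolve_left fun h0 => ?_
      · ext v
        exact congrArg Subtype.val (LinearMap.congr_fun hΨι (Ψ v))
      · obtain ⟨s, hs⟩ := @exists_ne _ hirr.1 0
        apply hs
        rw [← LinearMap.id_apply (R := k) s, ← hΨι]
        exact Subtype.ext (LinearMap.congr_fun h0 s)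
    have hiso : RepIso (subRep ρ S hS) ρ := RepIso.of_bijective hι
      ⟨S.injective_subtype, fun v => ⟨Ψ v, LinearMap.congr_fun h1 v⟩⟩
    refine RepIso.trans (hiso.symm.twist σ) (RepIso.trans ?_ hiso)
    exact ((hirr.repIso_of_isProj hb ⟨θ, hθ⟩ hSb (hirr.twist σ)
      ((asAlgebraHom_twist _ hσ).trans hSb))).symm
  · obtain ⟨e, he⟩ := hnp S hS hirr hp
    have := hirr.1
    obtain ⟨Φ, hΦ⟩ := (S.subtype ∘ₗ e.toLinearMap).exists_extend
    obtain ⟨Φ', hΦ'⟩ := (S.subtype ∘ₗ e.symm.toLinearMap).exists_extend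
    obtain ⟨θ', hθ'⟩ := hproj.twist σ
    obtain ⟨θ, hθ⟩ := hproj
    obtain ⟨Ψ, hΨ, hΨι⟩ := exists_intw_extend hθ (isFix_linHom.1 isFix_bot) (Φ := Φ)
      (isFix_linHom.1 isFix_bot) (hι.twist σ) (by rw [hΦ]; exact hι.comp he)
    obtain ⟨Ψ', hΨ', hΨι'⟩ := exists_intw_extend hθ' (isFix_linHom.1 isFix_bot) (Φ := Φ')
      (isFix_linHom.1 isFix_bot) hι (by rw [hΦ']; exact (hι.twist σ).comp he.equiv_symm)
    refine repIso_of_extend (hρ.twist σ) hρ S.injective_subtype hΨ (e := e) (ι' := S.subtype)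
      (fun s => ?_) hΨ' fun s => ?_
    · exact LinearMap.congr_fun (hΨι.trans hΦ) s
    · exact LinearMap.congr_fun (hΨι'.trans hΦ') s

end Projective

section Orthogonal

set_option linter.unusedSectionVars false

open Representation

variable {k G V W ι : Type*} [Field k] [Group G] [Finite G] [AddCommGroup V] [Module k V]
  [AddCommGroup W] [Module k W] [FiniteDimensional k V]

/-- The restriction of a representation to a subgroup. -/
abbrev res (ρ : Representation k G V) (C : Subgroup G) : Representation k C V :=
  MonoidHom.comp ρ C.subtype

theorem Intw.res {ρ : Representation k G V} {τ : Representation k G W} {f : V →ₗ[k] W}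
    (hf : Intw ρ τ f) (C : Subgroup G) : Intw (res ρ C) (res τ C) f := fun c v => hf c v

theorem intwOn_of_res {ρ : Representation k G V} {τ : Representation k G W} {C : Subgroup G}
    {f : V →ₗ[k] W} (hf : Intw (Paper.res ρ C) (Paper.res τ C) f) : IntwOn C ρ τ f :=
  fun c hc v => hf ⟨c, hc⟩ v

theorem exists_orthogonal {ρ : ι → Representation k G V} (hρ : ∀ i, Indec (ρ i))
    (hne : ∀ i j, i ≠ j → ¬ RepIso (ρ i) (ρ j)) {C : Subgroup G} {τ : Representation k C W}
    {α : ι → W →ₗ[k] V} {β : ι → V →ₗ[k] W} (hα : ∀ i, Intw τ (res (ρ i) C) (α i))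
    (hβ : ∀ i, Intw (res (ρ i) C) τ (β i))
    (h1 : ∀ i, relTr (linHom (ρ i) (ρ i)) C (α i ∘ₗ β i) = 1) (s : Finset ι) :
    ∃ (α' : ι → W →ₗ[k] V) (β' : ι → V →ₗ[k] W), (∀ i, Intw τ (res (ρ i) C) (α' i)) ∧
      (∀ i, Intw (res (ρ i) C) τ (β' i)) ∧
      (∀ i ∈ s, relTr (linHom (ρ i) (ρ i)) C (α' i ∘ₗ β' i) = 1) ∧
      ∀ i ∈ s, ∀ j ∈ s, i ≠ j → relTr (linHom (ρ j) (ρ i)) C (α' i ∘ₗ β' j) = 0 := by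
  classical
  induction s using Finset.induction_on with
  | empty => exact ⟨α, β, hα, hβ, by simp, by simp⟩
  | insert m s hm ih =>
    obtain ⟨α', β', hα', hβ', hd, ho⟩ := ih
    have hs : ∀ j ∈ s, m ≠ j := fun j hj h => hm (h ▸ hj)
    have hT : ∀ {i j} {f : W →ₗ[k] V} {g : V →ₗ[k] W}, Intw τ (res (ρ i) C) f →
        Intw (res (ρ j) C) τ g → Intw (ρ j) (ρ i) (relTr (linHom (ρ j) (ρ i)) C (f ∘ₗ g)) :=
      fun hf hg => intw_relTr (intwOn_of_res (hf.comp hg))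
    let X : ι → Module.End k V := fun i => relTr (linHom (ρ m) (ρ i)) C (α' i ∘ₗ β m)
    let Y : ι → Module.End k V := fun j => relTr (linHom (ρ j) (ρ m)) C (α m ∘ₗ β' j)
    have hX : ∀ i, Intw (ρ m) (ρ i) (X i) := fun i => hT (hα' i) (hβ m)
    have hY : ∀ j, Intw (ρ j) (ρ m) (Y j) := fun j => hT (hα m) (hβ' j)
    let β'' : V →ₗ[k] W := β m - ∑ j ∈ s, β' j ∘ₗ X j
    let α'' : W →ₗ[k] V := α m - ∑ j ∈ s, Y j ∘ₗ α' j
    have hβ'' : Intw (res (ρ m) C) τ β'' :=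
      (hβ m).sub (Intw.sum _ fun j _ => (hβ' j).comp ((hX j).res C))
    have hα'' : Intw τ (res (ρ m) C) α'' :=
      (hα m).sub (Intw.sum _ fun j _ => ((hY j).res C).comp (hα' j))
    have hsum1 : ∀ (i : ι) (f : W →ₗ[k] V), relTr (linHom (ρ m) (ρ i)) C (f ∘ₗ β'') =
        relTr (linHom (ρ m) (ρ i)) C (f ∘ₗ β m) -
          ∑ j ∈ s, relTr (linHom (ρ j) (ρ i)) C (f ∘ₗ β' j) ∘ₗ X j := fun i f => by
      have h : f ∘ₗ (∑ j ∈ s, β' j ∘ₗ X j) = ∑ j ∈ s, f ∘ₗ β' j ∘ₗ X j :=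
        map_sum (LinearMap.llcomp k V W V f) _ _
      simp only [β'', LinearMap.comp_sub, map_sub, h, map_sum]
      congr 1
      refine Finset.sum_congr rfl fun j _ => ?_
      rw [relTr_comp (hX j), LinearMap.comp_assoc]
    have hsum2 : ∀ (i : ι) (f : V →ₗ[k] W), relTr (linHom (ρ i) (ρ m)) C (α'' ∘ₗ f) =
        relTr (linHom (ρ i) (ρ m)) C (α m ∘ₗ f) -
          ∑ j ∈ s, Y j ∘ₗ relTr (linHom (ρ i) (ρ j)) C (α' j ∘ₗ f) := fun i f => by
      have h : (∑ j ∈ s, Y j ∘ₗ α' j) ∘ₗ f = ∑ j ∈ s, (Y j ∘ₗ α' j) ∘ₗ f :=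
        map_sum (LinearMap.lcomp k V f) _ _
      simp only [α'', LinearMap.sub_comp, map_sub, h, map_sum]
      congr 1
      refine Finset.sum_congr rfl fun j _ => ?_
      rw [comp_relTr (hY j), LinearMap.comp_assoc]
    have hz1 : ∀ i ∈ s, relTr (linHom (ρ m) (ρ i)) C (α' i ∘ₗ β'') = 0 := fun i hi => by
      rw [hsum1, Finset.sum_eq_single_of_mem i hi fun j hj hji => by
        rw [ho i hi j hj hji.symm, LinearMap.zero_comp], hd i hi]
      exact sub_self _
    have hz2 : ∀ i ∈ s, relTr (linHom (ρ i) (ρ m)) C (α'' ∘ₗ β' i) = 0 := fun i hi => by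
      rw [hsum2, Finset.sum_eq_single_of_mem i hi fun j hj hji => by
        rw [ho j hj i hi hji, LinearMap.comp_zero], hd i hi]
      exact sub_self _
    let u : Module.End k V := relTr (linHom (ρ m) (ρ m)) C (α'' ∘ₗ β'')
    have hu : Intw (ρ m) (ρ m) u := hT hα'' hβ''
    have hu1 : u + ∑ j ∈ s, Y j * X j = 1 := by
      have h2 : u = relTr (linHom (ρ m) (ρ m)) C (α'' ∘ₗ β m) := by
        simp only [u]
        rw [hsum1, Finset.sum_eq_zero fun j hj => by rw [hz2 j hj, LinearMap.zero_comp], sub_zero]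
      rw [h2, hsum2, h1]
      exact sub_add_cancel _ _
    have huu : IsUnit u := by
      have hYX : ∀ j ∈ s, Intw (ρ m) (ρ m) (Y j * X j) := fun j _ => (hY j).comp (hX j)
      refine ((hρ m).isUnit_or_of_add hu (Intw.sum _ hYX) (hu1 ▸ isUnit_one)).resolve_right
        fun h => ?_
      obtain ⟨j, hj, hju⟩ := (hρ m).exists_isUnit_of_sum s hYX h
      exact hne m j (hs j hj) (RepIso.of_bijective (hX j)
        ((hρ j).bijective_of_isUnit_comp (hρ m).1 (hX j) (hY j) hju))
    obtain ⟨⟨u, v, huv, hvu⟩, hu' : u = _⟩ := huu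
    rw [← hu'] at hu
    have hv : Intw (ρ m) (ρ m) v := hu.inv huv hvu
    refine ⟨Function.update α' m α'', Function.update β' m (β'' ∘ₗ v), fun i => ?_, fun i => ?_,
      fun i hi => ?_, fun i hi j hj hij => ?_⟩
    · rcases eq_or_ne i m with rfl | h
      · simpa using hα''
      · simpa [h] using hα' i
    · rcases eq_or_ne i m with rfl | h
      · simpa using hβ''.comp (hv.res C)
      · simpa [h] using hβ' i
    · rcases eq_or_ne i m with rfl | h
      · simp only [Function.update_self]
        rw [← LinearMap.comp_assoc, ← relTr_comp hv, ← huv, hu']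
        rfl
      · simpa [h] using hd i (Finset.mem_of_mem_insert_of_ne hi h)
    · rcases eq_or_ne i m with rfl | h
      · simpa [hij.symm] using hz2 j (Finset.mem_of_mem_insert_of_ne hj hij.symm)
      · have hi' := Finset.mem_of_mem_insert_of_ne hi h
        rcases eq_or_ne j m with rfl | h'
        · simp only [Function.update_self, Function.update_of_ne h]
          rw [← LinearMap.comp_assoc, ← relTr_comp hv, hz1 i hi', LinearMap.zero_comp]
        · simpa [h, h'] using ho i hi' j (Finset.mem_of_mem_insert_of_ne hj h') hij

end Orthogonal

section Count

set_option linter.unusedSectionVars false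

open Representation

attribute [local instance] Fintype.ofFinite

open scoped Classical

theorem exists_ne_ite_of_card_lt {k I ι : Type*} [Field k] [Fintype I] [Fintype ι]
    (hc : Fintype.card I < Fintype.card ι) (v w : I → ι → k) :
    ¬ ∀ j l, ∑ x, v x j * w x l = if j = l then 1 else 0 := by
  intro h
  let T : (ι → k) →ₗ[k] (I → k) := (Matrix.of w).mulVecLin
  have hT : LinearMap.ker T ≠ ⊥ := LinearMap.ker_ne_bot_of_finrank_lt (by simpa using hc)
  obtain ⟨y, hy, hy0⟩ := Submodule.exists_mem_ne_zero_of_ne_bot hT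
  apply hy0
  have hw : ∀ x, ∑ l, w x l * y l = 0 := fun x => congrFun hy x
  ext j
  calc y j = ∑ l, (∑ x, v x j * w x l) * y l := by simp [h]
    _ = ∑ x, v x j * ∑ l, w x l * y l := by
      simp only [Finset.sum_mul, Finset.mul_sum]
      rw [Finset.sum_comm]
      simp only [mul_assoc]
    _ = _ := by simp [hw]

variable {k G V W : Type*} [Field k] [Group G] [Finite G] [AddCommGroup V] [Module k V]
  [AddCommGroup W] [Module k W]

theorem inTr_bot_cosetSum {P : Type*} [Group P] [Finite P] (i : P →* G) {Q : Subgroup G}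
    {S : Set G} (hS : ∀ g ∈ S, ∀ q, i q * g ∈ S) (hSQ : ∀ g ∈ S, ∀ q ∈ Q, g * q ∈ S)
    (hfree : ∀ g ∈ S, ∀ q, g⁻¹ * i q * g ∈ Q → q = 1) (R : Representation k P V) {h : G → V}
    (hl : ∀ q g, h (i q * g) = R q (h g)) (hr : ∀ g, ∀ q ∈ Q, h (g * q) = h g) :
    InTr R ⊥ (cosetSum Q S h) := by
  have key : ∀ (q : P) (x : G ⧸ Q), ∃ y ∈ Q, (i q • x).out = i q * x.out * y := fun q x => by
    obtain ⟨y, hy, e⟩ := exists_out_eq_mul Q (i q * x.out)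
    refine ⟨y, hy, ?_⟩
    rw [← e]
    conv_lhs => rw [← QuotientGroup.out_eq' x]
    rfl
  let _ : MulAction P {x : G ⧸ Q // x.out ∈ S} :=
    { smul := fun q x => ⟨i q • x.1, by
        obtain ⟨y, hy, e⟩ := key q x.1
        rw [e]
        exact hSQ _ (hS _ x.2 q) _ hy⟩
      one_smul := fun x => Subtype.ext (by
        change i 1 • x.1 = x.1
        rw [map_one, one_smul])
      mul_smul := fun q q' x => Subtype.ext (by
        change i (q * q') • x.1 = i q • i q' • x.1
        rw [map_mul, SemigroupAction.mul_smul]) }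
  rw [cosetSum_def]
  convert inTr_bot_of_free (R := R) (F := fun x : {x : G ⧸ Q // x.out ∈ S} => h x.1.out)
    (fun q x => ?_) fun q x hx => ?_
  · obtain ⟨y, hy, e⟩ := key q x.1
    show h (i q • x.1).out = _
    rw [e, hr _ _ hy, hl]
  · obtain ⟨y, hy, e⟩ := key q x.1
    have hx' : i q • x.1 = x.1 := congrArg Subtype.val hx
    rw [hx'] at e
    refine hfree _ x.2 q ?_
    have : x.1.out⁻¹ * i q * x.1.out = y⁻¹ := by
      rw [eq_inv_iff_mul_eq_one, mul_assoc, mul_assoc, ← mul_assoc (i q), ← e, inv_mul_cancel]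
    rw [this]
    exact Q.inv_mem hy

theorem isProj_of_inTr_res {τ : Representation k G W} {Q : Subgroup G} {a : Module.End k W}
    (ha : IntwOn Q τ τ a) (ha1 : relTr (linHom τ τ) Q a = 1) {F : Module.End k W}
    (hF : Intw τ τ F) (h : InTr (MonoidHom.comp (linHom τ τ) Q.subtype) ⊥ F) (hu : IsUnit F) :
    IsProj τ := by
  obtain ⟨θ, -, hθ⟩ := h
  have hlin : MonoidHom.comp (linHom τ τ) Q.subtype = linHom (res τ Q) (res τ Q) := rfl
  have ha' : Intw (res τ Q) (res τ Q) a := fun q v => ha q q.2 v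
  have h1 : relTr (linHom τ τ) ⊥ (θ ∘ₗ a) = F := by
    rw [← relTr_relTr (bot_le : ⊥ ≤ Q) isFix_bot, Subgroup.bot_subgroupOf, hlin, ← relTr_comp ha',
      ← hlin, hθ, ← comp_relTr hF, ha1]
    rfl
  obtain ⟨u, rfl⟩ := hu
  have hi : Intw τ τ (↑u⁻¹ : Module.End k W) := hF.inv (by simp) (by simp)
  refine ⟨(↑u⁻¹ : Module.End k W) ∘ₗ (θ ∘ₗ a), ?_⟩
  rw [← comp_relTr hi, h1]
  exact u.inv_mul

/-- Products of semilinear maps yield a matrix of rank at most one of residues. -/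
theorem exists_rank_one {ι : Type*} [FiniteDimensional k W] {τ : Representation k G W}
    {t : Module.End k W → k} (ht : ∀ f g, Intw τ τ f → Intw τ τ g → t (f * g) = t f * t g)
    (ht0 : ∀ f, Intw τ τ f → (t f = 0 ↔ ¬ IsUnit f)) (A B : ι → Module.End k W)
    (hAB : ∀ j l, Intw τ τ (A j * B l)) : ∃ v w : ι → k, ∀ j l, t (A j * B l) = v j * w l := by
  by_cases h : ∀ j l, t (A j * B l) = 0
  · exact ⟨0, 0, by simpa using h⟩
  push Not at h
  obtain ⟨j₀, l₀, h0⟩ := h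
  obtain ⟨u, hu⟩ : IsUnit (A j₀ * B l₀) := by
    by_contra hc
    exact h0 ((ht0 _ (hAB _ _)).2 hc)
  have hi : Intw τ τ (↑u⁻¹ : Module.End k W) :=
    (hAB j₀ l₀).inv (by rw [← hu]; simp) (by rw [← hu]; simp)
  have h1 : B l₀ * ↑u⁻¹ * A j₀ = 1 := by
    have h2 : A j₀ * (B l₀ * ↑u⁻¹) = 1 := by rw [← mul_assoc, ← hu, Units.mul_inv]
    exact mul_eq_one_comm.1 h2
  refine ⟨fun j => t (A j * B l₀), fun l => t (↑u⁻¹ * (A j₀ * B l)), fun j l => ?_⟩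
  rw [← ht _ _ (hAB _ _) (hi.mul (hAB _ _))]
  congr 1
  calc A j * B l = A j * (B l₀ * ↑u⁻¹ * A j₀) * B l := by rw [h1, mul_one]
    _ = _ := by simp only [mul_assoc]

variable [IsAlgClosed k] [FiniteDimensional k V] [FiniteDimensional k W]

theorem card_le_of_pairwise_not_repIso {ι : Type*} [Finite ι] {ρ : ι → Representation k G V}
    (hρ : ∀ i, Indec (ρ i)) (hne : ∀ i j, i ≠ j → ¬ RepIso (ρ i) (ρ j)) {C N Q : Subgroup G}
    (hCN : C ≤ N) (hQC : Q ≤ C) (hN : ∀ n ∈ N, ∀ c ∈ C, n⁻¹ * c * n ∈ C)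
    (hfree : ∀ g, g ∉ N → ∀ q ∈ Q, g⁻¹ * q * g ∈ Q → q = 1)
    {τ : Representation k C W} (hτ : Indec τ) (hnp : ¬ IsProj τ) {a : Module.End k W}
    (ha : IntwOn (Q.subgroupOf C) τ τ a) (ha1 : relTr (linHom τ τ) (Q.subgroupOf C) a = 1)
    {α : ι → W →ₗ[k] V} {β : ι → V →ₗ[k] W} (hα : ∀ i, Intw τ (res (ρ i) C) (α i))
    (hβ : ∀ i, Intw (res (ρ i) C) τ (β i))
    (h1 : ∀ i, relTr (linHom (ρ i) (ρ i)) C (α i ∘ₗ β i) = 1)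
    {s : ι → W →ₗ[k] V} {r : ι → V →ₗ[k] W} (hs : ∀ i, Intw τ (res (ρ i) C) (s i))
    (hr : ∀ i, Intw (res (ρ i) C) τ (r i)) (hrs : ∀ i, r i ∘ₗ s i = LinearMap.id) :
    Nat.card ι ≤ C.relIndex N := by
  obtain ⟨α, β, hα, hβ, hd, ho⟩ := exists_orthogonal hρ hne hα hβ h1 Finset.univ
  by_contra! hcard
  obtain ⟨t, ht1, hta, htm, ht0⟩ := hτ.exists_residue
  -- the summands of the relative trace
  let f : ι → ι → G → Module.End k W := fun j l g =>
    r j ∘ₗ linHom (ρ l) (ρ j) g (α j ∘ₗ β l) ∘ₗ s l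
  have hfv : ∀ j l g w, f j l g w = r j (ρ j g (α j (β l (ρ l g⁻¹ (s l w))))) := fun j l g w => rfl
  have hfix : ∀ j l, IsFix (linHom (ρ l) (ρ j)) C (α j ∘ₗ β l) := fun j l =>
    isFix_linHom.2 (intwOn_of_res ((hα j).comp (hβ l)))
  have hfr : ∀ j l g, ∀ c ∈ C, f j l (g * c) = f j l g := fun j l g c hc => by
    simp only [f, (hfix j l).apply_mul g c hc]
  have hfl : ∀ j l g (c : C), f j l (c * g) = linHom τ τ c (f j l g) := fun j l g c => by
    ext w
    simp only [hfv, linHom_apply, LinearMap.comp_apply, mul_inv_rev, map_mul, Module.End.mul_apply]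
    rw [← hr j c, hs l c⁻¹]
    rfl
  have hsum : ∀ j l, cosetSum C Set.univ (f j l) = if j = l then 1 else 0 := fun j l => by
    have h2 : cosetSum C Set.univ (f j l) =
        r j ∘ₗ relTr (linHom (ρ l) (ρ j)) C (α j ∘ₗ β l) ∘ₗ s l := by
      rw [relTr_apply]
      exact (map_cosetSum ((LinearMap.llcomp k W V W (r j)) ∘ₗ (LinearMap.lcomp k V (s l))) C
        Set.univ fun g => linHom (ρ l) (ρ j) g (α j ∘ₗ β l)).symm
    rw [h2]
    split_ifs with hjl
    · subst hjl
      rw [hd _ (Finset.mem_univ _)]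
      exact hrs j
    · rw [ho _ (Finset.mem_univ _) _ (Finset.mem_univ _) hjl, LinearMap.zero_comp,
        LinearMap.comp_zero]
  have hfN : ∀ j l, ∀ n ∈ N, Intw τ τ (f j l n) := fun j l n hn => by
    refine isFix_linHom_top.1 fun c _ => ?_
    rw [← hfl, show (c : G) * n = n * (n⁻¹ * c * n) by group, hfr _ _ _ _ (hN n hn c c.2)]
  have hsN : ∀ j l, Intw τ τ (cosetSum C (N : Set G) (f j l)) := fun j l => by
    rw [cosetSum_def]
    exact Intw.sum _ fun x _ => hfN j l _ x.2
  have hsN' : ∀ j l, Intw τ τ (cosetSum C (N : Set G)ᶜ (f j l)) := fun j l => by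
    have := cosetSum_add_compl C (N : Set G) (f j l)
    rw [← eq_sub_iff_add_eq'] at this
    rw [this, hsum]
    split_ifs
    · exact Intw.one.sub (hsN j l)
    · exact Intw.zero.sub (hsN j l)
  have hmul : ∀ g ∈ (N : Set G)ᶜ, ∀ c ∈ N, g * c ∈ (N : Set G)ᶜ := fun g hg c hc h => hg (by
    simpa using N.mul_mem h (N.inv_mem hc))
  have hmul' : ∀ g ∈ (N : Set G)ᶜ, ∀ c ∈ N, c * g ∈ (N : Set G)ᶜ := fun g hg c hc h => hg (by
    simpa using N.mul_mem (N.inv_mem hc) h)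
  have hz : ∀ j l, t (cosetSum C (N : Set G)ᶜ (f j l)) = 0 := fun j l => by
    rw [ht0 _ (hsN' j l)]
    refine fun hu => hnp (isProj_of_inTr_res ha ha1 (hsN' j l) ?_ hu)
    let h : G → Module.End k W := fun g => r j ∘ₗ linHom (ρ l) (ρ j) g (α j ∘ₗ a ∘ₗ β l) ∘ₗ s l
    have hhv : ∀ g w, h g w = r j (ρ j g (α j (a (β l (ρ l g⁻¹ (s l w)))))) := fun g w => rfl
    have hQfix : IsFix (linHom (ρ l) (ρ j)) Q (α j ∘ₗ a ∘ₗ β l) := isFix_linHom.2 fun q hq v => by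
      have e1 := hβ l ⟨q, hQC hq⟩ v
      have e2 := ha ⟨q, hQC hq⟩ hq (β l v)
      have e3 := hα j ⟨q, hQC hq⟩ (a (β l v))
      simp only [LinearMap.comp_apply]
      exact ((congrArg (fun y => α j (a y)) e1).trans (congrArg (α j) e2)).trans e3
    have hhr : ∀ g, ∀ q ∈ Q, h (g * q) = h g := fun g q hq => by
      simp only [h, hQfix.apply_mul g q hq]
    have hhl : ∀ g (c : C), h (c * g) = linHom τ τ c (h g) := fun g c => by
      ext w
      simp only [hhv, linHom_apply, LinearMap.comp_apply, mul_inv_rev, map_mul,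
        Module.End.mul_apply]
      rw [← hr j c, hs l c⁻¹]
      rfl
    have hαβ : α j ∘ₗ β l =
        relTr (linHom (res (ρ l) C) (res (ρ j) C)) (Q.subgroupOf C) (α j ∘ₗ a ∘ₗ β l) := by
      rw [← comp_relTr (hα j), ← relTr_comp (hβ l), ha1]
      rfl
    have hfh : cosetSum C (N : Set G)ᶜ (f j l) = cosetSum Q (N : Set G)ᶜ h := by
      rw [← cosetSum_trans hQC (fun g hg c hc => hmul g hg c (hCN hc)) hhr]
      congr 1
      ext1 g
      simp only [f]
      rw [hαβ]
      have e4 := cosetSum_eq_relTr hQC hQfix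
      have e5 : relTr (linHom (res (ρ l) C) (res (ρ j) C)) (Q.subgroupOf C) (α j ∘ₗ a ∘ₗ β l) = _ :=
        e4
      rw [e5]
      refine (map_cosetSum (((LinearMap.llcomp k W V W (r j)) ∘ₗ (LinearMap.lcomp k V (s l))) ∘ₗ
        linHom (ρ l) (ρ j) g) Q _ _).trans ?_
      congr 1
      ext1 x
      simp only [h, map_mul]
      rfl
    rw [hfh]
    exact inTr_bot_cosetSum (C.subtype.comp (Q.subgroupOf C).subtype)
      (fun g hg q => hmul' g hg _ (hCN q.1.2)) (fun g hg q hq => hmul g hg q (hCN (hQC hq)))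
      (fun g hg q hq => Subtype.ext (Subtype.ext (hfree g hg _ q.2 hq)))
      _ (fun q g => hhl g q.1) hhr
  have hadd : ∀ j l, t (cosetSum C (N : Set G) (f j l)) = if j = l then 1 else 0 := fun j l => by
    have h2 := hta _ _ (hsN j l) (hsN' j l)
    rw [cosetSum_add_compl, hz, add_zero, hsum] at h2
    rw [← h2]
    split_ifs
    · exact ht1
    · exact (ht0 0 Intw.zero).2 (by
        have := hτ.1
        exact not_isUnit_zero)
  have hts : ∀ (T : Finset (N ⧸ C.subgroupOf N)) j l,
      t (∑ x ∈ T, f j l (x.out : N)) = ∑ x ∈ T, t (f j l (x.out : N)) := fun T j l => by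
    induction T using Finset.induction_on with
    | empty =>
      refine (ht0 0 Intw.zero).2 ?_
      have := hτ.1
      exact not_isUnit_zero
    | insert x T hx ih =>
      rw [Finset.sum_insert hx, Finset.sum_insert hx, ← ih, hta _ _ (hfN _ _ _ (Subtype.prop _))]
      exact Intw.sum _ fun x _ => hfN _ _ _ (Subtype.prop _)
  have hrank : ∀ x : N ⧸ C.subgroupOf N, ∃ v w : ι → k, ∀ j l,
      t (f j l (x.out : N)) = v j * w l := fun x =>
    exists_rank_one htm ht0 (fun j => r j ∘ₗ ρ j (x.out : N) ∘ₗ α j)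
      (fun l => β l ∘ₗ ρ l (x.out : N)⁻¹ ∘ₗ s l) fun j l => hfN j l _ (Subtype.prop _)
  choose v w hvw using hrank
  refine exists_ne_ite_of_card_lt ?_ v w fun j l => ?_
  · rwa [← Nat.card_eq_fintype_card, ← Nat.card_eq_fintype_card]
  · rw [← hadd, ← cosetSum_subgroup hCN (hfr j l), cosetSum_univ, hts]
    refine (Fintype.sum_congr _ _ fun x => (hvw x j l).symm).trans ?_
    congr!

end Count

section Brauer

set_option linter.unusedSectionVars false

open Representation

attribute [local instance] Fintype.ofFinite

open scoped Classical

section MapH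

variable (k : Type*) {G H K : Type*} [Field k] [Group G] [Group H] [Group K]

/-- The homomorphism of group algebras induced by a group homomorphism. -/
noncomputable abbrev mapH (φ : H →* G) : MonoidAlgebra k H →ₐ[k] MonoidAlgebra k G :=
  MonoidAlgebra.mapDomainAlgHom k k φ

variable {k}

theorem mapH_apply (φ : H →* G) (a : MonoidAlgebra k H) :
    mapH k φ a = MonoidAlgebra.mapDomainRingHom k φ a := rfl

theorem mapH_of (φ : H →* G) (h : H) :
    mapH k φ (MonoidAlgebra.of k H h) = MonoidAlgebra.of k G (φ h) := by simp

theorem mapH_comp (φ : H →* G) (ψ : K →* H) (a : MonoidAlgebra k K) :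
    mapH k (φ.comp ψ) a = mapH k φ (mapH k ψ a) :=
  congrFun (congrArg DFunLike.coe (MonoidAlgebra.mapDomainAlgHom_comp (R := k) (A := k) ψ φ)) a

theorem mapH_coeff {φ : H →* G} (hφ : Function.Injective φ) (a : MonoidAlgebra k H) (h : H) :
    (mapH k φ a).coeff (φ h) = a.coeff h :=
  Finsupp.mapDomain_apply hφ _ _

theorem mapH_coeff_of_notMem {φ : H →* G} (a : MonoidAlgebra k H) {g : G} (hg : g ∉ φ.range) :
    (mapH k φ a).coeff g = 0 :=
  Finsupp.mapDomain_of_notMem_range _ _ (by simpa using hg)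

theorem mapH_injective {φ : H →* G} (hφ : Function.Injective φ) :
    Function.Injective (mapH k φ) := MonoidAlgebra.mapDomain_injective hφ

theorem mapH_conjRep (φ : H →* G) (h : H) (a : MonoidAlgebra k H) :
    mapH k φ (conjRep k H h a) = conjRep k G (φ h) (mapH k φ a) := by
  rw [conjRep_apply, conjRep_apply, map_mul, map_mul, mapH_of, mapH_of, map_inv]

theorem conjRep_eq_mapH (g : G) (a : MonoidAlgebra k G) :
    conjRep k G g a = mapH k (MulAut.conj g : G ≃* G).toMonoidHom a := by
  ext x
  have h : x = (MulAut.conj g : G ≃* G).toMonoidHom (g⁻¹ * x * g) := by simp [mul_assoc]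
  rw [conjRep_coeff]
  conv_rhs => rw [h, mapH_coeff (MulAut.conj g).injective]

/-- An automorphism preserving `C` restricts to `C`. -/
noncomputable def restrict (σ : G ≃* G) (C : Subgroup G) (h : ∀ g, σ g ∈ C ↔ g ∈ C) : C ≃* C where
  toFun c := ⟨σ c, (h c).2 c.2⟩
  invFun c := ⟨σ.symm c, (h _).1 (by simp)⟩
  left_inv c := by ext; simp
  right_inv c := by ext; simp
  map_mul' c d := by ext; simp

theorem mapH_restrict (σ : G ≃* G) (C : Subgroup G) (h : ∀ g, σ g ∈ C ↔ g ∈ C)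
    (a : MonoidAlgebra k C) :
    mapH k C.subtype (mapH k (restrict σ C h : C →* C) a) =
      mapH k (σ : G →* G) (mapH k C.subtype a) := by
  rw [← mapH_comp, ← mapH_comp]
  rfl

end MapH

section Trunc

variable {k G : Type*} [Field k] [Group G] (C : Subgroup G)

/-- Truncation of an element of the group algebra to a subgroup. -/
noncomputable def trunc : MonoidAlgebra k G →ₗ[k] MonoidAlgebra k G where
  toFun a := .ofCoeff (a.coeff.filter (· ∈ C))
  map_add' a b := by ext; simp [Finsupp.filter_add]
  map_smul' r a := by ext; simp [Finsupp.filter_smul]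

variable {C}

theorem trunc_coeff (a : MonoidAlgebra k G) (g : G) :
    (trunc C a).coeff g = if g ∈ C then a.coeff g else 0 :=
  Finsupp.filter_apply (· ∈ C) a.coeff g

theorem trunc_mapH (y : MonoidAlgebra k C) : trunc C (mapH k C.subtype y) = mapH k C.subtype y := by
  ext g
  rw [trunc_coeff]
  split_ifs with h
  · rfl
  · rw [mapH_coeff_of_notMem]
    simpa using h

theorem exists_mapH_eq_trunc (a : MonoidAlgebra k G) :
    ∃ y : MonoidAlgebra k C, mapH k C.subtype y = trunc C a := by
  refine ⟨MonoidAlgebra.comapDomain C.subtype C.subtype_injective a, ?_⟩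
  ext g
  rw [trunc_coeff]
  split_ifs with h
  · have := mapH_coeff C.subtype_injective
      (MonoidAlgebra.comapDomain C.subtype C.subtype_injective a) ⟨g, h⟩
    rw [show C.subtype ⟨g, h⟩ = g from rfl] at this
    rw [this]
    simp
  · rw [mapH_coeff_of_notMem]
    simpa using h

theorem trunc_single (g : G) (r : k) :
    trunc C (MonoidAlgebra.single g r) = if g ∈ C then MonoidAlgebra.single g r else 0 := by
  ext x
  rw [trunc_coeff]
  by_cases hx : g = x
  · subst hx
    split_ifs <;> simp
  · split_ifs <;> simp [hx]

theorem trunc_mapH_mul (y : MonoidAlgebra k C) (a : MonoidAlgebra k G) :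
    trunc C (mapH k C.subtype y * a) = mapH k C.subtype y * trunc C a := by
  induction y using MonoidAlgebra.induction_linear with
  | zero => simp
  | add f g hf hg => rw [map_add, add_mul, map_add, hf, hg, add_mul]
  | single c r =>
    induction a using MonoidAlgebra.induction_linear with
    | zero => simp
    | add f g hf hg => rw [mul_add, map_add, hf, hg, map_add, mul_add]
    | single g s =>
      simp only [MonoidAlgebra.mapDomainAlgHom_apply, MonoidAlgebra.mapDomain_single,
        MonoidAlgebra.single_mul_single, trunc_single, Subgroup.subtype_apply,
        C.mul_mem_cancel_left c.2]
      split_ifs <;> simp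

theorem trunc_one : trunc C (1 : MonoidAlgebra k G) = 1 := by
  have := trunc_mapH (k := k) (1 : MonoidAlgebra k C)
  rwa [map_one] at this

theorem trunc_mapH_equiv (σ : G ≃* G) (h : ∀ g, σ g ∈ C ↔ g ∈ C) (a : MonoidAlgebra k G) :
    trunc C (mapH k (σ : G →* G) a) = mapH k (σ : G →* G) (trunc C a) := by
  ext x
  obtain ⟨x, rfl⟩ := σ.surjective x
  have := fun a : MonoidAlgebra k G => mapH_coeff (φ := (σ : G →* G)) σ.injective a x
  rw [trunc_coeff]
  erw [this, this]
  rw [trunc_coeff]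
  simp [h]

theorem trunc_conjRep {n : G} (hn : ∀ g, n * g * n⁻¹ ∈ C ↔ g ∈ C) (a : MonoidAlgebra k G) :
    trunc C (conjRep k G n a) = conjRep k G n (trunc C a) := by
  rw [conjRep_eq_mapH, conjRep_eq_mapH]
  exact trunc_mapH_equiv (MulAut.conj n) hn a

end Trunc

section TraceLemma


theorem IsBlockIdem.inTr_of_not_isNilpotent {k G : Type} [Field k] [Group G] [Finite G]
    {b z : MonoidAlgebra k G} (hb : IsBlockIdem (MonoidAlgebra k G) b) {H : Subgroup G}
    (hz : InTr (conjRep k G) H z) (hn : ¬ IsNilpotent (b * z)) : InTr (conjRep k G) H b := by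
  have hzc : ∀ x, x * z = z * x := central_iff.2 fun g => by
    obtain ⟨a, ha, rfl⟩ := hz
    exact isFix_relTr ha g trivial
  obtain ⟨y, hy, e⟩ := hb.exists_mul_eq k hzc hn
  rw [← e, hzc]
  exact (hz.mul_central hb.2.1.2).mul_central hy

theorem IsBlockIdem.not_isNilpotent {A : Type} [Ring A] {b : A} (hb : IsBlockIdem A b) :
    ¬ IsNilpotent b := fun ⟨n, hn⟩ => hb.1 (by
  rcases Nat.eq_zero_or_pos n with rfl | h
  · have : (1 : A) = 0 := by simpa using hn
    rw [← mul_one b, this, mul_zero]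
  · have : IsIdempotentElem b := hb.2.1.1
    rwa [this.pow_eq h.ne'] at hn)

/-- If `b` is a trace from `Q` and the sum of an equivariant family over a finite `Q`-set, then
`b` is a trace from the stabilizer of a point at which the family does not vanish. -/
theorem IsBlockIdem.exists_stabilizer {k G : Type} [Field k] [Group G] [Finite G]
    {b : MonoidAlgebra k G} (hb : IsBlockIdem (MonoidAlgebra k G) b) {Q : Subgroup G}
    (hQ : InTr (conjRep k G) Q b) {X : Type*} [MulAction Q X] [Finite X]
    (F : X → MonoidAlgebra k G) (hF : ∀ (q : Q) x, F (q • x) = conjRep k G q (F x))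
    (hsum : ∑ x, F x = b) :
    ∃ x, F x ≠ 0 ∧ InTr (conjRep k G) ((MulAction.stabilizer Q x).map Q.subtype) b := by
  obtain ⟨a, ha, hab⟩ := hQ
  have hF' : ∀ (q : Q) x, F (q • x) * a = (conjRep k G).comp Q.subtype q (F x * a) := fun q x => by
    change _ = conjRep k G q (F x * a)
    rw [conjRep_mul, ha q q.2, hF]
  let S : X → Subgroup G := fun x => (MulAction.stabilizer Q x).map Q.subtype
  have hSQ : ∀ x, S x ≤ Q := fun x => by
    rintro _ ⟨y, -, rfl⟩
    exact y.2
  have hS : ∀ x, (S x).subgroupOf Q = MulAction.stabilizer Q x := fun x =>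
    Subgroup.comap_map_eq_self_of_injective Q.subtype_injective _
  have hfix : ∀ x, IsFix (conjRep k G) (S x) (F x * a) := by
    rintro x _ ⟨q, hq, rfl⟩
    exact isFix_stabilizer (R := (conjRep k G).comp Q.subtype) (F := fun x => F x * a) hF' x q hq
  have h1 : b = ∑ ω : MulAction.orbitRel.Quotient Q X,
      relTr (conjRep k G) (S ω.out) (F ω.out * a) := by
    calc b = relTr (conjRep k G) Q (b * a) := by
          conv_lhs => rw [← hb.2.1.1]
          nth_rw 2 [← hab]
          exact map_relTr (LinearMap.mulLeft k b) (fun g x => by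
            simp only [LinearMap.mulLeft_apply, conjRep_mul, central_iff.1 hb.2.1.2]) Q a
      _ = relTr (conjRep k G) Q (∑ x, F x * a) := by rw [← hsum, Finset.sum_mul]
      _ = _ := by
          rw [sum_eq_sum_relTr (R := (conjRep k G).comp Q.subtype) (fun x => F x * a) hF', map_sum]
          refine Finset.sum_congr rfl fun ω _ => ?_
          rw [← hS, relTr_relTr (hSQ _) (hfix _)]
  have hcen : ∀ x y, y * relTr (conjRep k G) (S x) (F x * a) =
      relTr (conjRep k G) (S x) (F x * a) * y := fun x => central_iff.2 fun g =>
    isFix_relTr (hfix x) g trivial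
  by_contra! hc
  refine hb.not_isNilpotent ?_
  rw [← hb.2.1.1]
  nth_rw 2 [h1]
  rw [Finset.mul_sum]
  refine Commute.isNilpotent_sum (fun ω _ => ?_) fun ω ω' _ _ => ?_
  · by_cases h0 : F ω.out = 0
    · rw [h0, zero_mul, map_zero, mul_zero]
      exact IsNilpotent.zero
    · by_contra hn
      exact hc _ h0 (hb.inTr_of_not_isNilpotent ⟨_, hfix _, rfl⟩ hn)
  · have h2 : ∀ x, Commute b (relTr (conjRep k G) (S x) (F x * a)) := fun x => hcen x b
    have h3 : ∀ x y, Commute y (relTr (conjRep k G) (S x) (F x * a)) := fun x y => hcen x y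
    exact ((Commute.refl b).mul_right (h2 _)).mul_left ((h2 _).symm.mul_right (h3 _ _))

end TraceLemma

end Brauer

section BrauerMap

set_option linter.unusedSectionVars false

open Representation

attribute [local instance] Fintype.ofFinite

open scoped Classical

variable {k G : Type*} [Field k] [Group G] [Finite G] {p : ℕ} [Fact p.Prime] [CharP k p]
  {Z C : Subgroup G}

theorem mul_comm_of_isCyclic [IsCyclic Z] : ∀ x ∈ Z, ∀ y ∈ Z, x * y = y * x := fun x hx y hy => by
  obtain ⟨d, hd⟩ := IsCyclic.exists_generator (α := Z)
  obtain ⟨i, hi⟩ := Subgroup.mem_zpowers_iff.1 (hd ⟨x, hx⟩)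
  obtain ⟨j, hj⟩ := Subgroup.mem_zpowers_iff.1 (hd ⟨y, hy⟩)
  have : (⟨x, hx⟩ : Z) * ⟨y, hy⟩ = ⟨y, hy⟩ * ⟨x, hx⟩ := by
    rw [← hi, ← hj, ← zpow_add, ← zpow_add, add_comm]
  exact congrArg Subtype.val this

theorem trunc_eq_zero_of_inTr (hZ : Nat.card Z = p) (hC : ∀ g, g ∈ C ↔ ∀ q ∈ Z, q * g = g * q)
    {m : MonoidAlgebra k G} (hm : InTr ((conjRep k G).comp Z.subtype) ⊥ m) : trunc C m = 0 := by
  obtain ⟨a, -, rfl⟩ := hm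
  rw [relTr_bot, map_sum]
  have : ∀ q : Z, trunc C ((conjRep k G).comp Z.subtype q a) = trunc C a := fun q => by
    ext x
    rw [trunc_coeff, trunc_coeff]
    split_ifs with hx
    · refine (conjRep_coeff (q : G) a x).trans ?_
      rw [mul_assoc, ← (hC x).1 hx q q.2, inv_mul_cancel_left]
    · rfl
  simp only [this]
  rw [Finset.sum_const, ← Nat.cast_smul_eq_nsmul k]
  convert zero_smul k _
  rw [← CharP.cast_eq_zero k p, ← hZ, Nat.card_eq_fintype_card, @Finset.card_univ Z (Fintype.ofFinite Z)]
  congr!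

theorem inTr_of_trunc_eq_zero (hZ : Nat.card Z = p) (hC : ∀ g, g ∈ C ↔ ∀ q ∈ Z, q * g = g * q)
    {m : MonoidAlgebra k G} (hm : IsFix (conjRep k G) Z m) (h0 : trunc C m = 0) :
    InTr ((conjRep k G).comp Z.subtype) ⊥ m := by
  have hmem : ∀ (q : Z) (g : G), (q : G) * g * (q : G)⁻¹ ∈ C → g ∈ C := fun q g hg => by
    have hq : (q : G) ∈ C := (hC q).2 fun q' hq' => by
      have : IsCyclic Z := isCyclic_of_prime_card hZ
      exact mul_comm_of_isCyclic q' hq' q q.2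
    rw [mul_assoc, C.mul_mem_cancel_left hq, C.mul_mem_cancel_right (C.inv_mem hq)] at hg
    exact hg
  let _ : MulAction Z {g : G // g ∉ C} :=
    { smul := fun q g => ⟨q * g * (q : G)⁻¹, fun h => g.2 (hmem q g h)⟩
      one_smul := fun g => Subtype.ext (by
        change ((1 : Z) : G) * g * ((1 : Z) : G)⁻¹ = g
        simp)
      mul_smul := fun q q' g => Subtype.ext (by
        change ((q * q' : Z) : G) * g * ((q * q' : Z) : G)⁻¹ =
          q * (q' * g * (q' : G)⁻¹) * (q : G)⁻¹
        simp [mul_assoc]) }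
  have hsm : ∀ (q : Z) (g : {g : G // g ∉ C}), ((q • g : {g : G // g ∉ C}) : G) =
    q * g * (q : G)⁻¹ := fun q g => rfl
  have h1 : m = ∑ g : {g : G // g ∉ C}, MonoidAlgebra.single (g : G) (m.coeff g) := by
    ext x
    rw [MonoidAlgebra.coeff_sum, Finset.sum_apply']
    by_cases hx : x ∈ C
    · have := congrArg (fun a => a.coeff x) h0
      simp only [trunc_coeff, if_pos hx] at this
      rw [this, Finset.sum_eq_zero]
      · rfl
      · rintro g -
        have : (g : G) ≠ x := fun h => g.2 (h ▸ hx)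
        simp [this]
    · rw [Finset.sum_eq_single ⟨x, hx⟩]
      · simp
      · rintro g - hg
        have : (g : G) ≠ x := fun h => hg (Subtype.ext h)
        simp [this]
      · simp
  rw [h1]
  convert inTr_bot_of_free (R := (conjRep k G).comp Z.subtype)
    (F := fun g : {g : G // g ∉ C} => MonoidAlgebra.single (g : G) (m.coeff g)) (fun q g => ?_)
    fun q g hg => ?_
  · change _ = conjRep k G q _
    rw [conjRep_apply, hsm]
    have := congrArg (fun a => a.coeff (g : G)) (hm q⁻¹ (Z.inv_mem q.2))
    simp only [conjRep_coeff, inv_inv] at this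
    simp [this]
  · by_contra hq
    apply g.2
    have hq' : (q : G) ∈ Subgroup.centralizer {(g : G)} := by
      rw [Subgroup.mem_centralizer_singleton_iff]
      have := congrArg Subtype.val hg
      rw [hsm, mul_inv_eq_iff_eq_mul] at this
      exact this
    refine (hC g).2 fun z hz => ?_
    obtain ⟨i, hi⟩ := Subgroup.mem_zpowers_iff.1 (mem_zpowers_of_prime_card hZ hq (g' := ⟨z, hz⟩))
    have hi' : (q : G) ^ i = z := congrArg Subtype.val hi
    rw [← hi']
    exact Subgroup.mem_centralizer_singleton_iff.1 (Subgroup.zpow_mem _ hq' i)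

theorem trunc_mul (hZ : Nat.card Z = p) (hC : ∀ g, g ∈ C ↔ ∀ q ∈ Z, q * g = g * q)
    {a b : MonoidAlgebra k G} (ha : IsFix (conjRep k G) Z a) (hb : IsFix (conjRep k G) Z b) :
    trunc C (a * b) = trunc C a * trunc C b := by
  obtain ⟨y, hy⟩ := exists_mapH_eq_trunc (C := C) a
  have hZC : ∀ q ∈ Z, ∀ g, q * g * q⁻¹ ∈ C ↔ g ∈ C := fun q hq g => by
    have hq : q ∈ C := (hC q).2 fun q' hq' => by
      have : IsCyclic Z := isCyclic_of_prime_card hZ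
      exact mul_comm_of_isCyclic q' hq' q hq
    rw [mul_assoc, C.mul_mem_cancel_left hq, C.mul_mem_cancel_right (C.inv_mem hq)]
  have h1 : trunc C (a - trunc C a) = 0 := by
    rw [map_sub, ← hy, trunc_mapH, hy, sub_self]
  have h2 : InTr ((conjRep k G).comp Z.subtype) ⊥ (a - trunc C a) :=
    inTr_of_trunc_eq_zero hZ hC (fun q hq => by
      rw [map_sub, ← trunc_conjRep (hZC q hq), ha q hq]) h1
  have h3 : InTr ((conjRep k G).comp Z.subtype) ⊥ ((a - trunc C a) * b) :=
    h2.map (LinearMap.mulRight k b) fun q x => by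
      change conjRep k G q x * b = conjRep k G q (x * b)
      rw [conjRep_mul, hb q q.2]
  have h4 := trunc_eq_zero_of_inTr hZ hC h3
  rw [sub_mul, map_sub, sub_eq_zero] at h4
  rw [h4, ← hy, trunc_mapH_mul]

/-- The truncation of a relative trace. -/
theorem trunc_relTr (hZ : Nat.card Z = p) (hC : ∀ g, g ∈ C ↔ ∀ q ∈ Z, q * g = g * q)
    {N Q : Subgroup G} (hZN : Z ≤ N) (hQN : Q ≤ N) (hNC : ∀ n ∈ N, ∀ g, n * g * n⁻¹ ∈ C ↔ g ∈ C)
    (hfree : ∀ g, g ∉ N → ∀ q ∈ Z, g⁻¹ * q * g ∈ Q → q = 1)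
    {a : MonoidAlgebra k G} (ha : IsFix (conjRep k G) Q a) :
    trunc C (relTr (conjRep k G) Q a) =
      cosetSum Q (N : Set G) fun g => conjRep k G g (trunc C a) := by
  have hmul : ∀ g ∈ (N : Set G)ᶜ, ∀ c ∈ N, g * c ∈ (N : Set G)ᶜ := fun g hg c hc h => hg (by
    simpa using N.mul_mem h (N.inv_mem hc))
  have hmul' : ∀ g ∈ (N : Set G)ᶜ, ∀ c ∈ N, c * g ∈ (N : Set G)ᶜ := fun g hg c hc h => hg (by
    simpa using N.mul_mem (N.inv_mem hc) h)
  rw [relTr_apply, ← cosetSum_add_compl Q (N : Set G), map_add, map_cosetSum,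
    trunc_eq_zero_of_inTr hZ hC (m := cosetSum Q (N : Set G)ᶜ fun g => conjRep k G g a), add_zero]
  · exact cosetSum_congr Q _ fun g hg => trunc_conjRep (hNC g hg) a
  · refine inTr_bot_cosetSum Z.subtype (fun g hg q => hmul' g hg _ (hZN q.2))
      (fun g hg q hq => hmul g hg q (hQN hq))
      (fun g hg q hq => Subtype.ext (hfree g hg q q.2 hq)) _ (fun q g => ?_)
      fun g q hq => ha.apply_mul g q hq
    rw [map_mul]
    rfl

end BrauerMap

section Correspondence

set_option linter.unusedSectionVars false

open Representation

attribute [local instance] Fintype.ofFinite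

open scoped Classical

theorem mapH_iterate_eq {k G : Type*} [Field k] [Group G] {σ : G ≃* G} {j : ℕ}
    (h : (⇑σ)^[j] = id) : (⇑(mapH k (σ : G →* G)))^[j] = id := by
  have h1 : ∀ (j : ℕ) g (r : k), (⇑(mapH k (σ : G →* G)))^[j] (MonoidAlgebra.single g r) =
      MonoidAlgebra.single ((⇑σ)^[j] g) r := fun j g r => by
    induction j generalizing g with
    | zero => rfl
    | succ j ih =>
      rw [Function.iterate_succ_apply, Function.iterate_succ_apply, ← ih]
      simp
  ext1 a
  induction a using MonoidAlgebra.induction_linear with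
  | zero => exact iterate_map_zero _ _
  | add f g hf hg => rw [iterate_map_add, hf, hg]; rfl
  | single g r => rw [h1, h]; rfl

theorem eq_zero_of_isNilpotent_of_mul_self {A : Type*} [Ring A] {e : A} (he : e * e = e)
    (hn : IsNilpotent e) : e = 0 := by
  obtain ⟨n, hn⟩ := hn
  rcases Nat.eq_zero_or_pos n with rfl | h
  · have : (1 : A) = 0 := by simpa using hn
    rw [← mul_one e, this, mul_zero]
  · have : IsIdempotentElem e := he
    rwa [this.pow_eq h.ne'] at hn

/-- A form of Brauer's first main theorem for the centralizer of a subgroup of prime order of a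
group `Q` from which the block `b` is a trace. -/
theorem exists_correspondent {k G : Type} [Field k] [Group G] [Finite G] {p : ℕ}
    [Fact p.Prime] [CharP k p] {Z C N Q : Subgroup G} (hZ : Nat.card Z = p)
    (hC : ∀ g, g ∈ C ↔ ∀ q ∈ Z, q * g = g * q) (hZQ : Z ≤ Q) (hQC : Q ≤ C) (hCN : C ≤ N)
    (hNC : ∀ n ∈ N, ∀ g, n * g * n⁻¹ ∈ C ↔ g ∈ C)
    (hfree : ∀ g, g ∉ N → ∀ q ∈ Q, g⁻¹ * q * g ∈ Q → q = 1) (hidx : C.relIndex N < p)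
    {σ : G ≃* G} {m : ℕ} (hσm : (⇑σ)^[p ^ m] = id) (hσC : ∀ g, σ g ∈ C ↔ g ∈ C)
    (hσN : ∀ g, σ g ∈ N ↔ g ∈ N) {b : MonoidAlgebra k G}
    (hb : IsBlockIdem (MonoidAlgebra k G) b)
    (hbσ : MonoidAlgebra.mapDomainRingHom k (σ : G →* G) b = b)
    (hbQ : InTr (conjRep k G) Q b) (hne : trunc C b ≠ 0) :
    ∃ c : MonoidAlgebra k C, IsBlockIdem (MonoidAlgebra k C) c ∧
      InTr (conjRep k C) (Q.subgroupOf C) c ∧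
      MonoidAlgebra.mapDomainRingHom k (restrict σ C hσC : C →* C) c = c ∧
      ∃ η, (∀ a, a * η = η * a) ∧
        b * relTr (conjRep k G) C (mapH k C.subtype c) * η = b := by
  obtain ⟨a, ha, hab⟩ := hbQ
  have hZN : Z ≤ N := hZQ.trans (hQC.trans hCN)
  have hQN : Q ≤ N := hQC.trans hCN
  have hbcen : ∀ g, conjRep k G g b = b := central_iff.1 hb.2.1.2
  have hfix : ∀ {x : MonoidAlgebra k G}, (∀ g, conjRep k G g x = x) → IsFix (conjRep k G) Z x :=
    fun h g _ => h g
  obtain ⟨bC, hbC⟩ := exists_mapH_eq_trunc (C := C) b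
  obtain ⟨aC, haC⟩ := exists_mapH_eq_trunc (C := C) a
  have hinj : Function.Injective (mapH k C.subtype) := mapH_injective C.subtype_injective
  have hconj : ∀ (g : C) x, mapH k C.subtype (conjRep k C g x) =
    conjRep k G g (mapH k C.subtype x) := mapH_conjRep C.subtype
  have hmapTr : ∀ y : MonoidAlgebra k C,
      mapH k C.subtype (relTr (conjRep k C) (Q.subgroupOf C) y) =
        relTr ((conjRep k G).comp C.subtype) (Q.subgroupOf C) (mapH k C.subtype y) := fun y =>
    map_relTr (R' := (conjRep k G).comp C.subtype) (mapH k C.subtype).toLinearMap hconj _ y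
  have hmapFix : ∀ y : MonoidAlgebra k C, IsFix (conjRep k C) (Q.subgroupOf C) y →
      IsFix (conjRep k G) Q (mapH k C.subtype y) := fun y hy q hq => by
    have := hconj ⟨q, hQC hq⟩ y
    rw [hy ⟨q, hQC hq⟩ hq] at this
    exact this.symm
  have hSN : ∀ g ∈ (N : Set G), ∀ h ∈ C, g * h ∈ (N : Set G) := fun g hg h hh =>
    N.mul_mem hg (hCN hh)
  -- Truncation of a trace from `Q` of an element supported on `C`.
  have htr : ∀ (x : MonoidAlgebra k G) (y : MonoidAlgebra k C), IsFix (conjRep k G) Q x →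
      IsFix (conjRep k C) (Q.subgroupOf C) y → mapH k C.subtype y = trunc C x →
      trunc C (relTr (conjRep k G) Q x) = ∑ n : N ⧸ C.subgroupOf N, conjRep k G (n.out : N)
        (mapH k C.subtype (relTr (conjRep k C) (Q.subgroupOf C) y)) := fun x y hx hy hxy => by
    have h1 : IsFix (conjRep k G) C
        (mapH k C.subtype (relTr (conjRep k C) (Q.subgroupOf C) y)) := fun g hg => by
      rw [← hconj ⟨g, hg⟩, isFix_relTr hy ⟨g, hg⟩ trivial]
    rw [trunc_relTr hZ hC hZN hQN hNC (fun g hg q hq => hfree g hg q (hZQ hq)) hx, ← hxy,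
      ← cosetSum_relTr hQC (hmapFix y hy) hSN, ← hmapTr,
      ← cosetSum_subgroup hCN fun g h hh => h1.apply_mul g h hh, cosetSum_univ]
    congr!
  have hauto : ∀ n ∈ N, ∃ φ : MonoidAlgebra k C ≃+* MonoidAlgebra k C,
      ∀ x, conjRep k G n (mapH k C.subtype x) = mapH k C.subtype (φ x) := fun n hn => by
    refine ⟨MonoidAlgebra.mapDomainRingEquiv k (restrict (MulAut.conj n) C (hNC n hn)), fun x => ?_⟩
    rw [conjRep_eq_mapH]
    exact (mapH_restrict (MulAut.conj n) C (hNC n hn) x).symm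
  have hbN : ∀ n ∈ N, conjRep k G n (trunc C b) = trunc C b := fun n hn => by
    rw [← trunc_conjRep (hNC n hn), hbcen]
  have hbCc : ∀ x, x * bC = bC * x := central_iff.2 fun g => hinj (by
    rw [hconj, hbC, hbN g (hCN g.2)])
  have hbb : trunc C b * trunc C b = trunc C b := by
    rw [← trunc_mul hZ hC (hfix hbcen) (hfix hbcen), hb.2.1.1]
  have hbCi : bC * bC = bC := hinj (by rw [map_mul, hbC, hbb])
  have haCfix : IsFix (conjRep k C) (Q.subgroupOf C) aC := fun q hq => hinj (by
    rw [hconj, haC, ← trunc_conjRep (hNC q (hCN q.2)), ha q hq])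
  set t := relTr (conjRep k C) (Q.subgroupOf C) aC with ht
  have htc : ∀ x, x * t = t * x := central_iff.2 fun g => isFix_relTr haCfix g trivial
  have hbt : ¬ IsNilpotent (bC * t) := fun hnil => by
    refine hne (eq_zero_of_isNilpotent_of_mul_self hbb ?_)
    have h1 := htr a aC ha haCfix haC
    rw [hab, ← ht] at h1
    rw [← hbb]
    nth_rw 2 [h1]
    rw [Finset.mul_sum]
    have h2 : ∀ n : N, ∃ y : MonoidAlgebra k C, (∀ x, x * y = y * x) ∧ IsNilpotent y ∧
        trunc C b * conjRep k G n (mapH k C.subtype t) = mapH k C.subtype y := fun n => by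
      obtain ⟨φ, hφ⟩ := hauto n n.2
      refine ⟨φ (bC * t), fun x => φ.symm.injective ?_, hnil.map φ, ?_⟩
      · rw [map_mul φ.symm x, map_mul φ.symm _ x, φ.symm_apply_apply, ← mul_assoc, hbCc, mul_assoc,
          htc, mul_assoc]
      · rw [← hφ, map_mul, conjRep_mul, hbC, hbN n n.2]
    choose y hyc hyn hy using h2
    simp only [hy]
    exact Commute.isNilpotent_sum (fun x _ => (hyn _).map _) fun x x' _ _ =>
      Commute.map (show Commute (y _) (y _) from hyc _ _) (mapH k C.subtype)
  obtain ⟨c, hc, hbc, hct⟩ := exists_blockIdem k htc ⟨hbCi, hbCc⟩ hbt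
  have hcQ : InTr (conjRep k C) (Q.subgroupOf C) c :=
    hc.inTr_of_not_isNilpotent ⟨aC, haCfix, rfl⟩ hct
  obtain ⟨y, hy, hyc⟩ := hcQ
  have hcC : IsFix (conjRep k G) C (mapH k C.subtype c) := fun g hg => by
    rw [← hconj ⟨g, hg⟩, central_iff.1 hc.2.1.2]
  have hT : relTr (conjRep k G) C (mapH k C.subtype c) =
      relTr (conjRep k G) Q (mapH k C.subtype y) := by
    rw [← hyc, hmapTr, relTr_relTr hQC (hmapFix y hy)]
  set T := relTr (conjRep k G) C (mapH k C.subtype c) with hTdef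
  have hTcen : ∀ g, conjRep k G g T = T := fun g => isFix_relTr hcC g trivial
  have hBT : trunc C T = ∑ n : N ⧸ C.subgroupOf N, conjRep k G (n.out : N)
      (mapH k C.subtype c) := by
    rw [hT, htr _ y (hmapFix y hy) hy (trunc_mapH y).symm, hyc]
  have hort : ∀ d, IsBlockIdem (MonoidAlgebra k C) d → ∀ n ∈ N, mapH k C.subtype d *
      conjRep k G n (mapH k C.subtype c) =
        if mapH k C.subtype d = conjRep k G n (mapH k C.subtype c) then mapH k C.subtype d
        else 0 := fun d hd n hn => by
    obtain ⟨φ, hφ⟩ := hauto n hn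
    rw [hφ, ← map_mul]
    split_ifs with h
    · rw [← hinj h, hd.2.1.1]
    · by_contra h0
      refine h (congrArg _ (hd.eq_of_mul_ne_zero (hc.map φ) fun h1 => h0 ?_))
      rw [h1, map_zero]
  have hcT : ∃ l : k, l ≠ 0 ∧ mapH k C.subtype c * trunc C T = l • mapH k C.subtype c := by
    refine ⟨((Finset.univ.filter fun n : N ⧸ C.subgroupOf N => mapH k C.subtype c =
      conjRep k G (n.out : N) (mapH k C.subtype c)).card : k), ?_, ?_⟩
    · rw [Ne, CharP.cast_eq_zero_iff k p]
      refine Nat.not_dvd_of_pos_of_lt (Finset.card_pos.2 ⟨((1 : N) : N ⧸ C.subgroupOf N), ?_⟩)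
        (lt_of_le_of_lt (Finset.card_le_univ _) ?_)
      · obtain ⟨h, hh, e⟩ := exists_out_eq_mul (C.subgroupOf N) 1
        rw [Finset.mem_filter, e, one_mul, hcC h hh]
        exact ⟨Finset.mem_univ _, rfl⟩
      · rw [← Nat.card_eq_fintype_card]
        exact hidx
    · rw [hBT, Finset.mul_sum, Finset.sum_congr rfl fun n _ => hort c hc _ (Subtype.prop _),
        ← Finset.sum_filter, Finset.sum_const, Nat.cast_smul_eq_nsmul]
  have hcb : mapH k C.subtype c * trunc C b = mapH k C.subtype c := by
    rw [← hbC, ← map_mul, hbCc, hbc]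
  have hbT : ¬ IsNilpotent (b * T) := by
    rintro ⟨n, hn⟩
    obtain ⟨l, hl, hcl⟩ := hcT
    have hbTc : ∀ g, conjRep k G g (b * T) = b * T := fun g => by
      rw [conjRep_mul, hbcen, hTcen]
    have h1 : ∀ n g, conjRep k G g ((b * T) ^ n) = (b * T) ^ n := fun n g => by
      induction n with
      | zero => rw [pow_zero, conjRep_apply, mul_one, of_mul_of_inv]
      | succ n ih => rw [pow_succ, conjRep_mul, ih, hbTc]
    have h2 : ∀ n, mapH k C.subtype c * trunc C ((b * T) ^ n) = l ^ n • mapH k C.subtype c :=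
      fun n => by
        induction n with
        | zero => rw [pow_zero, pow_zero, trunc_one, mul_one, one_smul]
        | succ n ih =>
          rw [pow_succ', trunc_mul hZ hC (hfix hbTc) (hfix (h1 n)),
            trunc_mul hZ hC (hfix hbcen) (hfix hTcen), ← mul_assoc, ← mul_assoc, hcb, hcl,
            smul_mul_assoc, ih, smul_smul, pow_succ']
    have h3 := h2 n
    rw [hn, map_zero, mul_zero] at h3
    exact hc.1 (hinj (by
      rw [map_zero]
      exact (smul_eq_zero.1 h3.symm).resolve_left (pow_ne_zero n hl)))
  obtain ⟨η, hη, hbη⟩ := hb.exists_mul_eq k (central_iff.2 hTcen) hbT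
  refine ⟨c, hc, ⟨y, hy, hyc⟩, ?_, η, hη, hbη⟩
  set c' := MonoidAlgebra.mapDomainRingHom k (restrict σ C hσC : C →* C) c with hc'
  have hc'b : IsBlockIdem (MonoidAlgebra k C) c' :=
    hc.map (MonoidAlgebra.mapDomainRingEquiv k (restrict σ C hσC))
  have hιc' : mapH k C.subtype c' = mapH k (σ : G →* G) (mapH k C.subtype c) :=
    mapH_restrict σ C hσC c
  have hex : ∃ n ∈ N, mapH k C.subtype c' = conjRep k G n (mapH k C.subtype c) := by
    by_contra! hno
    have h1 : mapH k C.subtype c' * trunc C T = 0 := by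
      rw [hBT, Finset.mul_sum]
      refine Finset.sum_eq_zero fun n _ => ?_
      rw [hort c' hc'b _ (Subtype.prop _), if_neg (hno _ (Subtype.prop _))]
    have h2 : mapH k C.subtype c' * trunc C b = mapH k C.subtype c' := by
      have h3 : trunc C b = mapH k (σ : G →* G) (trunc C b) := by
        rw [← trunc_mapH_equiv σ hσC, mapH_apply, hbσ]
      rw [h3, hιc', ← map_mul, hcb]
    have h4 : trunc C b = trunc C b * trunc C T * trunc C η := by
      conv_lhs => rw [← hbη]
      rw [trunc_mul hZ hC (hfix fun g => by rw [conjRep_mul, hbcen, hTcen])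
        (hfix (central_iff.1 hη)), trunc_mul hZ hC (hfix hbcen) (hfix hTcen)]
    refine hc'b.1 (hinj ?_)
    rw [← h2, h4, ← mul_assoc, ← mul_assoc, h2, h1, zero_mul, map_zero]
  have hfixed := apply_eq_of_iterate_prime_pow (f := ⇑(mapH k (σ : G →* G)))
    (S := Set.range fun n : N => conjRep k G n (mapH k C.subtype c)) Fact.out
    (mapH_iterate_eq hσm) (Set.finite_range _) ?_ ?_ (mapH k C.subtype c) ⟨1, by simp⟩
  · exact hinj (hιc'.trans hfixed)
  · rintro _ ⟨n, rfl⟩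
    obtain ⟨n', hn', e⟩ := hex
    refine ⟨⟨σ n * n', N.mul_mem ((hσN n).2 n.2) hn'⟩, ?_⟩
    have h5 := mapH_conjRep (k := k) (σ : G →* G) (n : G) (mapH k C.subtype c)
    rw [← hιc', e] at h5
    refine Eq.trans ?_ h5.symm
    exact congrFun (congrArg DFunLike.coe (map_mul (conjRep k G) (σ n) n')) _
  · refine lt_of_le_of_lt ?_ hidx
    have h6 : (Set.range fun n : N => conjRep k G n (mapH k C.subtype c)) ⊆
        (fun n : N ⧸ C.subgroupOf N => conjRep k G (n.out : N) (mapH k C.subtype c)) ''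
          Set.univ := by
      rintro _ ⟨n, rfl⟩
      obtain ⟨h, hh, e⟩ := exists_out_eq_mul (C.subgroupOf N) n
      refine ⟨(n : N ⧸ C.subgroupOf N), trivial, ?_⟩
      simp only [e]
      exact hcC.apply_mul n h hh
    refine (Set.ncard_le_ncard h6 (Set.toFinite _)).trans
      ((Set.ncard_image_le (Set.toFinite _)).trans ?_)
    rw [Set.ncard_univ]
    rfl

end Correspondence

section CentralStep

set_option linter.unusedSectionVars false

open Representation

variable {k G V W S : Type*} [Field k] [Group G] [Finite G] [AddCommGroup V] [Module k V]
  [AddCommGroup W] [Module k W] [AddCommGroup S] [Module k S]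
  {ρ : Representation k G V} {τ : Representation k G W} {υ : Representation k G S}

theorem exists_intw_extend_range {Q : Subgroup G} {d : G}
    (hd : ∀ q ∈ Q, ∃ n : ℕ, q = d ^ n) {a : Module.End k W}
    (ha1 : relTr (linHom τ τ) Q a = 1) (ha : IntwOn Q τ τ a) {n : ℕ} {ι : S →ₗ[k] V}
    (hι : Intw υ ρ ι) (hinj : Function.Injective ι) (hr : ∀ v, ∃ s, ι s = ((ρ d - 1) ^ n) v)
    (hs : ∀ s, ∃ v, ι s = ((ρ d - 1) ^ n) v) {φ : S →ₗ[k] W} (hφ : Intw υ τ φ)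
    (hr' : ∀ s, ∃ w, φ s = ((τ d - 1) ^ n) w) : ∃ Ψ : V →ₗ[k] W, Intw ρ τ Ψ ∧ Ψ ∘ₗ ι = φ := by
  obtain ⟨π, hπ⟩ := ι.exists_leftInverse_of_injective (LinearMap.ker_eq_bot.2 hinj)
  have hπ' : ∀ s, π (ι s) = s := LinearMap.congr_fun hπ
  obtain ⟨Φ, hΦ, hΦ'⟩ := exists_extend_of_range_pow (ρ d - 1) (τ d - 1) n (φ ∘ₗ π)
    (fun v => by
      obtain ⟨s, hs⟩ := hr v
      rw [← hs]
      simp only [LinearMap.sub_apply, LinearMap.comp_apply, Module.End.one_apply, map_sub, hπ',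
        ← hφ d s, ← hι d s])
    (fun v => by
      obtain ⟨s, hs⟩ := hr v
      rw [← hs, LinearMap.comp_apply, hπ']
      exact hr' s)
  have hΦι : Φ ∘ₗ ι = φ := LinearMap.ext fun s => by
    obtain ⟨v, hv⟩ := hs s
    rw [LinearMap.comp_apply, hv, hΦ', ← hv, LinearMap.comp_apply, hπ']
  have hΦd : ∀ v, Φ (ρ d v) = τ d (Φ v) := fun v => by simpa using hΦ v
  have hΦn : ∀ (n : ℕ) v, Φ (ρ (d ^ n) v) = τ (d ^ n) (Φ v) := fun n v => by
    induction n generalizing v with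
    | zero => simp
    | succ n ih => rw [pow_succ, map_mul, map_mul, Module.End.mul_apply, ih, hΦd]; rfl
  have hΦQ : IntwOn Q ρ τ Φ := fun q hq v => by
    obtain ⟨n, rfl⟩ := hd q hq
    exact hΦn n v
  rw [← hΦι]
  exact exists_intw_extend ha1 ha hΦQ hι (hΦι ▸ hφ)

theorem sub_one_pow_prime_pow {p : ℕ} [Fact p.Prime] [CharP k p] (ρ : Representation k G V)
    (d : G) (s i : ℕ) : (ρ d - 1) ^ (p ^ s * i) = (ρ (d ^ p ^ s) - 1) ^ i := by
  rcases subsingleton_or_nontrivial V with h | h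
  · exact Subsingleton.elim _ _
  · have : CharP (Module.End k V) p :=
      charP_of_injective_algebraMap (algebraMap k (Module.End k V)).injective p
    rw [pow_mul, sub_pow_char_pow_of_commute _ _ (Commute.one_right _), one_pow, map_pow]

/-- A generator of a cyclic `p`-group one of whose `p`-power powers is a given element. -/
theorem exists_generator_pow_eq {p : ℕ} [hp : Fact p.Prime] {Q : Subgroup G} [IsCyclic Q]
    (hQ : IsPGroup p Q) {z : G} (hz : z ∈ Q) :
    ∃ d ∈ Q, (∀ q ∈ Q, ∃ n : ℕ, q = d ^ n) ∧ ∃ s, z = d ^ p ^ s := by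
  obtain ⟨d, hd⟩ := IsCyclic.exists_monoid_generator (α := Q)
  obtain ⟨n, hn⟩ := hd ⟨z, hz⟩
  obtain ⟨n, hn0, hn⟩ : ∃ n : ℕ, n ≠ 0 ∧ d ^ n = ⟨z, hz⟩ := by
    refine ⟨n + orderOf d, by have := orderOf_pos d; omega, ?_⟩
    rw [pow_add, pow_orderOf_eq_one, mul_one]
    exact hn
  obtain ⟨s, u, hu, rfl⟩ := Nat.exists_eq_pow_mul_and_not_dvd hn0 p hp.out.ne_one
  have hcop : u.Coprime (orderOf d) := by
    obtain ⟨t, ht⟩ := hQ d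
    exact (Nat.Coprime.pow_right t ((hp.out.coprime_iff_not_dvd.2 hu).symm)).coprime_dvd_right
      (orderOf_dvd_of_pow_eq_one ht)
  obtain ⟨m, hm⟩ := exists_pow_eq_self_of_coprime hcop
  refine ⟨(d ^ u : Q), Subtype.prop _, fun q hq => ?_, s, ?_⟩
  · obtain ⟨j, hj⟩ := hd ⟨q, hq⟩
    refine ⟨m * j, ?_⟩
    have h1 : (d ^ u) ^ (m * j) = ⟨q, hq⟩ := by
      rw [pow_mul, hm]
      exact hj
    exact (congrArg Subtype.val h1).symm
  · have h1 : (d ^ u) ^ p ^ s = ⟨z, hz⟩ := by rw [← pow_mul, mul_comm, hn]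
    exact (congrArg Subtype.val h1).symm

/-- Stability of an indecomposable module with vertex contained in a cyclic group, given
stability of its submodules on which a central element acts trivially. -/
theorem repIso_twist_of_central [FiniteDimensional k W] {p : ℕ} [Fact p.Prime] [CharP k p]
    {Q : Subgroup G} [IsCyclic Q] (hQ : IsPGroup p Q) {z : G} (hzQ : z ∈ Q)
    (hzc : ∀ g, z * g = g * z) {σ : G ≃* G} (hσz : σ z = z) (hσQ : ∀ g, σ g ∈ Q ↔ g ∈ Q)
    (hτ : Indec τ) {a : Module.End k W}
    (ha1 : relTr (linHom τ τ) Q a = 1) (ha : IntwOn Q τ τ a)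
    (hind : ∀ (S : Submodule k W) (hS : ∀ g, ∀ v ∈ S, τ g v ∈ S), (∀ v ∈ S, τ z v = v) →
      RepIso (twist (subRep τ S hS) σ) (subRep τ S hS)) :
    RepIso (twist τ σ) τ := by
  have := hτ.1
  obtain ⟨d, hdQ, hd, s, hs⟩ := exists_generator_pow_eq hQ hzQ
  have hd' : ∀ q ∈ Q, ∃ n : ℕ, q = (σ.symm d) ^ n := fun q hq => by
    obtain ⟨n, hn⟩ := hd (σ q) ((hσQ q).2 hq)
    exact ⟨n, by rw [← map_pow, ← hn, σ.symm_apply_apply]⟩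
  have hnil : ∃ n, (τ z - 1) ^ n = 0 := by
    obtain ⟨t, ht⟩ := hQ ⟨z, hzQ⟩
    have ht' : z ^ p ^ t = 1 := congrArg Subtype.val ht
    refine ⟨p ^ t * 1, ?_⟩
    rw [sub_one_pow_prime_pow, ht', map_one, sub_self, pow_one]
  classical
  obtain ⟨i, hi⟩ : ∃ i, Nat.find hnil = i + 1 := by
    refine Nat.exists_eq_succ_of_ne_zero fun h => ?_
    have := Nat.find_spec hnil
    rw [h, pow_zero] at this
    exact one_ne_zero this
  have hi1 : (τ z - 1) ^ (i + 1) = 0 := hi ▸ Nat.find_spec hnil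
  have hi0 : (τ z - 1) ^ i ≠ 0 := Nat.find_min hnil (by omega)
  have hcz : ∀ g, Commute (τ z - 1) (τ g) := fun g =>
    Commute.sub_left (by rw [Commute, SemiconjBy, ← map_mul, hzc, map_mul]) (Commute.one_left _)
  have hS : ∀ g, ∀ v ∈ LinearMap.range ((τ z - 1) ^ i), τ g v ∈ LinearMap.range ((τ z - 1) ^ i) := by
    rintro g _ ⟨v, rfl⟩
    exact ⟨τ g v, LinearMap.congr_fun ((hcz g).pow_left i).eq v⟩
  have hSz : ∀ v ∈ LinearMap.range ((τ z - 1) ^ i), τ z v = v := by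
    rintro _ ⟨v, rfl⟩
    have h1 := LinearMap.congr_fun hi1 v
    rw [pow_succ', Module.End.mul_apply] at h1
    exact sub_eq_zero.1 h1
  obtain ⟨e, he⟩ := hind _ hS hSz
  have hne : Nontrivial (LinearMap.range ((τ z - 1) ^ i)) := by
    rw [Submodule.nontrivial_iff_ne_bot, Ne, LinearMap.range_eq_bot]
    exact hi0
  have hT : ∀ τ' : Representation k G W, (τ' d - 1) ^ (p ^ s * i) = (τ' z - 1) ^ i := fun τ' => by
    rw [sub_one_pow_prime_pow, hs]
  have hz' : twist τ σ z = τ z := by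
    show τ (σ z) = τ z
    rw [hσz]
  have hsub : Intw (subRep τ _ hS) τ (LinearMap.range ((τ z - 1) ^ i)).subtype := fun _ _ => rfl
  have h1 : ∀ w : LinearMap.range ((τ z - 1) ^ i), ∃ v, (w : W) = ((τ z - 1) ^ i) v := by
    rintro ⟨_, v, rfl⟩
    exact ⟨v, rfl⟩
  have h2 : ∀ v, ∃ w : LinearMap.range ((τ z - 1) ^ i), (w : W) = ((τ z - 1) ^ i) v :=
    fun v => ⟨⟨_, v, rfl⟩, rfl⟩
  have haσ : relTr (linHom (twist τ σ) (twist τ σ)) Q a = 1 := by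
    rw [relTr_linHom_twist hσQ ha, ha1]
  obtain ⟨Ψ, hΨ, hΨ'⟩ := exists_intw_extend_range (ρ := twist τ σ) (τ := τ) hd ha1 ha
    (n := p ^ s * i) (hsub.twist σ) Subtype.val_injective (by rw [hT, hz']; exact h2)
    (by rw [hT, hz']; exact h1) (hsub.comp he) (by rw [hT]; exact fun s => h1 _)
  obtain ⟨Φ, hΦ, hΦ'⟩ := exists_intw_extend_range (ρ := τ) (τ := twist τ σ) hd haσ
    (fun q hq v => ha _ ((hσQ q).2 hq) v)
    (n := p ^ s * i) hsub Subtype.val_injective (by rw [hT]; exact h2)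
    (by rw [hT]; exact h1) ((hsub.twist σ).comp (Intw.equiv_symm he))
    (by rw [hT, hz']; exact fun s => h1 _)
  exact repIso_of_extend (hτ.twist σ) hτ Subtype.val_injective
    (ι := (LinearMap.range ((τ z - 1) ^ i)).subtype)
    (ι' := (LinearMap.range ((τ z - 1) ^ i)).subtype) (e := e) hΨ
    (fun s => LinearMap.congr_fun hΨ' s) hΦ fun s => LinearMap.congr_fun hΦ' s

end CentralStep

section CentralQuotient

set_option linter.unusedSectionVars false

open Representation

attribute [local instance] Fintype.ofFinite

theorem relTr_comp_surjective {k A G D : Type*} [Field k] [AddCommGroup A] [Module k A] [Group G]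
    [Finite G] [Group D] [Finite D] {R : Representation k D A} {π : G →* D}
    (hπ : Function.Surjective π) {H : Subgroup G} {K : Subgroup D} (hH : ∀ g, π g ∈ K ↔ g ∈ H)
    {a : A} (ha : IsFix R K a) :
    relTr (MonoidHom.comp R π) H a = relTr R K a := by
  rw [relTr_apply, relTr_apply, cosetSum_def]
  symm
  refine cosetSum_eq_sum (f := fun g => R g a) (fun g h hh => ha.apply_mul g h hh)
    (fun x : {x : G ⧸ H // x.out ∈ Set.univ} => π x.1.out) (by simp) (by simp) ?_
  intro g _
  obtain ⟨g, rfl⟩ := hπ g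
  simpa only [← map_inv, ← map_mul, hH] using
    existsUnique_out (H := H) (S := Set.univ) (by simp) (Set.mem_univ g)

variable {k G D : Type} [Field k] [Group G] [Finite G] [Group D] [Finite D] {p : ℕ} [Fact p.Prime]
  [CharP k p] {π : G →* D} {z : G} 

theorem mapH_surjective (hπ : Function.Surjective π) : Function.Surjective (mapH k π) := fun a => by
  induction a using MonoidAlgebra.induction_linear with
  | zero => exact ⟨0, map_zero _⟩
  | add f g hf hg =>
    obtain ⟨x, rfl⟩ := hf
    obtain ⟨y, rfl⟩ := hg
    exact ⟨x + y, map_add _ _ _⟩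
  | single g r =>
    obtain ⟨g, rfl⟩ := hπ g
    exact ⟨MonoidAlgebra.single g r, by simp⟩

theorem inTr_mapH (hπ : Function.Surjective π) {Q : Subgroup G} (hQ : π.ker ≤ Q)
    {c : MonoidAlgebra k G} (hc : InTr (conjRep k G) Q c) :
    InTr (conjRep k D) (Q.map π) (mapH k π c) := by
  obtain ⟨a, ha, rfl⟩ := hc
  have hfix : IsFix (conjRep k D) (Q.map π) (mapH k π a) := by
    rintro _ ⟨q, hq, rfl⟩
    rw [← mapH_conjRep, ha q hq]
  refine ⟨mapH k π a, hfix, ?_⟩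
  rw [← relTr_comp_surjective hπ (H := Q) (fun g => ?_) hfix]
  · exact (map_relTr (R' := MonoidHom.comp (conjRep k D) π) (mapH k π).toLinearMap
      (mapH_conjRep π) _ a).symm
  · exact ⟨fun ⟨q, hq, h⟩ => by
      have : q⁻¹ * g ∈ π.ker := by simp [MonoidHom.mem_ker, h]
      simpa using Q.mul_mem hq (hQ this), fun h => ⟨g, h, rfl⟩⟩

theorem exists_eq_mul_of_mapH_eq_zero (hπ : Function.Surjective π) (hker : ∀ g, π g = 1 → ∃ n : ℕ, g = z ^ n)
    {x : MonoidAlgebra k G} (hx : mapH k π x = 0) :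
    ∃ y, x = (MonoidAlgebra.of k G z - 1) * y := by
  have key : ∀ x : MonoidAlgebra k G, ∃ y, x - MonoidAlgebra.mapDomain
      (fun d => (Function.surjInv hπ d)) (mapH k π x) = (MonoidAlgebra.of k G z - 1) * y := fun x => by
    induction x using MonoidAlgebra.induction_linear with
    | zero => exact ⟨0, by simp⟩
    | add f g hf hg =>
      obtain ⟨x, hx⟩ := hf
      obtain ⟨y, hy⟩ := hg
      refine ⟨x + y, ?_⟩
      rw [mul_add, ← hx, ← hy, map_add, MonoidAlgebra.mapDomain_add]
      abel
    | single g r =>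
      obtain ⟨n, hn⟩ := hker (g * (Function.surjInv hπ (π g))⁻¹) (by
        rw [map_mul, map_inv, Function.surjInv_eq hπ, mul_inv_cancel])
      obtain ⟨y, hy⟩ := (Commute.one_right (MonoidAlgebra.of k G z)).sub_dvd_pow_sub_pow n
      refine ⟨y * MonoidAlgebra.single (Function.surjInv hπ (π g)) r, ?_⟩
      have hg : g = z ^ n * Function.surjInv hπ (π g) := by rw [← hn, inv_mul_cancel_right]
      rw [← mul_assoc, ← hy, one_pow, sub_mul, one_mul, ← map_pow]
      simp [MonoidAlgebra.single_mul_single, ← hg]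
  obtain ⟨y, hy⟩ := key x
  refine ⟨y, ?_⟩
  rw [← hy, hx]
  simp

theorem IsBlockIdem.mapH_of_central (hπ : Function.Surjective π)
    (hker : ∀ g, π g = 1 → ∃ n : ℕ, g = z ^ n) (hz : ∀ g, z * g = g * z) (hzp : z ^ p = 1)
    {c : MonoidAlgebra k G} (hc : IsBlockIdem (MonoidAlgebra k G) c) :
    IsBlockIdem (MonoidAlgebra k D) (mapH k π c) := by
  set w := MonoidAlgebra.of k G z - 1 with hw
  have hwc : ∀ x, w * x = x * w := fun x => by
    have h1 : x * MonoidAlgebra.of k G z = MonoidAlgebra.of k G z * x :=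
      central_iff.2 (fun g => by
        rw [conjRep_apply, ← map_mul, ← map_mul, ← hz, mul_inv_cancel_right]) x
    rw [hw, sub_mul, mul_sub, one_mul, mul_one, h1]
  have hwp : w ^ p = 0 := by
    have : CharP (MonoidAlgebra k G) p :=
      charP_of_injective_algebraMap (algebraMap k (MonoidAlgebra k G)).injective p
    rw [hw, sub_pow_char_of_commute p (Commute.one_right _), one_pow, ← map_pow, hzp, map_one,
      sub_self]
  have hK : ∀ x : MonoidAlgebra k G, mapH k π x = 0 → ∃ y, x = w * y :=
    fun x => exists_eq_mul_of_mapH_eq_zero hπ hker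
  have hnil : ∀ x : MonoidAlgebra k G, mapH k π x = 0 → IsNilpotent x := fun x hx => by
    obtain ⟨y, rfl⟩ := hK x hx
    exact ⟨p, by rw [Commute.mul_pow (hwc y), hwp, zero_mul]⟩
  have hlift : ∀ e, IsCentralIdem (MonoidAlgebra k D) e →
      ∃ e', IsCentralIdem (MonoidAlgebra k G) e' ∧ mapH k π e' = e := by
    rintro e ⟨he, hec⟩
    obtain ⟨e', hee', he'⟩ := exists_isIdempotentElem_eq_of_ker_isNilpotent (mapH k π).toRingHom
      hnil e (mapH_surjective hπ e) he
    have he' : mapH k π e' = e := he'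
    refine ⟨e', ⟨hee', ?_⟩, he'⟩
    have key : ∀ u v : MonoidAlgebra k G, u * u = u → v * v = v →
        (∀ x, mapH k π u * x * mapH k π v = 0) → ∀ x, u * x * v = 0 := by
      intro u v hu hv h x
      have h1 : ∀ n : ℕ, ∀ x, ∃ y, u * x * v = w ^ n * (u * y * v) := fun n => by
        induction n with
        | zero => exact fun x => ⟨x, by simp⟩
        | succ n ih =>
          intro x
          obtain ⟨y, hy⟩ := ih x
          obtain ⟨y', hy'⟩ := hK (u * y * v) (by rw [map_mul, map_mul, h])
          refine ⟨y', ?_⟩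
          have h2 : u * y * v = u * (u * y * v) * v := by
            rw [← mul_assoc, ← mul_assoc, hu, mul_assoc _ v, hv]
          rw [hy, h2, hy', ← mul_assoc u, ← hwc, pow_succ]
          simp only [mul_assoc]
      obtain ⟨y, hy⟩ := h1 p x
      rw [hy, hwp, zero_mul]
    have hf : (1 - e') * (1 - e') = 1 - e' := by
      have := hee'.one_sub; exact this
    have h1 := key e' (1 - e') hee' hf fun x => by
      rw [map_sub, map_one, he', ← hec, mul_assoc, mul_sub, he, mul_one, sub_self, mul_zero]
    have h2 := key (1 - e') e' hf hee' fun x => by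
      rw [map_sub, map_one, he', mul_assoc, hec, ← mul_assoc, sub_mul, he, one_mul, sub_self,
        zero_mul]
    intro x
    have h1' := h1 x
    have h2' := h2 x
    rw [mul_sub, mul_one, sub_eq_zero] at h1'
    rw [sub_mul, one_mul, sub_mul, sub_eq_zero] at h2'
    rw [h1', h2']
  refine ⟨fun h0 => hc.1 (eq_zero_of_isNilpotent_of_mul_self hc.2.1.1 (hnil c h0)),
    ⟨by rw [← map_mul, hc.2.1.1], fun x => ?_⟩, ?_⟩
  · obtain ⟨x, rfl⟩ := mapH_surjective hπ x
    rw [← map_mul, hc.2.1.2, map_mul]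
  · intro e f he hf hef hfe h
    obtain ⟨e', he', rfl⟩ := hlift e he
    have h1' : (1 - e') * (1 - e') = 1 - e' := by
      rw [mul_sub, mul_one, sub_mul, one_mul, he'.1, sub_self, sub_zero]
    have hf' : IsCentralIdem (MonoidAlgebra k G) (1 - e') :=
      ⟨h1', fun x => by rw [mul_sub, sub_mul, he'.2, mul_one, one_mul]⟩
    have h0 : e' * (1 - e') = 0 := by rw [mul_sub, mul_one, he'.1, sub_self]
    have h0' : (1 - e') * e' = 0 := by rw [sub_mul, one_mul, he'.1, sub_self]
    rcases hc.2.2 (c * e') (c * (1 - e')) (hc.2.1.mul he') (hc.2.1.mul hf')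
      (by rw [mul_assoc, ← mul_assoc e', ← he'.2 c, mul_assoc c e', h0, mul_zero, mul_zero])
      (by rw [mul_assoc, ← mul_assoc _ c, ← hf'.2 c, mul_assoc c, h0', mul_zero, mul_zero])
      (by rw [← mul_add]; simp) with h1 | h1
    · left
      have h2 := congrArg (mapH k π) h1
      rwa [map_mul, h, add_mul, hfe, add_zero, he.1, map_zero] at h2
    · right
      have h2 := congrArg (mapH k π) h1
      rwa [map_mul, h, map_sub, map_one, mul_sub, mul_one, add_mul, hfe, add_zero, he.1,
        add_sub_cancel_left, map_zero] at h2

end CentralQuotient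

section Induction

set_option linter.unusedSectionVars false

open Representation

/-- Modules in blocks that are traces from a cyclic `p`-subgroup of order `n` are stable under
automorphisms of `p`-power order that preserve the block and the subgroup. -/
def TwistStable (k : Type) [Field k] (p n : ℕ) : Prop :=
  ∀ (G : Type) [Group G] [Finite G] (Q : Subgroup G) [IsCyclic Q], Nat.card Q = n → IsPGroup p Q →
    ∀ (σ : G ≃* G) (m : ℕ), (⇑σ)^[p ^ m] = id → (∀ g, σ g ∈ Q ↔ g ∈ Q) →
    ∀ b : MonoidAlgebra k G, IsBlockIdem (MonoidAlgebra k G) b →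
    MonoidAlgebra.mapDomainRingHom k (σ : G →* G) b = b → InTr (conjRep k G) Q b →
    ∀ (V : Type) [AddCommGroup V] [Module k V] [FiniteDimensional k V] (ρ : Representation k G V),
      ρ.asAlgebraHom b = 1 → RepIso (twist ρ σ) ρ

theorem repIso_twist_of_central_mem {k G W : Type} [Field k] [Group G] [Finite G] {p : ℕ}
    [Fact p.Prime] [CharP k p] [AddCommGroup W] [Module k W] [FiniteDimensional k W]
    {Q : Subgroup G} [IsCyclic Q] (hQ : IsPGroup p Q) (ih : ∀ n < Nat.card Q, TwistStable k p n)
    {z : G} (hzQ : z ∈ Q) (hzc : ∀ g, z * g = g * z) (hz1 : z ≠ 1) (hzp : z ^ p = 1)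
    {σ : G ≃* G} {m : ℕ} (hσm : (⇑σ)^[p ^ m] = id) (hσz : σ z = z) (hσQ : ∀ g, σ g ∈ Q ↔ g ∈ Q)
    {c : MonoidAlgebra k G} (hc : IsBlockIdem (MonoidAlgebra k G) c)
    (hcσ : MonoidAlgebra.mapDomainRingHom k (σ : G →* G) c = c) (hcQ : InTr (conjRep k G) Q c)
    {τ : Representation k G W} (hτ : Indec τ) (hτc : τ.asAlgebraHom c = 1) :
    RepIso (twist τ σ) τ := by
  obtain ⟨a, ha, ha1⟩ := hcQ.asAlgebraHom τ
  rw [hτc] at ha1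
  refine repIso_twist_of_central hQ hzQ hzc hσz hσQ hτ ha1 (isFix_linHom.1 ha) fun S hS hz => ?_
  have hnormal : (Subgroup.zpowers z).Normal := ⟨by
    rintro _ ⟨n, rfl⟩ g
    have : Commute z g := hzc g
    rw [← (this.zpow_left n).eq, mul_inv_cancel_right]
    exact ⟨n, rfl⟩⟩
  have hmap : (Subgroup.zpowers z).map (σ : G →* G) = Subgroup.zpowers z := by
    rw [MonoidHom.map_zpowers]
    simp [hσz]
  have hzle : Subgroup.zpowers z ≤ Q := by simpa using hzQ
  set π := QuotientGroup.mk' (Subgroup.zpowers z) with hπ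
  have hπs : Function.Surjective π := QuotientGroup.mk'_surjective _
  have hker : ∀ g, π g = 1 → ∃ n : ℕ, g = z ^ n := fun g hg => by
    obtain ⟨n, hn⟩ := (mem_powers_iff_mem_zpowers (x := z)).2 ((QuotientGroup.eq_one_iff g).1 hg)
    exact ⟨n, hn.symm⟩
  have hπz : π z = 1 := (QuotientGroup.eq_one_iff z).2 (Subgroup.mem_zpowers z)
  let σ' := QuotientGroup.congr (Subgroup.zpowers z) (Subgroup.zpowers z) σ hmap
  have hσ' : ∀ g, σ' (π g) = π (σ g) := fun g => rfl
  have hmapmem : ∀ g, π g ∈ Q.map π ↔ g ∈ Q := fun g =>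
    ⟨fun ⟨q, hq, h⟩ => by
      have h1 : q⁻¹ * g ∈ π.ker := by simp [MonoidHom.mem_ker, h]
      rw [hπ, QuotientGroup.ker_mk'] at h1
      simpa using Q.mul_mem hq (hzle h1), fun h => ⟨g, h, rfl⟩⟩
  let υ := subRep τ S hS
  have hυ : ∀ g ∈ Subgroup.zpowers z, υ g = 1 := by
    have : υ z = 1 := LinearMap.ext fun v => Subtype.ext (hz v v.2)
    rintro _ ⟨n, rfl⟩
    obtain ⟨j, hj⟩ := (mem_powers_iff_mem_zpowers (x := z)).2 ⟨n, rfl⟩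
    simp only at hj ⊢
    rw [← hj, map_pow, this, one_pow]
  let υ' : Representation k (G ⧸ Subgroup.zpowers z) S := QuotientGroup.lift _ υ hυ
  have hυ' : ∀ g, υ' (π g) = υ g := fun g => rfl
  have hcyc : IsCyclic (Q.map π) :=
    isCyclic_of_surjective (π.subgroupMap Q) (π.subgroupMap_surjective Q)
  have hcard : Nat.card (Q.map π) < Nat.card Q := by
    refine lt_of_le_of_ne (Nat.card_le_card_of_surjective _ (π.subgroupMap_surjective Q)) fun h => ?_
    have hinj := ((Nat.bijective_iff_surjective_and_card (π.subgroupMap Q)).2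
      ⟨π.subgroupMap_surjective Q, h.symm⟩).1
    exact hz1 (congrArg Subtype.val (@hinj ⟨z, hzQ⟩ 1 (Subtype.ext (by simp [hπz]))))
  have hiter : ∀ j g, (⇑σ')^[j] (π g) = π ((⇑σ)^[j] g) := fun j g => by
    induction j generalizing g with
    | zero => rfl
    | succ j ih => rw [Function.iterate_succ_apply, Function.iterate_succ_apply, hσ', ih]
  obtain ⟨e, he⟩ := ih _ hcard _ (Q.map π) rfl (hQ.map π) σ' m (funext fun x => by
      obtain ⟨g, rfl⟩ := hπs x
      rw [hiter, hσm]
      rfl) (fun x => by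
      obtain ⟨g, rfl⟩ := hπs x
      rw [hσ', hmapmem, hmapmem, hσQ]) (mapH k π c) (hc.mapH_of_central hπs hker hzc hzp) (by
      rw [← mapH_apply, ← mapH_comp]
      conv_rhs => rw [← hcσ, ← mapH_apply, ← mapH_comp]
      rfl) (inTr_mapH hπs (by rw [hπ, QuotientGroup.ker_mk']; exact hzle) hcQ) S υ' (by
      have h1 := asAlgebraHom_comp υ' π c
      rw [← mapH_apply] at h1
      rw [← h1]
      refine LinearMap.ext fun v => Subtype.ext ?_
      have := subRep_asAlgebraHom τ S hS c v
      rw [hτc] at this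
      exact this)
  exact ⟨e, fun g v => he (π g) v⟩

end Induction

section Summand

set_option linter.unusedSectionVars false

open Representation

variable {k G V : Type*} [Field k] [Group G] [Finite G] [AddCommGroup V] [Module k V]
  [FiniteDimensional k V] {ρ : Representation k G V}

/-- An indecomposable representation that is relatively `C`-projective via an endomorphism
factoring through `e₀` is a summand of the representation induced from an indecomposable
summand of `e₀ V`. -/
theorem exists_indec_summand (hρ : Indec ρ) {C : Subgroup G} {e₀ η : Module.End k V}
    (he₀ : Intw (res ρ C) (res ρ C) e₀) (he₀' : e₀ * e₀ = e₀) (hη : Intw ρ ρ η)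
    (hT : IsUnit (relTr (linHom ρ ρ) C (e₀ * η))) :
    ∃ (S : Submodule k V) (hS : ∀ g, ∀ v ∈ S, res ρ C g v ∈ S), Indec (subRep (res ρ C) S hS) ∧
      (∀ v ∈ S, e₀ v = v) ∧ ∃ r β : V →ₗ[k] S, Intw (res ρ C) (subRep (res ρ C) S hS) r ∧
      Intw (res ρ C) (subRep (res ρ C) S hS) β ∧ r ∘ₗ S.subtype = LinearMap.id ∧
      relTr (linHom ρ ρ) C (S.subtype ∘ₗ β) = 1 := by
  classical
  let P : Module.End k V → Prop := fun e => Intw (res ρ C) (res ρ C) e ∧ e * e = e ∧ e₀ * e = e ∧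
    IsUnit (relTr (linHom ρ ρ) C (e * η))
  have hex : ∃ n e, P e ∧ Module.finrank k (LinearMap.range e) = n :=
    ⟨_, e₀, ⟨he₀, he₀', he₀', hT⟩, rfl⟩
  obtain ⟨e, ⟨he, hee, hee₀, hu⟩, hn⟩ := Nat.find_spec hex
  have hmin : ∀ f, P f → LinearMap.range f ≤ LinearMap.range e →
      LinearMap.range f = LinearMap.range e := fun f hf hle =>
    Submodule.eq_of_le_of_finrank_le hle (by
      rw [hn]
      exact Nat.find_min' hex ⟨f, hf, rfl⟩)
  have := hρ.1
  have hev : ∀ v, e (e v) = e v := LinearMap.congr_fun hee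
  have hIntw : ∀ f, Intw (res ρ C) (res ρ C) f → Intw ρ ρ (relTr (linHom ρ ρ) C (f * η)) :=
    fun f hf => intw_relTr ((intwOn_of_res hf).comp fun g _ v => hη g v)
  let r : V →ₗ[k] LinearMap.range e := e.rangeRestrict
  have hr : Intw (res ρ C) (subRep (res ρ C) _ he.range_mem) r := fun g v => Subtype.ext (he g v)
  have hrs : r ∘ₗ (LinearMap.range e).subtype = LinearMap.id := LinearMap.ext fun ⟨_, v, rfl⟩ =>
    Subtype.ext (hev v)
  have hsr : ∀ v, (r v : V) = e v := fun v => rfl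
  refine ⟨LinearMap.range e, he.range_mem, ⟨?_, fun f hf hff => ?_⟩, ?_, r, ?_⟩
  · rw [Submodule.nontrivial_iff_ne_bot, Ne, LinearMap.range_eq_bot]
    rintro rfl
    simp at hu
  · have hP : ∀ f : Module.End k (LinearMap.range e),
        Intw (subRep (res ρ C) _ he.range_mem) (subRep (res ρ C) _ he.range_mem) f →
        f * f = f → IsUnit (relTr (linHom ρ ρ) C
          (((LinearMap.range e).subtype ∘ₗ f ∘ₗ r : Module.End k V) * η)) → f = 1 := by
      intro f hf hff hfu
      have hrs' : ∀ w : LinearMap.range e, r w = w := LinearMap.congr_fun hrs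
      have h1 := hmin ((LinearMap.range e).subtype ∘ₗ f ∘ₗ r) ⟨fun g v => ?_, ?_, ?_, hfu⟩ ?_
      · refine LinearMap.ext fun w => ?_
        obtain ⟨v, hv⟩ : (w : V) ∈ LinearMap.range ((LinearMap.range e).subtype ∘ₗ f ∘ₗ r) := by
          rw [h1]
          exact w.2
        have hv' : f (r v) = w := Subtype.ext hv
        rw [← hv']
        exact LinearMap.congr_fun hff _
      · simp only [LinearMap.comp_apply, hr g v, hf g]
        rfl
      · refine LinearMap.ext fun v => congrArg Subtype.val ?_
        show f (r (f (r v))) = f (r v)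
        rw [hrs']
        exact LinearMap.congr_fun hff _
      · refine LinearMap.ext fun v => ?_
        show e₀ (f (r v)) = f (r v)
        obtain ⟨u, hu⟩ := (f (r v)).2
        rw [← hu]
        exact LinearMap.congr_fun hee₀ u
      · rintro _ ⟨v, rfl⟩
        exact (f (r v)).2
    have hsum : relTr (linHom ρ ρ) C (e * η) = relTr (linHom ρ ρ) C
          (((LinearMap.range e).subtype ∘ₗ f ∘ₗ r : Module.End k V) * η) +
        relTr (linHom ρ ρ) C
          (((LinearMap.range e).subtype ∘ₗ (1 - f) ∘ₗ r : Module.End k V) * η) := by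
      rw [← map_add, ← add_mul]
      congr 2
      ext v
      simp [hsr]
    rw [hsum] at hu
    have h1f : (1 - f) * (1 - f) = 1 - f := by
      rw [mul_sub, mul_one, sub_mul, one_mul, hff, sub_self, sub_zero]
    have hi : ∀ f : Module.End k (LinearMap.range e),
        Intw (subRep (res ρ C) _ he.range_mem) (subRep (res ρ C) _ he.range_mem) f →
        Intw (res ρ C) (res ρ C) ((LinearMap.range e).subtype ∘ₗ f ∘ₗ r) := fun f hf g v => by
      simp only [LinearMap.comp_apply, hr g v, hf g]
      rfl
    rcases hρ.isUnit_or_of_add (hIntw _ (hi f hf)) (hIntw _ (hi _ (Intw.one.sub hf))) hu with h | h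
    · exact Or.inr (hP f hf hff h)
    · left
      have := hP (1 - f) (Intw.one.sub hf) h1f h
      simpa using this
  · rintro _ ⟨v, rfl⟩
    exact LinearMap.congr_fun hee₀ v
  · obtain ⟨u, hu⟩ := hu
    have hi : Intw ρ ρ (↑u⁻¹ : Module.End k V) :=
      (hu ▸ hIntw e he).inv (by simp) (by simp)
    refine ⟨r ∘ₗ η ∘ₗ (↑u⁻¹ : Module.End k V), hr, hr.comp ((hη.comp hi).res C), hrs, ?_⟩
    have h1 : (LinearMap.range e).subtype ∘ₗ r ∘ₗ η ∘ₗ (↑u⁻¹ : Module.End k V) =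
        (e * η) ∘ₗ (↑u⁻¹ : Module.End k V) := LinearMap.ext fun v => rfl
    rw [h1, ← relTr_comp hi, ← hu]
    exact u.mul_inv

end Summand

section Powers

set_option linter.unusedSectionVars false

open Representation

variable {k G V : Type*} [Field k] [Group G] [AddCommGroup V] [Module k V]
  {ρ : Representation k G V}

theorem repIso_twist_pow {σ : MulAut G} (h : RepIso (twist ρ σ) ρ) (j : ℕ) :
    RepIso (twist ρ (σ ^ j)) ρ := by
  induction j with
  | zero => exact RepIso.refl _
  | succ j ih =>
    rw [pow_succ]
    exact (show RepIso (twist (twist ρ (σ ^ j)) σ) (twist ρ σ) from ih.twist σ).trans h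

theorem mulAut_pow_apply (σ : MulAut G) (j : ℕ) (g : G) : (σ ^ j) g = (⇑σ)^[j] g := by
  induction j generalizing g with
  | zero => rfl
  | succ j ih => rw [pow_succ, MulAut.mul_apply, ih, Function.iterate_succ_apply]

/-- If the orbit of `ρ` under an automorphism of `p`-power order is nontrivial, then it contains
`p` distinct isomorphism classes. -/
theorem not_repIso_twist_pow {σ : MulAut G} {p m : ℕ} (hp : p.Prime) (hσ : (⇑σ)^[p ^ m] = id)
    (h : ¬ RepIso (twist ρ σ) ρ) {i j : ℕ} (hi : i < p) (hj : j < p) (hij : i ≠ j) :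
    ¬ RepIso (twist ρ (σ ^ i)) (twist ρ (σ ^ j)) := by
  wlog hlt : i < j generalizing i j
  · exact fun h' => this hj hi hij.symm (by omega) h'.symm
  intro h'
  obtain ⟨d, rfl⟩ := Nat.exists_eq_add_of_lt hlt
  have h1 : RepIso ρ (twist ρ (σ ^ (d + 1))) := by
    refine RepIso.of_twist (σ := σ ^ i) (h'.trans ?_)
    rw [add_assoc, add_comm i, pow_add]
    exact RepIso.refl _
  have hσ1 : σ ^ p ^ m = 1 := MulEquiv.ext fun g => by rw [mulAut_pow_apply, hσ]; rfl
  have hcop : (d + 1).Coprime (orderOf σ) :=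
    (Nat.Coprime.pow_right m (Nat.coprime_of_lt_prime (n := d + 1) (by omega) (by omega) hp).symm).coprime_dvd_right
      (orderOf_dvd_of_pow_eq_one hσ1)
  obtain ⟨n, hn⟩ := exists_pow_eq_self_of_coprime hcop
  have h2 := repIso_twist_pow h1.symm n
  rw [hn] at h2
  exact h h2

end Powers

section Correspondent

set_option linter.unusedSectionVars false

open Representation

variable {k G V : Type} [Field k] [IsAlgClosed k] [Group G] [Finite G] [AddCommGroup V]
  [Module k V] [FiniteDimensional k V] {ρ : Representation k G V}

theorem repIso_twist_of_correspondent {p m : ℕ} (hp : p.Prime) (hρ : Indec ρ) (hnp : ¬ IsProj ρ)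
    {C N Q : Subgroup G} (hQC : Q ≤ C) (hCN : C ≤ N) (hNC : ∀ n ∈ N, ∀ g, n * g * n⁻¹ ∈ C ↔ g ∈ C)
    (hfree : ∀ g, g ∉ N → ∀ q ∈ Q, g⁻¹ * q * g ∈ Q → q = 1) (hidx : C.relIndex N < p)
    {σ : G ≃* G} (hσm : (⇑σ)^[p ^ m] = id) (hσC : ∀ g, σ g ∈ C ↔ g ∈ C)
    {b : MonoidAlgebra k G} (hρb : ρ.asAlgebraHom b = 1)
    {c : MonoidAlgebra k C} (hc : IsBlockIdem (MonoidAlgebra k C) c)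
    (hcQ : InTr (conjRep k C) (Q.subgroupOf C) c) {η : MonoidAlgebra k G}
    (hη : ∀ a, a * η = η * a)
    (hbη : b * relTr (conjRep k G) C (mapH k C.subtype c) * η = b)
    (hstab : ∀ (W : Type) [AddCommGroup W] [Module k W] [FiniteDimensional k W]
      (τ : Representation k C W), Indec τ → τ.asAlgebraHom c = 1 →
        RepIso (twist τ (restrict σ C hσC)) τ) :
    RepIso (twist ρ σ) ρ := by
  by_contra hne
  have hcomp : ∀ x, (res ρ C).asAlgebraHom x = ρ.asAlgebraHom (mapH k C.subtype x) := fun x =>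
    asAlgebraHom_comp ρ C.subtype x
  have hηi : Intw ρ ρ (ρ.asAlgebraHom η) := intw_of_central ρ hη
  have he : Intw (res ρ C) (res ρ C) (ρ.asAlgebraHom (mapH k C.subtype c)) := by
    rw [← hcomp]
    exact intw_of_central _ hc.2.1.2
  obtain ⟨S, hS, hτ, heS, r, β, hr, hβ, hrs, h1⟩ := exists_indec_summand hρ (C := C) he
    (by rw [← map_mul, ← map_mul, hc.2.1.1]) hηi (by
      have h2 := relTr_comp (ρ := ρ) hηi C (ρ.asAlgebraHom (mapH k C.subtype c)) (υ := ρ)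
      have h3 : ρ.asAlgebraHom (relTr (conjRep k G) C (mapH k C.subtype c)) =
          relTr (linHom ρ ρ) C (ρ.asAlgebraHom (mapH k C.subtype c)) := map_relTr (R' := linHom ρ ρ) ρ.asAlgebraHom.toLinearMap (asAlgebraHom_conjRep ρ) C
        (mapH k C.subtype c)
      have h4 : relTr (linHom ρ ρ) C (ρ.asAlgebraHom (mapH k C.subtype c) * ρ.asAlgebraHom η) = 1 := by
        refine h2.symm.trans ?_
        rw [← hρb]
        conv_rhs => rw [← hbη, map_mul, map_mul, hρb, one_mul]
        rw [h3]
        rfl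
      rw [h4]
      exact isUnit_one)
  set τ := subRep (res ρ C) S hS with hτdef
  have hτc : τ.asAlgebraHom c = 1 := LinearMap.ext fun v => Subtype.ext (by
    rw [hτdef, subRep_asAlgebraHom, hcomp]
    exact heS v v.2)
  obtain ⟨a, ha, ha1⟩ := hcQ.asAlgebraHom τ
  rw [hτc] at ha1
  have hs : Intw τ (res ρ C) S.subtype := fun _ _ => rfl
  have hτnp : ¬ IsProj τ := by
    rintro ⟨θ, hθ⟩
    refine hnp ⟨S.subtype ∘ₗ θ ∘ₗ β, ?_⟩
    have h2 : relTr (linHom (res ρ C) (res ρ C)) ⊥ (S.subtype ∘ₗ θ ∘ₗ β) = S.subtype ∘ₗ β := by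
      rw [← comp_relTr hs, ← relTr_comp hβ, hθ]
      rfl
    rw [← relTr_relTr (bot_le : ⊥ ≤ C) isFix_bot, Subgroup.bot_subgroupOf]
    rw [← h1, ← h2]
    rfl
  let σ' : MulAut G := σ
  have hσ' : ∀ (j : ℕ) g, (σ' ^ j) g ∈ C ↔ g ∈ C := fun j g => by
    induction j generalizing g with
    | zero => rfl
    | succ j ih => rw [pow_succ, MulAut.mul_apply, ih]; exact hσC g
  let σC : MulAut C := restrict σ C hσC
  have hσC' : ∀ (j : ℕ) (x : C), (((σC ^ j) x : C) : G) = (σ' ^ j) x := fun j x => by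
    induction j generalizing x with
    | zero => rfl
    | succ j ih => rw [pow_succ, pow_succ, MulAut.mul_apply, MulAut.mul_apply, ih]; rfl
  have hθ : ∀ j : ℕ, ∃ e : S ≃ₗ[k] S, Intw τ (twist τ (σC ^ j)) e.toLinearMap := fun j =>
    (repIso_twist_pow (hstab S τ hτ hτc) j).symm
  choose θ hθ using hθ
  have hres : ∀ (j : ℕ) (x : C), res (twist ρ (σ' ^ j)) C x = res ρ C ((σC ^ j) x) := fun j x => by
    show ρ ((σ' ^ j) x) = ρ ((σC ^ j) x : C)
    rw [hσC']
  have hto : ∀ (j : ℕ) {f : S →ₗ[k] V}, Intw τ (res ρ C) f →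
      Intw τ (res (twist ρ (σ' ^ j)) C) (f ∘ₗ (θ j).toLinearMap) := fun j f hf x v => by
    rw [hres, LinearMap.comp_apply, hθ j x v, LinearMap.comp_apply]
    exact hf _ _
  have hfrom : ∀ (j : ℕ) {f : V →ₗ[k] S}, Intw (res ρ C) τ f →
      Intw (res (twist ρ (σ' ^ j)) C) τ ((θ j).symm.toLinearMap ∘ₗ f) := fun j f hf x v => by
    rw [hres, LinearMap.comp_apply, hf, LinearMap.comp_apply]
    exact (hθ j).equiv_symm x (f v)
  have hcount := card_le_of_pairwise_not_repIso (ι := Fin p) (ρ := fun i => twist ρ (σ' ^ (i : ℕ)))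
    (fun i => hρ.twist _) (fun i j hij => not_repIso_twist_pow hp hσm hne i.2 j.2
      (fun h => hij (Fin.ext h))) hCN hQC (fun n hn c hc => by
        simpa using (hNC _ (N.inv_mem hn) c).2 hc) hfree hτ hτnp (isFix_linHom.1 ha) ha1
    (fun i => hto i hs) (fun i => hfrom i hβ) (fun i => by
      have h2 : (S.subtype ∘ₗ (θ i).toLinearMap) ∘ₗ (θ i).symm.toLinearMap ∘ₗ β =
          S.subtype ∘ₗ β := LinearMap.ext fun v => by simp
      rw [h2, relTr_linHom_twist (hσ' i) (intwOn_of_res (hs.comp hβ)), h1])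
    (fun i => hto i hs) (fun i => hfrom i hr) (fun i => LinearMap.ext fun w => by
      have h2 : r ((θ i w : S) : V) = θ i w := LinearMap.congr_fun hrs (θ i w)
      show (θ i).symm (r ((θ i w : S) : V)) = w
      rw [h2, LinearEquiv.symm_apply_apply])
  rw [Nat.card_fin] at hcount
  omega

end Correspondent

section CyclicSubgroup

set_option linter.unusedSectionVars false

variable {G : Type} [Group G] [Finite G] {p : ℕ} [hp : Fact p.Prime] {Q : Subgroup G}

theorem exists_orderOf_eq_prime [IsCyclic Q] (hQ : IsPGroup p Q) (hne : Q ≠ ⊥) :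
    ∃ z ∈ Q, orderOf z = p ∧ (∀ x ∈ Q, x ^ p = 1 → x ∈ Subgroup.zpowers z) ∧
      ∀ q ∈ Q, q ≠ 1 → ∃ j : ℕ, orderOf (q ^ j) = p := by
  classical
  have hpow : ∀ q ∈ Q, q ≠ 1 → ∃ j : ℕ, orderOf (q ^ j) = p := fun q hq hq1 => by
    obtain ⟨n, hn⟩ := hQ ⟨q, hq⟩
    have hn' : q ^ p ^ n = 1 := congrArg Subtype.val hn
    obtain ⟨j, -, hj⟩ := (Nat.dvd_prime_pow hp.out).1 (orderOf_dvd_of_pow_eq_one hn')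
    have hj0 : j ≠ 0 := by
      rintro rfl
      exact hq1 (orderOf_eq_one_iff.1 (by simpa using hj))
    obtain ⟨i, rfl⟩ := Nat.exists_eq_succ_of_ne_zero hj0
    refine ⟨p ^ i, ?_⟩
    rw [orderOf_pow_of_dvd (pow_ne_zero _ hp.out.ne_zero) (by rw [hj]; exact pow_dvd_pow p i.le_succ),
      hj, pow_succ, Nat.mul_div_cancel_left _ (pow_pos hp.out.pos _)]
  obtain ⟨q, hq, hq1⟩ := Q.bot_or_exists_ne_one.resolve_left hne
  obtain ⟨j, hj⟩ := hpow q hq hq1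
  refine ⟨q ^ j, Q.pow_mem hq j, hj, fun x hx hxp => ?_, hpow⟩
  set z : Q := ⟨q ^ j, Q.pow_mem hq j⟩ with hz
  have hzo : orderOf z = p := by rw [← hj, ← Subgroup.orderOf_coe]
  have : Fintype Q := Fintype.ofFinite Q
  have hle := IsCyclic.card_pow_eq_one_le (α := Q) hp.out.pos
  let T : Finset Q := Finset.univ.filter fun y => y ^ p = 1
  let Z : Finset Q := Finset.univ.filter fun y => y ∈ Subgroup.zpowers z
  have hZT : Z ⊆ T := fun y hy => by
    simp only [Z, T, Finset.mem_filter, Finset.mem_univ, true_and] at hy ⊢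
    rw [← hzo]
    obtain ⟨i, rfl⟩ := hy
    rw [← zpow_natCast, ← zpow_mul, mul_comm, zpow_mul, zpow_natCast, pow_orderOf_eq_one, one_zpow]
  have hZc : Z.card = p := by
    rw [← hzo, ← Nat.card_zpowers, Nat.card_eq_fintype_card, Fintype.card_subtype]
  have heq := Finset.eq_of_subset_of_card_le hZT (by rw [hZc]; exact hle)
  have hxT : (⟨x, hx⟩ : Q) ∈ Z := by
    rw [heq]
    simp only [T, Finset.mem_filter, Finset.mem_univ, true_and]
    exact Subtype.ext hxp
  simp only [Z, Finset.mem_filter, Finset.mem_univ, true_and] at hxT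
  obtain ⟨i, hi⟩ := hxT
  exact ⟨i, congrArg Subtype.val hi⟩

theorem relIndex_centralizer_lt {Z : Subgroup G} (hZ : Nat.card Z = p) :
    (Subgroup.centralizer (Z : Set G)).relIndex (Subgroup.normalizer (Z : Set G)) < p := by
  have : IsCyclic Z := isCyclic_of_prime_card hZ
  rw [Subgroup.relIndex, ← Subgroup.normalizerMonoidHom_ker, Subgroup.index_ker]
  have := Subgroup.card_le_card_group (Z.normalizerMonoidHom.range)
  rw [IsCyclic.card_mulAut, hZ, Nat.totient_prime hp.out] at this
  exact this.trans_lt (Nat.sub_lt hp.out.pos one_pos)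

theorem mul_mul_inv_mem_centralizer_iff {Z : Subgroup G} {n : G}
    (hn : n ∈ Subgroup.normalizer (Z : Set G)) (g : G) :
    n * g * n⁻¹ ∈ Subgroup.centralizer (Z : Set G) ↔ g ∈ Subgroup.centralizer (Z : Set G) := by
  have key : ∀ n ∈ Subgroup.normalizer (Z : Set G), ∀ g ∈ Subgroup.centralizer (Z : Set G),
      n * g * n⁻¹ ∈ Subgroup.centralizer (Z : Set G) := fun n hn g hg => by
    rw [Subgroup.mem_centralizer_iff] at hg ⊢
    intro q hq
    have h1 : n⁻¹ * q * n ∈ Z := by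
      simpa using (Subgroup.mem_normalizer_iff.1 (Subgroup.inv_mem _ hn) q).1 hq
    have h2 := hg _ h1
    calc q * (n * g * n⁻¹) = n * (n⁻¹ * q * n * g) * n⁻¹ := by group
      _ = n * (g * (n⁻¹ * q * n)) * n⁻¹ := by rw [h2]
      _ = _ := by group
  refine ⟨fun h => ?_, key n hn g⟩
  have := key _ (Subgroup.inv_mem _ hn) _ h
  simpa [mul_assoc] using this

theorem eq_one_of_inv_mul_mul_mem {z : G}
    (hzQ : ∀ x ∈ Q, x ^ p = 1 → x ∈ Subgroup.zpowers z) (hzp : orderOf z = p)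
    (hpow : ∀ q ∈ Q, q ≠ 1 → ∃ j : ℕ, orderOf (q ^ j) = p) {g : G}
    (hg : g ∉ Subgroup.normalizer (Subgroup.zpowers z : Set G)) {q : G} (hq : q ∈ Q)
    (hgq : g⁻¹ * q * g ∈ Q) : q = 1 := by
  by_contra hq1
  refine hg ?_
  obtain ⟨j, hj⟩ := hpow q hq hq1
  have hjp : (q ^ j) ^ p = 1 := by rw [← hj, pow_orderOf_eq_one]
  have h1 : q ^ j ∈ Subgroup.zpowers z := hzQ _ (Q.pow_mem hq j) hjp
  have hconj : g⁻¹ * q ^ j * g = (g⁻¹ * q * g) ^ j := by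
    have := conj_pow (i := j) (a := g⁻¹) (b := q)
    rw [inv_inv] at this
    exact this.symm
  have h2 : g⁻¹ * q ^ j * g ∈ Subgroup.zpowers z := by
    refine hzQ _ (hconj ▸ Q.pow_mem hgq j) ?_
    have := conj_pow (i := p) (a := g⁻¹) (b := q ^ j)
    rw [inv_inv] at this
    rw [this, hjp]
    simp
  have hgen : Subgroup.zpowers (q ^ j) = Subgroup.zpowers z :=
    Subgroup.eq_of_le_of_card_ge (by simpa using h1) (by simp [hj, hzp])
  rw [← hgen] at h2 ⊢
  rw [← Subgroup.inv_mem_iff]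
  refine Subgroup.mem_normalizer_fintype fun n hn => ?_
  obtain ⟨i, rfl⟩ := hn
  simp only [SetLike.mem_coe]
  rw [← conj_zpow, inv_inv]
  exact Subgroup.zpow_mem _ h2 i

theorem map_eq_self_of_iterate_prime_pow {z : G} (hz : z ∈ Q)
    (hzQ : ∀ x ∈ Q, x ^ p = 1 → x ∈ Subgroup.zpowers z) (hzp : orderOf z = p)
    {σ : G ≃* G} {m : ℕ} (hσm : (⇑σ)^[p ^ m] = id) (hσQ : ∀ g, σ g ∈ Q ↔ g ∈ Q) : σ z = z := by
  have hzpow : ∀ x ∈ Subgroup.zpowers z, x ∈ Q ∧ x ^ p = 1 := by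
    rintro _ ⟨i, rfl⟩
    refine ⟨Q.zpow_mem hz i, ?_⟩
    simp only
    rw [← zpow_natCast, ← zpow_mul, mul_comm, zpow_mul, zpow_natCast, ← hzp, pow_orderOf_eq_one,
      one_zpow]
  have hz1 : z ≠ 1 := fun h => by
    rw [h, orderOf_one] at hzp
    exact hp.out.one_lt.ne hzp
  refine apply_eq_of_iterate_prime_pow (S := (Subgroup.zpowers z : Set G) \ {1}) hp.out hσm
    (Set.toFinite _) (fun x hx => ⟨hzQ _ ((hσQ x).2 (hzpow x hx.1).1) ?_, ?_⟩) ?_ z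
    ⟨Subgroup.mem_zpowers z, hz1⟩
  · rw [← map_pow, (hzpow x hx.1).2, map_one]
  · simpa using hx.2
  · have h1 : (Subgroup.zpowers z : Set G).ncard = p := by
      rw [← hzp, ← Nat.card_zpowers]; rfl
    rw [Set.ncard_sdiff_singleton_of_mem (Subgroup.one_mem _), h1]
    exact Nat.sub_lt hp.out.pos one_pos

end CyclicSubgroup

section TwistStable

set_option linter.unusedSectionVars false

attribute [local instance] Fintype.ofFinite

open Representation

theorem IsBlockIdem.exists_coeff_ne_zero {k G : Type} [Field k] [Group G] [Finite G]
    {b : MonoidAlgebra k G} (hb : IsBlockIdem (MonoidAlgebra k G) b) {Q : Subgroup G}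
    (hQ : InTr (conjRep k G) Q b) :
    ∃ g, b.coeff g ≠ 0 ∧ InTr (conjRep k G) (Q ⊓ Subgroup.centralizer {g}) b := by
  let _ : MulAction Q G := MulAction.compHom G ((MulAut.conj : G →* MulAut G).comp Q.subtype)
  have hsm : ∀ (q : Q) (x : G), q • x = q * x * (q : G)⁻¹ := fun q x => rfl
  have hcb := central_iff.1 hb.2.1.2
  have hsum : ∑ x, MonoidAlgebra.single x (b.coeff x) = b := by
    ext g
    simp
  obtain ⟨x, hx, h⟩ := hb.exists_stabilizer hQ
    (fun x => MonoidAlgebra.single x (b.coeff x)) (fun q x => by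
      have h1 : b.coeff (q * x * (q : G)⁻¹) = b.coeff x := by
        have := conjRep_coeff (q : G)⁻¹ b x
        rw [hcb, inv_inv] at this
        exact this.symm
      simp only [hsm, h1]
      rw [conjRep_apply]
      simp [mul_assoc]) hsum
  refine ⟨x, fun h0 => hx (by simp [h0]), ?_⟩
  convert h using 1
  ext g
  simp only [Subgroup.mem_inf, Subgroup.mem_centralizer_singleton_iff, Subgroup.mem_map,
    MulAction.mem_stabilizer_iff, hsm, Subgroup.coe_subtype, mul_inv_eq_iff_eq_mul]
  constructor
  · rintro ⟨h1, h2⟩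
    exact ⟨⟨g, h1⟩, h2, rfl⟩
  · rintro ⟨q, h1, rfl⟩
    exact ⟨q.2, h1⟩

theorem repIso_twist_of_not_isProj {k G V : Type} [Field k] [IsAlgClosed k] [Group G] [Finite G] {p : ℕ}
    [hp : Fact p.Prime] [CharP k p] [AddCommGroup V] [Module k V] [FiniteDimensional k V]
    {Q : Subgroup G} [IsCyclic Q] (hQ : IsPGroup p Q) (ih : ∀ n < Nat.card Q, TwistStable k p n)
    {σ : G ≃* G} {m : ℕ} (hσm : (⇑σ)^[p ^ m] = id) (hσQ : ∀ g, σ g ∈ Q ↔ g ∈ Q)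
    {b : MonoidAlgebra k G} (hb : IsBlockIdem (MonoidAlgebra k G) b)
    (hbσ : MonoidAlgebra.mapDomainRingHom k (σ : G →* G) b = b) (hbQ : InTr (conjRep k G) Q b)
    {ρ : Representation k G V} (hρ : Indec ρ) (hnp : ¬ IsProj ρ) (hρb : ρ.asAlgebraHom b = 1) :
    RepIso (twist ρ σ) ρ := by
  have hbot : ¬ InTr (conjRep k G) ⊥ b := fun h => hnp <| by
    have := h.asAlgebraHom ρ
    rw [hρb] at this
    exact this.isProj
  have hQne : Q ≠ ⊥ := by
    rintro rfl
    exact hbot hbQ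
  obtain ⟨z, hzQ, hzo, hzall, hpow⟩ := exists_orderOf_eq_prime hQ hQne
  have hz1 : z ≠ 1 := fun h => by
    rw [h, orderOf_one] at hzo
    exact hp.out.one_lt.ne hzo
  have hzp : z ^ p = 1 := by rw [← hzo, pow_orderOf_eq_one]
  have hσz := map_eq_self_of_iterate_prime_pow hzQ hzall hzo hσm hσQ
  set Z := Subgroup.zpowers z with hZdef
  have hZ : Nat.card Z = p := by rw [Nat.card_zpowers, hzo]
  set C := Subgroup.centralizer (Z : Set G) with hCdef
  set N := Subgroup.normalizer (Z : Set G) with hNdef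
  have hC : ∀ g, g ∈ C ↔ ∀ q ∈ Z, q * g = g * q := fun g => Subgroup.mem_centralizer_iff
  have hC' : ∀ g, g ∈ C ↔ z * g = g * z := fun g => by
    rw [hC]
    refine ⟨fun h => h z (Subgroup.mem_zpowers z), ?_⟩
    rintro h _ ⟨i, rfl⟩
    exact (Commute.zpow_left h i)
  have hZQ : Z ≤ Q := by simpa [hZdef] using hzQ
  have hQC : Q ≤ C := fun q hq => (hC' q).2 (mul_comm_of_isCyclic z hzQ q hq)
  have hCN : C ≤ N := Subgroup.centralizer_le_normalizer _
  have hNC : ∀ n ∈ N, ∀ g, n * g * n⁻¹ ∈ C ↔ g ∈ C := fun n hn g =>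
    mul_mul_inv_mem_centralizer_iff hn g
  have hfree : ∀ g, g ∉ N → ∀ q ∈ Q, g⁻¹ * q * g ∈ Q → q = 1 := fun g hg q hq h =>
    eq_one_of_inv_mul_mul_mem hzall hzo hpow hg hq h
  have hidx : C.relIndex N < p := relIndex_centralizer_lt hZ
  have hσC : ∀ g, σ g ∈ C ↔ g ∈ C := fun g => by
    rw [hC', hC']
    nth_rewrite 1 2 [← hσz]
    rw [← map_mul, ← map_mul, σ.injective.eq_iff]
  have hσZ : ∀ g, σ g ∈ Z ↔ g ∈ Z := fun g => by
    have hpw : ∀ i : ℤ, σ (z ^ i) = z ^ i := fun i => by rw [map_zpow, hσz]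
    constructor
    · rintro ⟨i, hi⟩
      exact ⟨i, σ.injective ((hpw i).trans hi)⟩
    · rintro ⟨i, rfl⟩
      exact ⟨i, (hpw i).symm⟩
  have hσN : ∀ g, σ g ∈ N ↔ g ∈ N := fun g => by
    simp only [hNdef, Subgroup.mem_normalizer_iff]
    constructor
    · intro h x
      rw [← hσZ, ← hσZ (g * x * g⁻¹), h (σ x)]
      simp
    · intro h x
      obtain ⟨x, rfl⟩ := σ.surjective x
      rw [hσZ, h x, ← hσZ (g * x * g⁻¹)]
      simp
  have hne : trunc C b ≠ 0 := fun h0 => by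
    obtain ⟨x, hx, hxQ⟩ := hb.exists_coeff_ne_zero hbQ
    have hxC : x ∉ C := fun h => hx <| by
      have := trunc_coeff (C := C) b x
      rw [h0, if_pos h] at this
      exact this.symm
    refine hbot ?_
    convert hxQ
    refine (Subgroup.eq_bot_iff_forall _ |>.2 fun q hq => ?_).symm
    rw [Subgroup.mem_inf, Subgroup.mem_centralizer_singleton_iff] at hq
    by_contra hq1
    obtain ⟨j, hj⟩ := hpow q hq.1 hq1
    have h1 : q ^ j ∈ Z := hzall _ (Q.pow_mem hq.1 j) (by rw [← hj, pow_orderOf_eq_one])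
    have hgen : Subgroup.zpowers (q ^ j) = Z :=
      Subgroup.eq_of_le_of_card_ge (by simpa using h1) (by rw [hZ, Nat.card_zpowers, hj])
    have h2 : z ∈ Subgroup.zpowers (q ^ j) := hgen ▸ Subgroup.mem_zpowers z
    obtain ⟨i, hi⟩ := h2
    refine hxC ((hC' x).2 ?_)
    rw [← hi]
    have hc : Commute q x := hq.2
    exact (hc.pow_left j).zpow_left i
  obtain ⟨c, hc, hcQ, hcσ, η, hη, hbη⟩ := exists_correspondent hZ hC hZQ hQC hCN hNC hfree hidx
    hσm hσC hσN hb hbσ hbQ hne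
  refine repIso_twist_of_correspondent hp.out hρ hnp hQC hCN hNC hfree hidx hσm hσC hρb hc hcQ hη
    hbη fun W _ _ _ τ hτ hτc => ?_
  let e : Q.subgroupOf C ≃* Q := Subgroup.subgroupOfEquivOfLe hQC
  have : IsCyclic (Q.subgroupOf C) := isCyclic_of_surjective e.symm e.symm.surjective
  refine repIso_twist_of_central_mem (Q := Q.subgroupOf C) (z := ⟨z, hQC hzQ⟩) (hQ.of_equiv e.symm)
    (fun n hn => ih n (hn.trans_eq (Nat.card_congr e.toEquiv))) (Subgroup.mem_subgroupOf.2 hzQ)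
    (fun g => Subtype.ext ((hC' g).1 g.2)) (fun h => hz1 (congrArg Subtype.val h))
    (Subtype.ext hzp) (m := m) ?_ (Subtype.ext hσz) (fun g => ?_) hc hcσ hcQ hτ hτc
  · funext x
    have : ∀ (j : ℕ) (x : C), ((⇑(restrict σ C hσC))^[j] x : G) = (⇑σ)^[j] x := fun j => by
      induction j with
      | zero => exact fun _ => rfl
      | succ j ih => exact fun x => ih _
    exact Subtype.ext ((this _ x).trans (congrFun hσm x))
  · rw [Subgroup.mem_subgroupOf, Subgroup.mem_subgroupOf]
    exact hσQ g

theorem twistStable (k : Type) [Field k] [IsAlgClosed k] (p : ℕ) [Fact p.Prime] [CharP k p]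
    (n : ℕ) : TwistStable k p n := by
  induction n using Nat.strong_induction_on with
  | _ n ih =>
    rintro G _ _ Q _ rfl hQ σ m hσm hσQ b hb hbσ hbQ V _ _ _ ρ hρb
    refine repIso_twist_of_indec (fun V _ _ _ ρ hρb hρ => ?_) V ρ hρb
    by_cases hproj : IsProj ρ
    · refine repIso_twist_of_isProj hb hbσ hρ hproj hρb fun S hS hirr hnp =>
        repIso_twist_of_not_isProj hQ ih hσm hσQ hb hbσ hbQ hirr.indec hnp ?_
      refine LinearMap.ext fun s => Subtype.ext ?_
      rw [subRep_asAlgebraHom, hρb]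
      rfl
    · exact repIso_twist_of_not_isProj hQ ih hσm hσQ hb hbσ hbQ hρ hproj hρb

end TwistStable

section FixedPoint

set_option linter.unusedSectionVars false

attribute [local instance] Fintype.ofFinite

open scoped Classical

theorem sum_eq_zero_of_isPGroup {k Q X : Type*} [Field k] {p : ℕ} [Fact p.Prime] [CharP k p]
    [Group Q] [Finite Q] (hQ : IsPGroup p Q) [MulAction Q X] [Finite X] {F : X → k}
    (hF : ∀ (q : Q) x, F (q • x) = F x) (h0 : ∀ x, (∀ q : Q, q • x = x) → F x = 0) :
    ∑ x, F x = 0 := by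
  rw [sum_eq_sum_orbits (A := k) (1 : Q →* AddMonoid.End k) F hF]
  refine Finset.sum_eq_zero fun ω _ => ?_
  rw [cosetSum_univ]
  simp only [MonoidHom.one_apply, AddMonoid.End.one_apply, Finset.sum_const, Finset.card_univ,
    nsmul_eq_mul]
  by_cases ht : MulAction.stabilizer Q ω.out = ⊤
  · rw [h0 ω.out fun q => MulAction.mem_stabilizer_iff.1 (ht ▸ Subgroup.mem_top q), mul_zero]
  · obtain ⟨n, hn⟩ := hQ.index (MulAction.stabilizer Q ω.out)
    have hn0 : n ≠ 0 := by
      rintro rfl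
      exact ht (Subgroup.index_eq_one.1 (by simpa using hn))
    rw [@Fintype.card_eq_nat_card _ (_), ← Subgroup.index, hn, Nat.cast_pow, CharP.cast_eq_zero, zero_pow hn0, zero_mul]

variable {k G : Type} [Field k] [Group G] [Finite G] {p : ℕ} [Fact p.Prime] [CharP k p]

theorem coeff_mul_eq_sum (a b : MonoidAlgebra k G) (g : G) :
    (a * b).coeff g = ∑ h, a.coeff h * b.coeff (h⁻¹ * g) := by
  have h1 : a = ∑ h, MonoidAlgebra.single h (a.coeff h) := by
    ext g
    simp
  conv_lhs => rw [h1]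
  rw [Finset.sum_mul, MonoidAlgebra.coeff_sum, Finset.sum_apply']
  simp only [MonoidAlgebra.coeff_single_mul_apply]

theorem coeff_conj {b : MonoidAlgebra k G} (hb : ∀ a, a * b = b * a) (q g : G) :
    b.coeff (q * g * q⁻¹) = b.coeff g := by
  have := conjRep_coeff q⁻¹ b g
  rw [central_iff.1 hb, inv_inv] at this
  exact this.symm

theorem conj_smul {Q : Subgroup G} (q : ConjAct Q) (x : Q) :
    ((q • x : Q) : G) = (ConjAct.ofConjAct q : Q) * x * ((ConjAct.ofConjAct q : Q) : G)⁻¹ := rfl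

/-- The truncation to the centralizer of a `p`-subgroup is multiplicative on central elements. -/
theorem trunc_centralizer_mul {Q : Subgroup G} (hQ : IsPGroup p Q) {a b : MonoidAlgebra k G}
    (ha : ∀ x, x * a = a * x) (hb : ∀ x, x * b = b * x) :
    trunc (Subgroup.centralizer (Q : Set G)) (a * b) =
      trunc (Subgroup.centralizer (Q : Set G)) a * trunc (Subgroup.centralizer (Q : Set G)) b := by
  set C := Subgroup.centralizer (Q : Set G) with hCdef
  have hC : ∀ g, g ∈ C ↔ ∀ q ∈ Q, q * g = g * q := fun g => Subgroup.mem_centralizer_iff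
  have hconj : ∀ q ∈ Q, ∀ g, q * g * q⁻¹ ∈ C ↔ g ∈ C := fun q hq g =>
    mul_mul_inv_mem_centralizer_iff (Subgroup.le_normalizer hq) g
  have hta : ∀ q ∈ Q, ∀ g, (trunc C a).coeff (q * g * q⁻¹) = (trunc C a).coeff g := fun q hq g => by
    simp only [trunc_coeff, hconj q hq, coeff_conj ha]
  have htb : ∀ q ∈ Q, ∀ g, (trunc C b).coeff (q * g * q⁻¹) = (trunc C b).coeff g := fun q hq g => by
    simp only [trunc_coeff, hconj q hq, coeff_conj hb]
  ext g
  by_cases hg : g ∈ C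
  · rw [trunc_coeff, if_pos hg, coeff_mul_eq_sum, coeff_mul_eq_sum, ← sub_eq_zero,
      ← Finset.sum_sub_distrib]
    let _ : MulAction Q G := MulAction.compHom G ((MulAut.conj : G →* MulAut G).comp Q.subtype)
    have hsm : ∀ (q : Q) (x : G), q • x = q * x * (q : G)⁻¹ := fun q x => rfl
    refine sum_eq_zero_of_isPGroup hQ (fun q x => ?_) fun x hx => ?_
    · have h1 : ((q : G) * x * (q : G)⁻¹)⁻¹ * g = q * (x⁻¹ * g) * (q : G)⁻¹ := by
        have := (hC g).1 hg _ (Q.inv_mem q.2)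
        simp only [mul_inv_rev, inv_inv, mul_assoc]
        rw [this]
      rw [hsm, h1, coeff_conj ha, coeff_conj hb, hta q q.2, htb q q.2]
    · have hxC : x ∈ C := (hC x).2 fun q hq => by
        have := hx ⟨q, hq⟩
        rwa [hsm, mul_inv_eq_iff_eq_mul] at this
      rw [trunc_coeff, trunc_coeff, if_pos hxC, if_pos (C.mul_mem (C.inv_mem hxC) hg), sub_self]
  · rw [trunc_coeff, if_neg hg, coeff_mul_eq_sum]
    refine (Finset.sum_eq_zero fun h _ => ?_).symm
    rw [trunc_coeff, trunc_coeff]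
    split_ifs with h1 h2
    · exact absurd ((C.mul_mem_cancel_left (C.inv_mem h1)).1 h2) hg
    all_goals simp

/-- A commutative `p`-subgroup acting on a nonzero `f`-fixed part has a nonzero fixed vector. -/
theorem exists_fixed_of_commute {Q : Subgroup G} (hQ : IsPGroup p Q) {f : MonoidAlgebra k G}
    (hf : f ≠ 0) (hff : f * f = f) (T : Finset G) (hTQ : ∀ z ∈ T, z ∈ Q)
    (hTf : ∀ z ∈ T, Commute (MonoidAlgebra.of k G z) f) (hTT : ∀ z ∈ T, ∀ w ∈ T, z * w = w * z) :
    ∃ v, v ≠ 0 ∧ f * v = v ∧ ∀ z ∈ T, MonoidAlgebra.of k G z * v = v := by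
  induction T using Finset.induction_on with
  | empty => exact ⟨f, hf, hff, by simp⟩
  | insert z T hzT ih =>
    obtain ⟨v, hv, hfv, hTv⟩ := ih (fun w hw => hTQ w (Finset.mem_insert_of_mem hw))
      (fun w hw => hTf w (Finset.mem_insert_of_mem hw))
      (fun w hw u hu => hTT w (Finset.mem_insert_of_mem hw) u (Finset.mem_insert_of_mem hu))
    have hz := Finset.mem_insert_self z T
    set n := MonoidAlgebra.of k G z - 1 with hn
    have hnil : ∃ e, n ^ e * v = 0 := by
      obtain ⟨e, he⟩ := hQ ⟨z, hTQ z hz⟩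
      have he' : z ^ p ^ e = 1 := congrArg Subtype.val he
      have : CharP (MonoidAlgebra k G) p := charP_of_injective_algebraMap' k p
      refine ⟨p ^ e, ?_⟩
      rw [hn, sub_pow_char_pow_of_commute _ _ (Commute.one_right _), ← map_pow, he', map_one,
        one_pow, sub_self, zero_mul]
    have hpos : 0 < Nat.find hnil := by
      rw [Nat.find_pos]
      simpa using hv
    obtain ⟨e, he⟩ := Nat.exists_eq_succ_of_ne_zero hpos.ne'
    have hfn : Commute n f := (hTf z hz).sub_left (Commute.one_left f)
    refine ⟨n ^ e * v, Nat.find_min hnil (by omega), ?_, fun w hw => ?_⟩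
    · rw [← mul_assoc, ← (hfn.pow_left e).eq, mul_assoc, hfv]
    · rcases Finset.mem_insert.1 hw with rfl | hwT
      · have h1 := Nat.find_spec hnil
        rw [he, pow_succ', mul_assoc, hn, sub_mul, one_mul, sub_eq_zero] at h1
        exact h1
      · have h1 : Commute n (MonoidAlgebra.of k G w) :=
          Commute.sub_left (by
            rw [commute_iff_eq, ← map_mul, ← map_mul, hTT z hz w hw]) (Commute.one_left _)
        rw [← mul_assoc, ← (h1.pow_left e).eq, mul_assoc, hTv w hwT]

theorem exists_fixed_point_of_sum_eq {b : MonoidAlgebra k G}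
    (hb : IsBlockIdem (MonoidAlgebra k G) b) {Q : Subgroup G} (hQp : IsPGroup p Q)
    (hQ : InTr (conjRep k G) Q b) (hmin : ∀ R ≤ Q, InTr (conjRep k G) R b → R = Q)
    {X : Type} [MulAction G X] [Finite X] {ψ : X → MonoidAlgebra k G}
    (hψ : ∀ q ∈ Q, ∀ c, ψ (q • c) = MonoidAlgebra.of k G q * ψ c)
    (hψQ : ∀ q ∈ Q, ∀ c, ψ c * MonoidAlgebra.of k G q = ψ c)
    (hsum : ∑ c, ψ c = b * ∑ q : Q, MonoidAlgebra.of k G q) : ∃ c : X, ∀ q ∈ Q, q • c = c := by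
  by_contra! hno
  set C := Subgroup.centralizer (Q : Set G) with hCdef
  have hC : ∀ g, g ∈ C ↔ ∀ q ∈ Q, q * g = g * q := fun g => Subgroup.mem_centralizer_iff
  set f := trunc C b with hfdef
  have hbc := hb.2.1.2
  have hf0 : f ≠ 0 := by
    obtain ⟨g, hg, hgQ⟩ := hb.exists_coeff_ne_zero hQ
    have h1 := hmin _ inf_le_left hgQ
    have hgC : g ∈ C := (hC g).2 fun q hq => by
      rw [← h1] at hq
      exact Subgroup.mem_centralizer_singleton_iff.1 hq.2
    intro h0
    have := trunc_coeff (C := C) b g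
    rw [← hfdef, h0, if_pos hgC] at this
    exact hg this.symm
  have hff : f * f = f := by
    rw [hfdef, ← trunc_centralizer_mul hQp hbc hbc, hb.2.1.1]
  have h1 : ∀ g ∈ C, ∑ q : Q, b.coeff (g * (q : G)⁻¹) = 0 := fun g hg => by
    have h2 : (∑ c, ψ c).coeff g = 0 := by
      rw [MonoidAlgebra.coeff_sum, Finset.sum_apply']
      refine sum_eq_zero_of_isPGroup hQp (fun q c => ?_) fun c hc => ?_
      · change (ψ ((q : G) • c)).coeff g = _
        rw [hψ q q.2, ← hψQ _ (Q.inv_mem q.2) c, ← mul_assoc, ← conjRep_apply, conjRep_coeff,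
          hψQ _ (Q.inv_mem q.2) c, mul_assoc, ← (hC g).1 hg q q.2, inv_mul_cancel_left]
      · obtain ⟨q, hq, hqc⟩ := hno c
        exact absurd (hc ⟨q, hq⟩) hqc
    rw [hsum, Finset.mul_sum, MonoidAlgebra.coeff_sum, Finset.sum_apply'] at h2
    rw [← h2]
    refine Finset.sum_congr rfl fun q _ => ?_
    simp [MonoidAlgebra.coeff_mul_single_apply]
  have h2 : ∀ g ∈ C, ∑ q : Q, f.coeff (g * (q : G)⁻¹) = 0 := fun g hg => by
    rw [← h1 g hg, ← sub_eq_zero, ← Finset.sum_sub_distrib]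
    have : Finite (ConjAct Q) := inferInstanceAs (Finite Q)
    have hQ' : IsPGroup p (ConjAct Q) := hQp
    convert sum_eq_zero_of_isPGroup (k := k) (X := Q) hQ'
      (F := fun x => f.coeff (g * (x : G)⁻¹) - b.coeff (g * (x : G)⁻¹)) (fun q x => ?_)
      fun x hx => ?_
    · have h3 : g * ((q • x : Q) : G)⁻¹ = (ConjAct.ofConjAct q : Q) * (g * (x : G)⁻¹) *
          ((ConjAct.ofConjAct q : Q) : G)⁻¹ := by
        rw [conj_smul, ← mul_assoc, (hC g).1 hg _ (ConjAct.ofConjAct q).2]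
        simp [mul_assoc]
      rw [h3, coeff_conj hbc, hfdef, trunc_coeff, trunc_coeff, coeff_conj hbc]
      simp only [hCdef, mul_mul_inv_mem_centralizer_iff
        (Subgroup.le_normalizer (ConjAct.ofConjAct q).2)]
    · have hxC : (x : G) ∈ C := (hC x).2 fun q hq => by
        have := congrArg Subtype.val (hx (ConjAct.toConjAct ⟨q, hq⟩))
        rw [conj_smul, mul_inv_eq_iff_eq_mul] at this
        exact this
      rw [hfdef, trunc_coeff, if_pos (C.mul_mem hg (C.inv_mem hxC)), sub_self]
  set Z := Q ⊓ C with hZdef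
  have h3 : ∀ g, ∑ z : Z, f.coeff (g * z) = 0 := fun g => by
    by_cases hg : g ∈ C
    · rw [← h2 g hg]
      refine Finset.sum_of_injOn (fun z : Z => (⟨(z : G)⁻¹, Q.inv_mem z.2.1⟩ : Q))
        (fun z _ w _ h => Subtype.ext (inv_injective (congrArg Subtype.val h))) (by simp)
        (fun q _ hq => ?_) (by simp)
      have hqC : (q : G) ∉ C := fun h => hq
        ⟨⟨(q : G)⁻¹, Q.inv_mem q.2, C.inv_mem h⟩, by simp, Subtype.ext (inv_inv _)⟩
      rw [hfdef, trunc_coeff, if_neg (fun h => hqC ?_)]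
      exact C.inv_mem_iff.1 ((C.mul_mem_cancel_left hg).1 h)
    · refine Finset.sum_eq_zero fun z _ => ?_
      rw [hfdef, trunc_coeff, if_neg (fun h => hg ((C.mul_mem_cancel_right z.2.2).1 h))]
  have hTf : ∀ z ∈ Finset.univ.filter (· ∈ Z), Commute (MonoidAlgebra.of k G z) f := fun z hz => by
    simp only [Finset.mem_filter, Finset.mem_univ, true_and] at hz
    refine conjRep_eq_self_iff.1 ?_
    ext g
    have hzn := Subgroup.le_normalizer (Q.inv_mem hz.1)
    have := mul_mul_inv_mem_centralizer_iff hzn g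
    have h7 := coeff_conj hbc z⁻¹ g
    rw [inv_inv] at this h7
    rw [conjRep_coeff, hfdef, trunc_coeff, trunc_coeff, h7]
    simp only [hCdef, this]
  have hTT : ∀ z ∈ Finset.univ.filter (· ∈ Z), ∀ w ∈ Finset.univ.filter (· ∈ Z),
      z * w = w * z := fun z hz w hw => by
    simp only [Finset.mem_filter, Finset.mem_univ, true_and] at hz hw
    exact (hC w).1 hw.2 z hz.1
  obtain ⟨v, hv, hfv, hZv⟩ := exists_fixed_of_commute hQp hf0 hff
    (Finset.univ.filter (· ∈ Z)) (by simp +contextual [hZdef]) hTf hTT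
  refine hv ?_
  rw [← hfv]
  have h4 : f = ∑ g, f.coeff g • MonoidAlgebra.of k G g := by
    ext g
    simp
  have h5 : Function.Bijective fun y : (G ⧸ Z) × Z => (y.1.out : G) * (y.2 : G) := by
    constructor
    · rintro ⟨c, z⟩ ⟨d, w⟩ h
      have hcd : c = d := by
        have := congrArg (QuotientGroup.mk (s := Z)) h
        simpa using this
      subst hcd
      simpa using h
    · intro g
      refine ⟨⟨g, ⟨((g : G ⧸ Z).out)⁻¹ * g, QuotientGroup.eq.1 (QuotientGroup.out_eq' _)⟩⟩, ?_⟩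
      simp
  have h6 : ∀ z : Z, MonoidAlgebra.of k G (z : G) * v = v := fun z => hZv z (by simp)
  rw [h4, Finset.sum_mul, ← h5.sum_comp, Fintype.sum_prod_type]
  refine Finset.sum_eq_zero fun c _ => ?_
  simp only [map_mul, smul_mul_assoc, mul_assoc, h6]
  rw [← Finset.sum_smul, h3, zero_smul]

end FixedPoint

section RelativeProjectivity

set_option linter.unusedSectionVars false

attribute [local instance] Fintype.ofFinite

open scoped Classical

variable {k : Type} [Field k] {A : Type} [Group A] [Finite A]

/-- The diagonal action on functions from a `G`-set to a module. -/
noncomputable def funRep (X : BModule k (MonoidAlgebra k A)) (C : Type) [MulAction A C] :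
    Representation k A (C → X) where
  toFun g :=
    { toFun := fun ψ c => MonoidAlgebra.of k A g • ψ (g⁻¹ • c)
      map_add' := fun ψ φ => funext fun c => smul_add _ _ _
      map_smul' := fun r ψ => funext fun c => smul_algebra_smul_comm r (MonoidAlgebra.of k A g) (ψ (g⁻¹ • c)) }
  map_one' := LinearMap.ext fun ψ => funext fun c => by
    change MonoidAlgebra.of k A 1 • ψ ((1 : A)⁻¹ • c) = ψ c
    rw [map_one, one_smul, inv_one, one_smul]
  map_mul' g h := LinearMap.ext fun ψ => funext fun c => by
    change MonoidAlgebra.of k A (g * h) • ψ ((g * h)⁻¹ • c) =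
      MonoidAlgebra.of k A g • MonoidAlgebra.of k A h • ψ (h⁻¹ • g⁻¹ • c)
    rw [map_mul, mul_smul, mul_inv_rev, mul_smul]

theorem funRep_apply (X : BModule k (MonoidAlgebra k A)) (C : Type) [MulAction A C] (g : A)
    (ψ : C → X) (c : C) : funRep X C g ψ c = MonoidAlgebra.of k A g • ψ (g⁻¹ • c) := rfl

/-- Higman's criterion: a relatively `D`-projective module is a direct summand of the functions
on the cosets of `D`. -/
theorem RelProj.exists_coset_section {D : Subgroup A} (X : BModule k (MonoidAlgebra k A))
    (hX : RelProj k A D X) : ∃ θ : X → (A ⧸ D) → X,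
      (∀ g u c, θ (MonoidAlgebra.of k A g • u) (g • c) = MonoidAlgebra.of k A g • θ u c) ∧
      ∀ u, ∑ c, θ u c = u := by
  set ρ := funRep X (A ⧸ D) with hρ
  let s : ρ.asModule →ₗ[k] X :=
    (∑ c, LinearMap.proj (R := k) (φ := fun _ : A ⧸ D => (X : Type)) c) ∘ₗ
      ρ.asModuleEquiv.toLinearMap
  have hs : ∀ m, s m = ∑ c, ρ.asModuleEquiv m c := fun m => by simp [s]
  have hof : ∀ g m, ρ.asModuleEquiv (MonoidAlgebra.of k A g • m) = ρ g (ρ.asModuleEquiv m) :=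
    fun g m => by rw [Representation.asModuleEquiv_map_smul, Representation.asAlgebraHom_of]
  have hcomm : ∀ (g : A) (m : ρ.asModule),
      s (MonoidAlgebra.single g (1 : k) • m) = MonoidAlgebra.single g (1 : k) • s m := fun g m => by
    rw [← MonoidAlgebra.of_apply, hs, hs, hof, Finset.smul_sum]
    exact Fintype.sum_equiv (MulAction.toPerm g⁻¹) _ _ fun c => rfl
  let f := MonoidAlgebra.equivariantOfLinearOfComm s hcomm
  have hf : ∀ m, f m = ∑ c, ρ.asModuleEquiv m c := hs
  let h : X →+ ρ.asModule := (ρ.asModuleEquiv.symm.toLinearMap ∘ₗ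
    LinearMap.single k (fun _ : A ⧸ D => (X : Type)) ((1 : A) : A ⧸ D)).toAddMonoidHom
  have hh : ∀ u, ρ.asModuleEquiv (h u) = Pi.single ((1 : A) : A ⧸ D) u := fun u => rfl
  have hfh : ∀ u, f (h u) = u := fun u => by
    rw [hf, hh]
    exact Fintype.sum_pi_single' _ _
  obtain ⟨h', hh'⟩ := hX ⟨ρ.asModule⟩ X f LinearMap.id (fun u => ⟨h u, hfh u⟩)
    ⟨h, fun c u => by
      rw [algebraMap_smul, algebraMap_smul]
      exact LinearMap.map_smul (ρ.asModuleEquiv.symm.toLinearMap ∘ₗ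
        LinearMap.single k (fun _ : A ⧸ D => (X : Type)) ((1 : A) : A ⧸ D)) c u, fun d u => by
      apply ρ.asModuleEquiv.injective
      rw [hof, hh, hh]
      funext c
      rw [funRep_apply]
      by_cases hc : c = ((1 : A) : A ⧸ D)
      · have : ((d : A)⁻¹ • c) = ((1 : A) : A ⧸ D) := by
          rw [hc, MulAction.Quotient.smul_coe, QuotientGroup.eq]
          simp
        rw [this, hc, Pi.single_eq_same, Pi.single_eq_same]
      · have : ((d : A)⁻¹ • c) ≠ ((1 : A) : A ⧸ D) := by
          rw [Ne, inv_smul_eq_iff]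
          intro h
          refine hc (h.trans ?_)
          rw [MulAction.Quotient.smul_coe, QuotientGroup.eq]
          simp
        rw [Pi.single_eq_of_ne hc, Pi.single_eq_of_ne this, smul_zero], hfh⟩
  refine ⟨fun u => ρ.asModuleEquiv (h' u), fun g u c => ?_, fun u => (hf _).symm.trans (hh' u)⟩
  beta_reduce
  rw [map_smul, hof, funRep_apply, inv_smul_smul]

/-- The left ideal of the elements of the block fixed by right multiplication with `Q`. -/
def fixedIdeal (b : MonoidAlgebra k A) (hb : ∀ a, a * b = b * a) (Q : Subgroup A) :
    Submodule (MonoidAlgebra k A) (MonoidAlgebra k A) where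
  carrier := {a | b * a = a ∧ ∀ q ∈ Q, a * MonoidAlgebra.of k A q = a}
  zero_mem' := ⟨mul_zero _, fun _ _ => zero_mul _⟩
  add_mem' hx hy := ⟨by rw [mul_add, hx.1, hy.1], fun q hq => by
    rw [add_mul, hx.2 q hq, hy.2 q hq]⟩
  smul_mem' c x hx := ⟨by rw [smul_eq_mul, ← mul_assoc, ← hb, mul_assoc, hx.1], fun q hq => by
    rw [smul_eq_mul, mul_assoc, hx.2 q hq]⟩

/-- A minimal subgroup from which `b` is a trace is cyclic when the defect group is. -/
theorem isCyclic_of_isDefectGroup {p : ℕ} [Fact p.Prime] [CharP k p] {b : MonoidAlgebra k A}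
    (hb : IsBlockIdem (MonoidAlgebra k A) b) {D : Subgroup A} (hD : IsDefectGroup k A b D)
    (hcyc : IsCyclic D) {Q : Subgroup A} (hQp : IsPGroup p Q) (hQ : InTr (conjRep k A) Q b)
    (hmin : ∀ R ≤ Q, InTr (conjRep k A) R b → R = Q) : IsCyclic Q := by
  have hbc := hb.2.1.2
  set X : BModule k (MonoidAlgebra k A) := ⟨fixedIdeal b hbc Q⟩ with hX
  have hXl : LiesIn (MonoidAlgebra k A) b X := fun u : fixedIdeal b hbc Q => Subtype.ext u.2.1
  obtain ⟨θ, hθ, hθs⟩ := RelProj.exists_coset_section X (hD.1 X hXl)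
  have hleft : ∀ q ∈ Q, MonoidAlgebra.of k A q * ∑ r : Q, MonoidAlgebra.of k A r =
      ∑ r : Q, MonoidAlgebra.of k A r := fun q hq => by
    rw [Finset.mul_sum]
    refine Fintype.sum_equiv (Equiv.mulLeft (⟨q, hq⟩ : Q)) _ _ fun r => ?_
    simp
  have hright : ∀ q ∈ Q, (∑ r : Q, MonoidAlgebra.of k A r) * MonoidAlgebra.of k A q =
      ∑ r : Q, MonoidAlgebra.of k A r := fun q hq => by
    rw [Finset.sum_mul]
    refine Fintype.sum_equiv (Equiv.mulRight (⟨q, hq⟩ : Q)) _ _ fun r => ?_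
    simp
  let u : fixedIdeal b hbc Q := ⟨b * ∑ q : Q, MonoidAlgebra.of k A q, by
    rw [← mul_assoc, hb.2.1.1], fun q hq => by rw [mul_assoc, hright q hq]⟩
  have hu : ∀ q ∈ Q, MonoidAlgebra.of k A q • u = u := fun q hq => Subtype.ext <| by
    change MonoidAlgebra.of k A q * (b * _) = b * _
    rw [← mul_assoc, hbc, mul_assoc, hleft q hq]
  let ι : X →+ MonoidAlgebra k A := (fixedIdeal b hbc Q).subtype.toAddMonoidHom
  obtain ⟨c, hc⟩ := exists_fixed_point_of_sum_eq hb hQp hQ hmin (X := A ⧸ D)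
    (ψ := fun c => ι (θ u c))
    (fun q hq c => by
      have := hθ q u c
      rw [show MonoidAlgebra.of k A q • (u : X) = u from hu q hq] at this
      rw [this]
      rfl)
    (fun q hq c => (θ u c : fixedIdeal b hbc Q).2.2 q hq)
    (by
      rw [← map_sum]
      refine Eq.trans ?_ (congrArg ι (hθs u))
      congr!)
  obtain ⟨g, rfl⟩ := QuotientGroup.mk_surjective c
  have hg : ∀ q ∈ Q, g⁻¹ * q * g ∈ D := fun q hq => by
    have := hc q hq
    rw [MulAction.Quotient.smul_coe, eq_comm, QuotientGroup.eq] at this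
    simpa [mul_assoc] using this
  let φ : Q →* D := ((MulAut.conj g⁻¹).toMonoidHom.comp Q.subtype).codRestrict D fun q => by
    simpa using hg q q.2
  refine isCyclic_of_injective φ fun x y h => Subtype.ext ?_
  have := congrArg Subtype.val h
  simpa [φ] using this

end RelativeProjectivity

section DefectSubgroup

set_option linter.unusedSectionVars false

attribute [local instance] Fintype.ofFinite

open scoped Classical

variable {k G : Type} [Field k] [Group G] [Finite G] {p : ℕ} [Fact p.Prime] [CharP k p]

theorem exists_minimal_inTr {b : MonoidAlgebra k G} (hb : ∀ a, a * b = b * a) :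
    ∃ Q : Subgroup G, InTr (conjRep k G) Q b ∧
      ∀ R ≤ Q, InTr (conjRep k G) R b → R = Q := by
  have hfix : IsFix (conjRep k G) ⊤ b := fun g _ => central_iff.1 hb g
  obtain ⟨Q, hQ⟩ := (Set.toFinite {Q : Subgroup G | InTr (conjRep k G) Q b}).exists_minimal
    ⟨⊤, b, hfix, relTr_top hfix⟩
  exact ⟨Q, hQ.1, fun R hR hRb => le_antisymm hR (hQ.2 hRb hR)⟩

theorem isPGroup_of_minimal_inTr {b : MonoidAlgebra k G} {Q : Subgroup G}
    (hQ : InTr (conjRep k G) Q b) (hmin : ∀ R ≤ Q, InTr (conjRep k G) R b → R = Q) :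
    IsPGroup p Q := by
  obtain ⟨a, ha, rfl⟩ := hQ
  obtain ⟨P⟩ : Nonempty (Sylow p Q) := inferInstance
  set R : Subgroup G := (P : Subgroup Q).map Q.subtype with hR
  have hRQ : R ≤ Q := Subgroup.map_subtype_le _
  have hRP : R.subgroupOf Q = P := by
    rw [hR, Subgroup.subgroupOf, Subgroup.comap_map_eq_self_of_injective Subtype.val_injective]
  have hm : ((P : Subgroup Q).index : k) ≠ 0 := fun h =>
    P.not_dvd_index ((CharP.cast_eq_zero_iff k p _).1 h)
  have hfix : IsFix (conjRep k G) R (((P : Subgroup Q).index : k)⁻¹ • a) := fun h hh => by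
    rw [map_smul, ha h (hRQ hh)]
  have htr : relTr ((conjRep k G).comp Q.subtype) (R.subgroupOf Q) a =
      ((P : Subgroup Q).index : k) • a := by
    rw [relTr_apply, cosetSum_univ, hRP]
    have : ∀ q : Q, (conjRep k G).comp Q.subtype q a = a := fun q => ha q q.2
    simp only [this, Finset.sum_const, Finset.card_univ]
    rw [@Fintype.card_eq_nat_card _ (_), ← Subgroup.index, Nat.cast_smul_eq_nsmul]
  have h1 : R = Q := hmin R hRQ ⟨_, hfix, by
    rw [← relTr_relTr hRQ hfix, map_smul, htr, inv_smul_smul₀ hm]⟩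
  have hRp : IsPGroup p R := P.2.map Q.subtype
  rwa [h1] at hRp

theorem InTr.map_mulEquiv {Q : Subgroup G} {b : MonoidAlgebra k G}
    (hQ : InTr (conjRep k G) Q b) (τ : G ≃* G) (hτ : mapH k (τ : G →* G) b = b) :
    InTr (conjRep k G) (Q.map (τ : G →* G)) b := by
  obtain ⟨a, ha, hab⟩ := hQ
  have hfix : IsFix (conjRep k G) (Q.map (τ : G →* G)) (mapH k (τ : G →* G) a) := by
    rintro _ ⟨q, hq, rfl⟩
    rw [← mapH_conjRep, ha q hq]
  refine ⟨_, hfix, ?_⟩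
  rw [← relTr_comp_equiv τ (H := Q) (fun g => by simp) hfix]
  have := map_relTr (R := conjRep k G) (R' := (conjRep k G).comp (τ : G →* G))
    (mapH k (τ : G →* G)).toLinearMap (fun g a => mapH_conjRep (τ : G →* G) g a) Q a
  rw [hab] at this
  exact this.symm.trans hτ

/-- Minimal subgroups from which a block idempotent is a trace are unique up to conjugation. -/
theorem IsBlockIdem.exists_conj_mem {b : MonoidAlgebra k G}
    (hb : IsBlockIdem (MonoidAlgebra k G) b) {Q Q' : Subgroup G}
    (hQ : InTr (conjRep k G) Q b) (hmin : ∀ R ≤ Q, InTr (conjRep k G) R b → R = Q)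
    (hQ' : InTr (conjRep k G) Q' b) : ∃ g : G, ∀ q ∈ Q, g⁻¹ * q * g ∈ Q' := by
  obtain ⟨a, ha, hab⟩ := hQ'
  obtain ⟨c, -, hc⟩ := hb.exists_stabilizer hQ (X := G ⧸ Q')
    (fun c => conjRep k G c.out a) (fun q c => by
      obtain ⟨h, hh, e⟩ := exists_out_eq_mul Q' ((q : G) * c.out)
      have : q • c = (((q : G) * c.out : G) : G ⧸ Q') := by
        conv_lhs => rw [← QuotientGroup.out_eq' c]
        rfl
      rw [this, e, ha.apply_mul _ h hh, map_mul, Module.End.mul_apply])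
    (by
      rw [← hab, relTr_apply, cosetSum_univ]
      congr!)
  have hle : (MulAction.stabilizer Q c).map Q.subtype ≤ Q := Subgroup.map_subtype_le _
  refine ⟨c.out, fun q hq => ?_⟩
  rw [← hmin _ hle hc] at hq
  obtain ⟨r, hr, rfl⟩ := hq
  have h1 : (r : G) • c = c := MulAction.mem_stabilizer_iff.1 hr
  rw [← QuotientGroup.out_eq' c, MulAction.Quotient.smul_mk, eq_comm] at h1
  have := QuotientGroup.eq.1 h1
  simpa [mul_assoc] using this

end DefectSubgroup

section Stability

set_option linter.unusedSectionVars false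

variable {k : Type} [Field k] {Gt : Type} [Group Gt] {G : Subgroup Gt} [G.Normal]
  {U : Type} [AddCommGroup U] [Module (MonoidAlgebra k G) U]

theorem conjHom_eq_conjNormal (x : Gt) :
    conjHom Gt G x = ((MulAut.conjNormal x⁻¹ : MulAut G) : G →* G) := by
  ext g
  simp [conjHom]

theorem IsStableAt.mul {x y : Gt} (hx : IsStableAt k Gt G x U) (hy : IsStableAt k Gt G y U) :
    IsStableAt k Gt G (x * y) U := by
  obtain ⟨φ, hφ⟩ := hx
  obtain ⟨ψ, hψ⟩ := hy
  have hc : conjHom Gt G (x * y) = (conjHom Gt G y).comp (conjHom Gt G x) := by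
    ext g
    simp [conjHom, mul_assoc]
  refine ⟨ψ.trans φ, fun a u => ?_⟩
  have h1 : MapAlong k (conjHom Gt G (x * y)) a =
      MapAlong k (conjHom Gt G y) (MapAlong k (conjHom Gt G x) a) := by
    rw [hc]
    exact mapH_comp _ _ a
  rw [AddEquiv.trans_apply, AddEquiv.trans_apply, h1, hψ, hφ]

theorem isStableAt_coe (g : G) : IsStableAt k Gt G (g : Gt) U := by
  have h1 : ∀ h : G, MonoidAlgebra.of k G h * MonoidAlgebra.of k G h⁻¹ = 1 := fun h => by
    rw [← map_mul, mul_inv_cancel, map_one]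
  refine ⟨{ toFun := fun u => MonoidAlgebra.of k G g • u
            invFun := fun u => MonoidAlgebra.of k G g⁻¹ • u
            left_inv := fun u => ?_
            right_inv := fun u => ?_
            map_add' := smul_add _ }, fun a u => ?_⟩
  · have := h1 g⁻¹
    rw [inv_inv] at this
    simp only [smul_smul, this, one_smul]
  · simp only [smul_smul, h1, one_smul]
  · change MonoidAlgebra.of k G g • _ • u = a • MonoidAlgebra.of k G g • u
    rw [smul_smul, smul_smul]
    congr 1
    induction a using MonoidAlgebra.induction_linear with
    | zero => simp
    | add f f' hf hf' => rw [map_add, mul_add, hf, hf', add_mul]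
    | single h r =>
      have : MapAlong k (conjHom Gt G g) (MonoidAlgebra.single h r) =
          MonoidAlgebra.single (g⁻¹ * h * g) r := by
        simp [MapAlong]
        rfl
      rw [this]
      simp [MonoidAlgebra.single_mul_single, mul_assoc]

theorem mapH_conjNormal_eq {b : MonoidAlgebra k G} {x : Gt}
    (hx : Commute (MonoidAlgebra.of k Gt x) (MapAlong k G.subtype b)) :
    mapH k ((MulAut.conjNormal x : MulAut G) : G →* G) b = b := by
  apply mapH_injective (φ := G.subtype) Subtype.val_injective
  have hc : G.subtype.comp ((MulAut.conjNormal x : MulAut G) : G →* G) =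
      (MulAut.conj x : Gt ≃* Gt).toMonoidHom.comp G.subtype := by
    ext g
    simp
  rw [← mapH_comp, hc, mapH_comp, ← conjRep_eq_mapH]
  exact conjRep_eq_self_iff.2 hx

/-- A module over the group algebra as a representation. -/
noncomputable def repOfModule (U : BModule k (MonoidAlgebra k G)) : Representation k G U :=
  ((Algebra.lsmul k k U : MonoidAlgebra k G →ₐ[k] Module.End k U) :
    MonoidAlgebra k G →* Module.End k U).comp (MonoidAlgebra.of k G)

theorem repOfModule_asAlgebraHom (U : BModule k (MonoidAlgebra k G)) (a : MonoidAlgebra k G)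
    (u : U) : (repOfModule U).asAlgebraHom a u = a • u := by
  induction a using MonoidAlgebra.induction_linear with
  | zero => simp
  | add f f' hf hf' => rw [map_add, LinearMap.add_apply, hf, hf', add_smul]
  | single g r =>
    rw [Representation.asAlgebraHom_single, LinearMap.smul_apply]
    change r • MonoidAlgebra.of k G g • u = _
    rw [← smul_assoc, MonoidAlgebra.of_apply, MonoidAlgebra.smul_single, smul_eq_mul, mul_one]

theorem isStableAt_of_repIso {U : BModule k (MonoidAlgebra k G)} {x : Gt}
    (h : RepIso (twist (repOfModule U) (MulAut.conjNormal x⁻¹ : MulAut G)) (repOfModule U)) :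
    IsStableAt k Gt G x U := by
  obtain ⟨e, he⟩ := h
  refine ⟨e.toAddEquiv, fun a u => ?_⟩
  have := he.asAlgebraHom a u
  rw [asAlgebraHom_comp, repOfModule_asAlgebraHom, repOfModule_asAlgebraHom] at this
  rw [conjHom_eq_conjNormal]
  exact this

theorem exists_pow_prime_pow_eq_one {p : ℕ} [Fact p.Prime] [Finite Gt]
    (hp : IsPGroup p (Gt ⧸ G)) (w : Gt) :
    ∃ c m : ℕ, (w ^ c) ^ p ^ m = 1 ∧ w * (w ^ c)⁻¹ ∈ G := by
  obtain ⟨m, n, hn, hw⟩ := Nat.exists_eq_pow_mul_and_not_dvd (orderOf_pos w).ne' p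
    (Fact.out : p.Prime).ne_one
  have hcop : Nat.Coprime (p ^ m) n :=
    Nat.Coprime.pow_left m (((Fact.out : p.Prime).coprime_iff_not_dvd).2 hn)
  obtain ⟨c, hc1, hc2⟩ := Nat.chineseRemainder hcop 1 0
  refine ⟨c, m, ?_, ?_⟩
  · rw [← pow_mul, ← orderOf_dvd_iff_pow_eq_one, hw, mul_comm]
    exact Nat.mul_dvd_mul ((Nat.modEq_zero_iff_dvd).1 hc2) dvd_rfl
  · obtain ⟨j, hj⟩ := IsPGroup.iff_orderOf.1 hp (w : Gt ⧸ G)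
    have h1 : p ^ j ∣ p ^ m := by
      have h2 : orderOf (w : Gt ⧸ G) ∣ orderOf w := orderOf_map_dvd (QuotientGroup.mk' G) w
      rw [hj, hw] at h2
      exact (Nat.Coprime.pow_left j
        (((Fact.out : p.Prime).coprime_iff_not_dvd).2 hn)).dvd_of_dvd_mul_right h2
    have h3 : (w : Gt ⧸ G) ^ c = (w : Gt ⧸ G) ^ 1 :=
      pow_eq_pow_iff_modEq.2 (hj ▸ hc1.of_dvd h1)
    rw [← QuotientGroup.eq_one_iff, QuotientGroup.mk_mul, QuotientGroup.mk_inv,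
      QuotientGroup.mk_pow, h3, pow_one, mul_inv_cancel]

end Stability

/-- For a `G̃`-stable block `B` of `kG` with cyclic defect groups and
`G̃/G` a `p`-group, every indecomposable `B`-module is `G̃`-stable. -/
theorem statement_13 (k : Type) [Field k] [IsAlgClosed k]
    (p : ℕ) [Fact p.Prime] [CharP k p]
    (Gt : Type) [Group Gt] [Finite Gt] (G : Subgroup Gt) [G.Normal]
    (hp : IsPGroup p (Gt ⧸ G))
    (b : MonoidAlgebra k ↥G) (hb : IsBlockIdem (MonoidAlgebra k ↥G) b)
    (hstable : ∀ x : Gt, Commute (MonoidAlgebra.of k Gt x) (MapAlong k G.subtype b))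
    (D : Subgroup ↥G) (hD : IsDefectGroup k ↥G b D) (hcyc : IsCyclic ↥D) :
    ∀ U : BModule k (MonoidAlgebra k ↥G),
      Module.Finite (MonoidAlgebra k ↥G) ↥U → LiesIn (MonoidAlgebra k ↥G) b ↥U →
      IndecMod (MonoidAlgebra k ↥G) ↥U → IsGtStable k Gt G ↥U := by
  intro U hU hbU _ x
  obtain ⟨Q, hQ, hmin⟩ := exists_minimal_inTr hb.2.1.2
  have hQp : IsPGroup p Q := isPGroup_of_minimal_inTr hQ hmin
  have hQcyc : IsCyclic Q := isCyclic_of_isDefectGroup hb hD hcyc hQp hQ hmin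
  obtain ⟨g, hg⟩ := hb.exists_conj_mem hQ hmin
    (hQ.map_mulEquiv (MulAut.conjNormal x) (mapH_conjNormal_eq (hstable x)))
  set w : Gt := g * x with hw
  have hwQ : ∀ q ∈ Q, MulAut.conjNormal w⁻¹ q ∈ Q := fun q hq => by
    obtain ⟨r, hr, hrq⟩ := hg q hq
    have h1 : (x : Gt) * r * x⁻¹ = (g : Gt)⁻¹ * q * g :=
      (MulAut.conjNormal_apply x r).symm.trans (congrArg Subtype.val hrq)
    have h2 : MulAut.conjNormal w⁻¹ q = r := Subtype.ext <| by
      rw [MulAut.conjNormal_apply, hw, inv_inv, mul_inv_rev]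
      calc x⁻¹ * (g : Gt)⁻¹ * q * (g * x) = x⁻¹ * ((g : Gt)⁻¹ * q * g) * x := by
            simp only [mul_assoc]
        _ = r := by simp [← h1, mul_assoc]
    rw [h2]
    exact hr
  obtain ⟨c, m, hy, hwy⟩ := exists_pow_prime_pow_eq_one hp w
  set y := w ^ c with hyw
  set σ : MulAut G := MulAut.conjNormal y⁻¹ with hσ
  have hσw : σ = (MulAut.conjNormal w⁻¹ : MulAut G) ^ c := by
    rw [hσ, hyw, ← inv_pow, map_pow]
  have hpow : ∀ (τ : MulAut G) (n : ℕ), ⇑(τ ^ n) = (⇑τ)^[n] := fun τ n => by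
    induction n with
    | zero => rfl
    | succ n ih => rw [pow_succ, MulAut.coe_mul, ih, Function.iterate_succ]
  have hiter : ∀ (τ : MulAut G), (∀ q ∈ Q, τ q ∈ Q) → ∀ (n : ℕ), ∀ q ∈ Q, (⇑τ)^[n] q ∈ Q :=
    fun τ hτ n q hq => by
      induction n with
      | zero => exact hq
      | succ n ih => rw [Function.iterate_succ_apply']; exact hτ _ ih
  have hσm : (⇑σ)^[p ^ m] = id := by
    rw [← hpow, hσ, ← map_pow, inv_pow, hy, inv_one, map_one]
    rfl
  have hσQ : ∀ q ∈ Q, σ q ∈ Q := fun q hq => by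
    rw [hσw, hpow]
    exact hiter _ hwQ c q hq
  have hσQ' : ∀ h, σ h ∈ Q ↔ h ∈ Q := fun h => ⟨fun hh => by
    have h1 := hiter σ hσQ (p ^ m - 1) _ hh
    rwa [← Function.iterate_succ_apply, Nat.succ_eq_add_one,
      Nat.sub_add_cancel (Nat.pow_pos (Fact.out : p.Prime).pos), hσm] at h1, hσQ h⟩
  have : Module.Finite k (MonoidAlgebra k G) := inferInstance
  have : FiniteDimensional k U := Module.Finite.trans (MonoidAlgebra k G) U
  have hρ : (repOfModule U).asAlgebraHom b = 1 :=
    LinearMap.ext fun u => (repOfModule_asAlgebraHom U b u).trans (hbU u)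
  have hy : IsStableAt k Gt G y U := isStableAt_of_repIso
    (twistStable k p (Nat.card Q) G Q rfl hQp σ m hσm hσQ' b hb
      (mapH_conjNormal_eq (hstable y⁻¹)) hQ U (repOfModule U) hρ)
  have hx : x = (g⁻¹ : G) * ((⟨w * y⁻¹, hwy⟩ : G) * y) := by
    simp [hw]
  rw [hx]
  exact (isStableAt_coe _).mul ((isStableAt_coe _).mul hy)

end Paper
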